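/- Let Γ be a finite simplicial graph. Then Aut⁰(A_Γ) is finitely presented: there exist a finite set S, a finite set of relations R ⊆ FreeGroup(S), and a group isomorphism between Aut⁰(A_Γ) and the presented group with generators S and relators R. -/

import Mathlib

open SimpleGraph

namespace RaagPaper

variable {V : Type} [Fintype V] [DecidableEq V]

/-- The defining relations of the right-angled Artin group of a graph `Γ`. -/
def Rels (Γ : SimpleGraph V) : Set (FreeGroup V) :=
  {r | ∃ u v : V, Γ.Adj u v ∧
    r = FreeGroup.of u * FreeGroup.of v * (FreeGroup.of u)⁻¹ * (FreeGroup.of v)⁻¹}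

/-- The right-angled Artin group of `Γ`. -/
abbrev Raag (Γ : SimpleGraph V) := PresentedGroup (Rels Γ)

/-- The generator of `Raag Γ` corresponding to the vertex `v`. -/
def gen (Γ : SimpleGraph V) (v : V) : Raag Γ := PresentedGroup.of v

/-- The link of a vertex. -/
def lk (Γ : SimpleGraph V) (v : V) : Set V := Γ.neighborSet v

/-- The star of a vertex. -/
def st (Γ : SimpleGraph V) (v : V) : Set V := insert v (Γ.neighborSet v)

/-- The partial preorder `v ≤ w ↔ lk v ⊆ st w` on vertices. -/
def Le (Γ : SimpleGraph V) (v w : V) : Prop := lk Γ v ⊆ st Γ w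

/-- The equivalence `v ∼ w`. -/
def Sim (Γ : SimpleGraph V) (v w : V) : Prop := Le Γ v w ∧ Le Γ w v

/-- The equivalence class of a vertex under `∼`. -/
def simClass (Γ : SimpleGraph V) (v : V) : Set V := {u | Sim Γ u v}

/-- Property (B1): any two distinct non-adjacent vertices are `∼`-equivalent. -/
def B1 (Γ : SimpleGraph V) : Prop :=
  ∀ u v : V, u ≠ v → ¬ Γ.Adj u v → Sim Γ u v

/-- Property (B2). -/
def B2 (Γ : SimpleGraph V) : Prop :=
  ∀ v w : V, v ≠ w → Le Γ v w → ∃ u : V, u ≠ v ∧ u ≠ w ∧ Le Γ v u ∧ Le Γ u w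

/-- `α` is the transvection `t_{vw}` for some `v ≤ w`. -/
def IsTransvection (Γ : SimpleGraph V) (α : MulAut (Raag Γ)) : Prop :=
  ∃ v w : V, v ≠ w ∧ Le Γ v w ∧ α (gen Γ v) = gen Γ v * gen Γ w ∧
    ∀ z : V, z ≠ v → α (gen Γ z) = gen Γ z

/-- `Y` is (the vertex set of) a connected component of the subgraph of `Γ` induced on `S`. -/
def IsCompOf (Γ : SimpleGraph V) (S : Set V) (Y : Set V) : Prop :=
  ∃ C : (Γ.induce S).ConnectedComponent, Y = Subtype.val '' C.supp

/-- `α` is a partial conjugation `c_{v,Y}`. -/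
def IsPartialConj (Γ : SimpleGraph V) (α : MulAut (Raag Γ)) : Prop :=
  ∃ (v : V) (Y : Set V), IsCompOf Γ (st Γ v)ᶜ Y ∧
    (∀ y ∈ Y, α (gen Γ y) = (gen Γ v)⁻¹ * gen Γ y * gen Γ v) ∧
    (∀ z : V, z ∉ Y → α (gen Γ z) = gen Γ z)

/-- `α` is the inversion `ι_v`. -/
def IsInversion (Γ : SimpleGraph V) (α : MulAut (Raag Γ)) : Prop :=
  ∃ v : V, α (gen Γ v) = (gen Γ v)⁻¹ ∧ ∀ z : V, z ≠ v → α (gen Γ z) = gen Γ z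

/-- `SAut⁰(A_Γ)`: the subgroup generated by transvections and partial conjugations. -/
def SAut0 (Γ : SimpleGraph V) : Subgroup (MulAut (Raag Γ)) :=
  Subgroup.closure {α | IsTransvection Γ α ∨ IsPartialConj Γ α}

/-- `Aut⁰(A_Γ)`: the subgroup generated by transvections, partial conjugations and inversions. -/
def Aut0 (Γ : SimpleGraph V) : Subgroup (MulAut (Raag Γ)) :=
  Subgroup.closure {α | IsTransvection Γ α ∨ IsPartialConj Γ α ∨ IsInversion Γ α}

/-- The natural map `Aut(A_Γ) → Aut(A_Γ^{ab})`. -/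
def abAutHom (Γ : SimpleGraph V) :
    MulAut (Raag Γ) →* MulAut (Abelianization (Raag Γ)) :=
  MonoidHom.mk' (fun e => MulEquiv.abelianizationCongr e) (by
    intro e f
    exact (abelianizationCongr_trans f e).symm)

/-- The Torelli subgroup `IA_Γ`. -/
def IA (Γ : SimpleGraph V) : Subgroup (MulAut (Raag Γ)) := (abAutHom Γ).ker

/-- The subgroup of `m`-th powers of `A_Γ^{ab}`; the quotient by it is `A_Γ^{ab} ⊗ ℤ/mℤ`. -/
def powN (Γ : SimpleGraph V) (m : ℕ) : Subgroup (Abelianization (Raag Γ)) :=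
  (powMonoidHom m : Abelianization (Raag Γ) →* Abelianization (Raag Γ)).range

/-- `IA_Γ(m)`: the kernel of `Aut(A_Γ) → Aut(A_Γ^{ab} ⊗ ℤ/mℤ)`, i.e. the automorphisms
acting trivially on the abelianization modulo `m`-th powers. -/
def IAm (Γ : SimpleGraph V) (m : ℕ) : Subgroup (MulAut (Raag Γ)) where
  carrier := {α | ∀ x : Abelianization (Raag Γ), abAutHom Γ α x * x⁻¹ ∈ powN Γ m}
  one_mem' := by
    intro x
    simp only [map_one, MulAut.one_apply, mul_inv_cancel]
    exact one_mem _
  mul_mem' := by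
    intro a b ha hb x
    have h : abAutHom Γ (a * b) x * x⁻¹ =
        (abAutHom Γ a (abAutHom Γ b x) * (abAutHom Γ b x)⁻¹) * (abAutHom Γ b x * x⁻¹) := by
      simp only [map_mul, MulAut.mul_apply]
      group
    rw [h]
    exact mul_mem (ha _) (hb x)
  inv_mem' := by
    intro a ha x
    have h : abAutHom Γ a (abAutHom Γ a⁻¹ x) = x := by
      have : abAutHom Γ a * abAutHom Γ a⁻¹ = 1 := by
        rw [← map_mul, mul_inv_cancel, map_one]
      calc abAutHom Γ a (abAutHom Γ a⁻¹ x) = (abAutHom Γ a * abAutHom Γ a⁻¹) x := rfl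
        _ = x := by rw [this]; rfl
    have := inv_mem (ha (abAutHom Γ a⁻¹ x))
    rw [h] at this
    simpa [mul_comm] using this
  
/-- `SIA_Γ(m) = SAut⁰(A_Γ) ∩ IA_Γ(m)`. -/
def SIA (Γ : SimpleGraph V) (m : ℕ) : Subgroup (MulAut (Raag Γ)) := SAut0 Γ ⊓ IAm Γ m

/-- The group of inner automorphisms of `A_Γ`. -/
def innSub (Γ : SimpleGraph V) : Subgroup (MulAut (Raag Γ)) :=
  (MulAut.conj : Raag Γ →* MulAut (Raag Γ)).range


/-- Property (NL): three pairwise distinct, pairwise non-adjacent vertices with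
`v₃ ≤ v₁` and `v₃ ≤ v₂`. -/
def NL (Γ : SimpleGraph V) : Prop :=
  ∃ v₁ v₂ v₃ : V, v₁ ≠ v₂ ∧ v₁ ≠ v₃ ∧ v₂ ≠ v₃ ∧
    ¬ Γ.Adj v₁ v₂ ∧ ¬ Γ.Adj v₁ v₃ ∧ ¬ Γ.Adj v₂ v₃ ∧ Le Γ v₃ v₁ ∧ Le Γ v₃ v₂

open Classical in
/-- The multiset of cardinalities of the equivalence classes of vertices under `∼`. -/
noncomputable def classSizes (Γ : SimpleGraph V) : Multiset ℕ :=
  (Finset.image (fun v => Set.toFinset (simClass Γ v)) Finset.univ).val.map Finset.card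

set_option linter.unusedSectionVars false

section Presentations

section PeakReduction

variable {G X : Type*} [Group G] [MulAction G X]

/-- `Conn Ω N x k α β`: the translates `α • x` and `β • x` are joined by an `Ω`-path of length at
most `k` all of whose interior points have smaller norm than `x`. -/
def Conn (Ω : Set G) (N : X → ℕ) (x : X) (k : ℕ) (α β : G) : Prop :=
  ∃ l : List G, (∀ ω ∈ l, ω ∈ Ω) ∧ l.length ≤ k ∧ l.prod * α = β ∧
    ∀ l₁ l₂, l = l₁ ++ l₂ → l₁ ≠ [] → l₂ ≠ [] → N ((l₂.prod * α) • x) < N x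

theorem Conn.mono {Ω : Set G} {N : X → ℕ} {x : X} {j k : ℕ} {α β : G} (h : Conn Ω N x j α β)
    (hjk : j ≤ k) : Conn Ω N x k α β := by
  obtain ⟨l, h1, h2, h3, h4⟩ := h
  exact ⟨l, h1, h2.trans hjk, h3, h4⟩

theorem Conn.rfl {Ω : Set G} {N : X → ℕ} {x : X} {k : ℕ} {α : G} : Conn Ω N x k α α := by
  refine ⟨[], by simp, by simp, by simp, ?_⟩
  intro l₁ l₂ h h1
  simp_all

theorem Conn.edge {Ω : Set G} {N : X → ℕ} {x : X} {α β ω : G} (hω : ω ∈ Ω) (h : ω * α = β) :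
    Conn Ω N x 1 α β := by
  refine ⟨[ω], by simpa, by simp, by simpa, ?_⟩
  intro l₁ l₂ h h1 h2
  have := congrArg List.length h
  have := List.length_pos_iff.2 h1
  have := List.length_pos_iff.2 h2
  simp at *
  omega

theorem Conn.trans {Ω : Set G} {N : X → ℕ} {x : X} {j k : ℕ} {α β γ : G}
    (h : Conn Ω N x j α γ) (h' : Conn Ω N x k γ β) (hγ : N (γ • x) < N x) :
    Conn Ω N x (j + k) α β := by
  obtain ⟨l, h1, h2, h3, h4⟩ := h
  obtain ⟨l', h1', h2', h3', h4'⟩ := h'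
  refine ⟨l' ++ l, ?_, ?_, ?_, ?_⟩
  · intro ω hω
    rcases List.mem_append.1 hω with h | h
    exacts [h1' _ h, h1 _ h]
  · simp; omega
  · rw [List.prod_append, mul_assoc, h3, h3']
  · intro l₁ l₂ h5 h6 h7
    rcases List.append_eq_append_iff.1 h5 with ⟨m, rfl, rfl⟩ | ⟨m, rfl, rfl⟩
    · by_cases hm : m = []
      · subst hm
        simp only [List.nil_append] at *
        rw [h3]; exact hγ
      · exact h4 m l₂ _root_.rfl hm h7
    · rw [List.prod_append, mul_assoc, h3]
      by_cases hm : m = []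
      · subst hm; simpa using hγ
      · exact h4' l₁ m _root_.rfl h6 hm

theorem Conn.symm {Ω : Set G} (hΩ : ∀ ω ∈ Ω, ω⁻¹ ∈ Ω) {N : X → ℕ} {x : X} {k : ℕ} {α β : G}
    (h : Conn Ω N x k α β) : Conn Ω N x k β α := by
  obtain ⟨l, h1, h2, h3, h4⟩ := h
  have hp : ∀ m : List G, (m.map (·⁻¹)).reverse.prod = m.prod⁻¹ := fun m =>
    (List.prod_inv_reverse m).symm
  refine ⟨(l.map (·⁻¹)).reverse, ?_, by simpa, ?_, ?_⟩
  · intro ω hω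
    simp only [List.mem_reverse, List.mem_map] at hω
    obtain ⟨a, ha, rfl⟩ := hω
    exact hΩ _ (h1 a ha)
  · rw [hp, ← h3]; group
  · intro l₁ l₂ h5 h6 h7
    have h8 : l = (l₂.map (·⁻¹)).reverse ++ (l₁.map (·⁻¹)).reverse := by
      have := congrArg (fun m => (m.map (·⁻¹)).reverse) h5
      simpa [List.map_reverse, Function.comp_def] using this
    have := h4 _ _ h8 (by simpa) (by simpa)
    have e : l₂.prod * β = (l₁.map (·⁻¹)).reverse.prod * α := by
      rw [← h3, h8, List.prod_append, hp, hp]; group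
    rwa [e]

/-- One step of an `Ω`-path in a group `Q` over `G`, staying below level `n`. -/
def Step {Q : Type*} [Group Q] (f : Q →* G) (tl : G → Q) (Ω : Set G) (N : X → ℕ) (x₀ : X) (n : ℕ)
    (q q' : Q) : Prop :=
  ∃ ω ∈ Ω, q' = tl ω * q ∧ N (f q • x₀) < n ∧ N (f q' • x₀) < n

/-- The data of a peak-reducible action. -/
structure PeakReducible (Ω : Set G) (N : X → ℕ) (x₀ : X) (K : ℕ) : Prop where
  inv_mem : ∀ ω ∈ Ω, ω⁻¹ ∈ Ω
  local_conn : ∀ g : G, ∀ α ∈ Ω, ∀ β ∈ Ω, N (α • g • x₀) ≤ N (g • x₀) →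
    N (β • g • x₀) < N (g • x₀) → Conn Ω N (g • x₀) K α β
  min : ∀ g : G, N x₀ ≤ N (g • x₀)
  gen : Subgroup.closure Ω = ⊤

/-- A group over `G` with lifts of the elements of `Ω` satisfying all relations of length at
most `n`. -/
structure LiftRel {Q : Type*} [Group Q] (f : Q →* G) (tl : G → Q) (Ω : Set G) (n : ℕ) : Prop where
  map_tl : ∀ ω ∈ Ω, f (tl ω) = ω
  rel : ∀ l : List G, (∀ ω ∈ l, ω ∈ Ω) → l.length ≤ n → l.prod = 1 → (l.map tl).prod = 1

variable {Q : Type*} [Group Q] {f : Q →* G} {tl : G → Q} {Ω : Set G} {N : X → ℕ} {x₀ : X} {K : ℕ}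

theorem LiftRel.map_prod {n : ℕ} (hL : LiftRel f tl Ω n) (l : List G) (hl : ∀ ω ∈ l, ω ∈ Ω) :
    f ((l.map tl).prod) = l.prod := by
  induction l with
  | nil => simp
  | cons a l ih =>
    simp only [List.mem_cons, forall_eq_or_imp] at hl
    simp [ih hl.2, hL.map_tl a hl.1]

theorem LiftRel.inv (hP : PeakReducible Ω N x₀ K) (hL : LiftRel f tl Ω (K + 2)) {ω : G}
    (hω : ω ∈ Ω) : tl ω⁻¹ = (tl ω)⁻¹ := by
  have := hL.rel [ω⁻¹, ω] (by simp [hω, hP.inv_mem]) (by simp) (by simp)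
  simp at this
  exact eq_inv_of_mul_eq_one_left this

theorem LiftRel.conn (hP : PeakReducible Ω N x₀ K) (hL : LiftRel f tl Ω (K + 2)) {α β : G}
    (hα : α ∈ Ω) (hβ : β ∈ Ω) {l : List G} (hl : ∀ ω ∈ l, ω ∈ Ω) (hlen : l.length ≤ K)
    (h : l.prod * α = β) : (l.map tl).prod * tl α = tl β := by
  have := hL.rel (β⁻¹ :: (l ++ [α])) (by
    intro ω hω
    simp only [List.mem_cons, List.mem_append, List.not_mem_nil, or_false] at hω
    rcases hω with rfl | h | rfl
    exacts [hP.inv_mem _ hβ, hl _ h, hα]) (by simp; omega) (by simp [h])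
  simp only [List.map_cons, List.map_append, List.map_nil, List.prod_cons, List.prod_append,
    List.prod_nil, mul_one, hL.inv hP hβ] at this
  exact (inv_mul_eq_one.1 this).symm

theorem Step.mono {m n : ℕ} (hmn : m ≤ n) {q q' : Q} (h : Step f tl Ω N x₀ m q q') :
    Step f tl Ω N x₀ n q q' := by
  obtain ⟨ω, h1, h2, h3, h4⟩ := h
  exact ⟨ω, h1, h2, by omega, by omega⟩

open Relation

theorem Step.path_mono {m n : ℕ} (hmn : m ≤ n) {q q' : Q}
    (h : ReflTransGen (Step f tl Ω N x₀ m) q q') : ReflTransGen (Step f tl Ω N x₀ n) q q' := by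
  induction h with
  | refl => exact ReflTransGen.refl
  | tail _ h ih => exact ih.tail (h.mono hmn)

theorem LiftRel.path {k n : ℕ} (hL : LiftRel f tl Ω k) (q : Q) (l : List G) (hl : ∀ ω ∈ l, ω ∈ Ω)
    (h : ∀ l₁ l₂, l = l₁ ++ l₂ → N ((l₂.prod * f q) • x₀) < n) :
    ReflTransGen (Step f tl Ω N x₀ n) q ((l.map tl).prod * q) := by
  induction l with
  | nil => simpa using ReflTransGen.refl
  | cons a l ih =>
    simp only [List.mem_cons, forall_eq_or_imp] at hl
    refine (ih hl.2 fun l₁ l₂ h' => h (a :: l₁) l₂ (by simp [h'])).tail ⟨a, hl.1, ?_, ?_, ?_⟩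
    · simp [mul_assoc]
    · have := h [a] l (by simp)
      rwa [map_mul, hL.map_prod l hl.2]
    · have := h [] (a :: l) (by simp)
      rw [map_mul, hL.map_prod (a :: l) (by simpa using hl)]
      exact this

theorem LiftRel.path_invariant (hP : PeakReducible Ω N x₀ K) (hL : LiftRel f tl Ω (K + 2)) {n : ℕ}
    {q q' : Q} (h : ReflTransGen (Step f tl Ω N x₀ (n + 1)) q q') (hq : N (f q • x₀) < n) :
    (N (f q' • x₀) < n ∧ ReflTransGen (Step f tl Ω N x₀ n) q q') ∨
    (N (f q' • x₀) = n ∧ (∃ ω ∈ Ω, N ((ω * f q') • x₀) < n) ∧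
      ∀ ω ∈ Ω, N ((ω * f q') • x₀) < n → ReflTransGen (Step f tl Ω N x₀ n) q (tl ω * q')) := by
  induction h with
  | refl => exact Or.inl ⟨hq, ReflTransGen.refl⟩
  | @tail p y _ hstep ih =>
    obtain ⟨ω, hω, rfl, hp, hy⟩ := hstep
    have hfy : f (tl ω * p) = ω * f p := by rw [map_mul, hL.map_tl _ hω]
    have hpy : tl ω⁻¹ * (tl ω * p) = p := by rw [hL.inv hP hω]; group
    rcases ih with ⟨h1, h2⟩ | ⟨h1, ⟨ω₁, hω₁, hω₁'⟩, h2⟩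
    · by_cases hyn : N (f (tl ω * p) • x₀) < n
      · exact Or.inl ⟨hyn, h2.tail ⟨ω, hω, rfl, h1, hyn⟩⟩
      · have hyn' : N (f (tl ω * p) • x₀) = n := by omega
        refine Or.inr ⟨hyn', ⟨ω⁻¹, hP.inv_mem _ hω, ?_⟩, ?_⟩
        · rw [hfy]; simpa using h1
        · intro ω' hω' hlt
          obtain ⟨l, hl1, hl2, hl3, hl4⟩ := hP.local_conn (f (tl ω * p)) ω⁻¹ (hP.inv_mem _ hω) ω' hω'
            (by rw [hyn', hfy, mul_smul, inv_smul_smul]; omega)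
            (by rw [smul_smul, hyn']; exact hlt)
          have e := hL.conn hP (hP.inv_mem _ hω) hω' hl1 hl2 hl3
          have hpath := hL.path (N := N) (x₀ := x₀) (n := n) p l hl1 ?_
          · refine h2.trans ?_
            have e2 : tl ω' * (tl ω * p) = (l.map tl).prod * p := by
              rw [← e, mul_assoc, hpy]
            rw [e2]; exact hpath
          · intro l₁ l₂ hll
            by_cases h1' : l₁ = []
            · subst h1'
              simp only [List.nil_append] at hll
              subst hll
              have : l.prod * f p = ω' * f (tl ω * p) := by
                rw [← hl3, hfy]; group
              rw [this]; exact hlt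
            · by_cases h2' : l₂ = []
              · subst h2'; simpa using h1
              · have := hl4 l₁ l₂ hll h1' h2'
                rw [hyn', hfy] at this
                simpa [mul_smul] using this
    · by_cases hyn : N (f (tl ω * p) • x₀) < n
      · exact Or.inl ⟨hyn, h2 ω hω (by rwa [← hfy])⟩
      · have hyn' : N (f (tl ω * p) • x₀) = n := by omega
        refine Or.inr ⟨hyn', ?_, ?_⟩
        · obtain ⟨l, hl1, hl2, hl3, hl4⟩ := (hP.local_conn (f p) ω hω ω₁ hω₁
            (by rw [smul_smul, ← hfy]; omega) (by rw [smul_smul, h1]; exact hω₁'))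
          rcases List.eq_nil_or_concat l with rfl | ⟨l', ω₂, rfl⟩
          · simp only [List.prod_nil, one_mul] at hl3
            subst hl3
            rw [hfy] at hyn'
            omega
          · refine ⟨ω₂, hl1 ω₂ (by simp), ?_⟩
            by_cases hl' : l' = []
            · subst hl'
              have : ω₂ * f (tl ω * p) = ω₁ * f p := by
                rw [← hl3, hfy]; simp [mul_assoc]
              rw [this]; exact hω₁'
            · have := hl4 l' [ω₂] (by simp) hl' (by simp)
              rw [h1] at this
              rw [hfy]
              simpa [mul_smul] using this
        · intro ω' hω' hlt
          obtain ⟨l, hl1, hl2, hl3, hl4⟩ := hP.local_conn (f (tl ω * p)) ω⁻¹ (hP.inv_mem _ hω) ω' hω'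
            (by rw [hyn', hfy, mul_smul, inv_smul_smul]; omega)
            (by rw [smul_smul, hyn']; exact hlt)
          have e := hL.conn hP (hP.inv_mem _ hω) hω' hl1 hl2 hl3
          have e2 : tl ω' * (tl ω * p) = (l.map tl).prod * p := by
            rw [← e, mul_assoc, hpy]
          have e3 : l.prod * f p = ω' * f (tl ω * p) := by
            rw [← hl3, hfy]; group
          rcases List.eq_nil_or_concat l with rfl | ⟨l', ω₂, rfl⟩
          · simp only [List.prod_nil, one_mul] at e3
            rw [← e3] at hlt
            omega
          · have hm : ω₂ ∈ Ω := hl1 ω₂ (by simp)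
            have hlow : ∀ l₁ l₂, l' = l₁ ++ l₂ → N ((l₂.prod * f (tl ω₂ * p)) • x₀) < n := by
              intro l₁ l₂ hll
              have e4 : l₂.prod * f (tl ω₂ * p) = (l₂ ++ [ω₂]).prod * f p := by
                simp [hL.map_tl _ hm, mul_assoc]
              rw [e4]
              by_cases h1' : l₁ = []
              · subst h1'
                simp only [List.nil_append] at hll
                subst hll
                simp only [List.concat_eq_append] at e3
                rw [e3]; exact hlt
              · have := hl4 l₁ (l₂ ++ [ω₂]) (by simp [hll]) h1' (by simp)
                rw [hyn', hfy] at this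
                simpa [mul_smul] using this
            have hpath := hL.path (N := N) (x₀ := x₀) (n := n) (tl ω₂ * p) l'
              (fun ω hω => hl1 ω (by simp [hω])) hlow
            have h0 : N ((ω₂ * f p) • x₀) < n := by
              have := hlow l' [] (by simp)
              rwa [List.prod_nil, one_mul, map_mul, hL.map_tl _ hm] at this
            refine (h2 ω₂ hm h0).trans ?_
            rw [e2]
            simpa [mul_assoc] using hpath

theorem LiftRel.reduce (hP : PeakReducible Ω N x₀ K) (hL : LiftRel f tl Ω (K + 2)) {m n : ℕ}
    {q : Q} (h : ReflTransGen (Step f tl Ω N x₀ n) 1 q) (hm : N x₀ ≤ m) (hq : N (f q • x₀) ≤ m) :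
    ReflTransGen (Step f tl Ω N x₀ (m + 1)) 1 q := by
  induction n with
  | zero =>
    exact Step.path_mono (by omega) h
  | succ n ih =>
    by_cases hn : m < n
    · rcases hL.path_invariant hP h (by simpa using by omega) with h' | h'
      · exact ih h'.2
      · omega
    · exact Step.path_mono (by omega) h

theorem LiftRel.exists_path (hP : PeakReducible Ω N x₀ K) (hL : LiftRel f tl Ω (K + 2)) {q : Q}
    (hq : q ∈ Subgroup.closure (tl '' Ω)) : ∃ n, ReflTransGen (Step f tl Ω N x₀ n) 1 q := by
  have key : ∀ ω ∈ Ω, ∀ y : Q, (∃ n, ReflTransGen (Step f tl Ω N x₀ n) 1 y) →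
      ∃ n, ReflTransGen (Step f tl Ω N x₀ n) 1 (tl ω * y) := by
    rintro ω hω y ⟨n, hn⟩
    refine ⟨n + N (f y • x₀) + N (f (tl ω * y) • x₀) + 1, ReflTransGen.tail
      (Step.path_mono (by omega) hn) ⟨ω, hω, rfl, by omega, by omega⟩⟩
  induction hq using Subgroup.closure_induction_left with
  | one => exact ⟨0, ReflTransGen.refl⟩
  | mul_left x hx y _ ih =>
    obtain ⟨ω, hω, rfl⟩ := hx
    exact key ω hω y ih
  | inv_mul_cancel x hx y _ ih =>
    obtain ⟨ω, hω, rfl⟩ := hx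
    rw [← hL.inv hP hω]
    exact key _ (hP.inv_mem _ hω) y ih

theorem PeakReducible.exists_lt (hP : PeakReducible Ω N x₀ K) (g : G) (hg : N x₀ < N (g • x₀)) :
    ∃ ω ∈ Ω, N ((ω * g) • x₀) < N (g • x₀) := by
  have hL : LiftRel (MonoidHom.id G) id Ω (K + 2) :=
    ⟨fun _ _ => rfl, fun l _ _ h => by simpa using h⟩
  obtain ⟨n, hn⟩ := hL.exists_path hP (q := g) (by simp [hP.gen])
  have h := hL.reduce hP hn hg.le le_rfl
  rcases hL.path_invariant hP h (by simpa using hg) with h' | h'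
  · exact absurd h'.1 (lt_irrefl _)
  · exact h'.2.1

theorem finite_lists_of_length_le {α : Type*} {s : Set α} (hs : s.Finite) (n : ℕ) :
    {l : List α | (∀ a ∈ l, a ∈ s) ∧ l.length ≤ n}.Finite := by
  have : Finite s := hs
  refine ((List.finite_length_le s n).image (List.map Subtype.val)).subset ?_
  rintro l ⟨h1, h2⟩
  exact ⟨l.attachWith (· ∈ s) h1, by simpa using h2, by simp⟩

theorem isFinitelyPresented_of_relators {F G : Type*} [Group F] [Group G]
    [Group.IsFinitelyPresented F] (f : F →* G) (hf : Function.Surjective f) (R : Set F)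
    (hR : R.Finite) (hRf : ∀ r ∈ R, f r = 1)
    (h : ∀ x, f x = 1 → (QuotientGroup.mk' (Subgroup.normalClosure R)) x = 1) :
    Group.IsFinitelyPresented G := by
  refine Group.IsFinitelyPresented.of_surjective f hf ⟨R, hR, le_antisymm ?_ ?_⟩
  · exact Subgroup.normalClosure_le_normal hRf
  · intro x hx
    exact (QuotientGroup.eq_one_iff x).1 (h x hx)

theorem exists_list_prod_of_closure (hΩ : ∀ ω ∈ Ω, ω⁻¹ ∈ Ω) {g : G}
    (hg : g ∈ Subgroup.closure Ω) : ∃ l : List G, (∀ ω ∈ l, ω ∈ Ω) ∧ l.prod = g := by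
  induction hg using Subgroup.closure_induction_left with
  | one => exact ⟨[], by simp, by simp⟩
  | mul_left x hx y _ ih =>
    obtain ⟨l, h1, h2⟩ := ih
    exact ⟨x :: l, by simpa [hx] using h1, by simp [h2]⟩
  | inv_mul_cancel x hx y _ ih =>
    obtain ⟨l, h1, h2⟩ := ih
    exact ⟨x⁻¹ :: l, by simpa [hΩ x hx] using h1, by simp [h2]⟩

theorem PeakReducible.isFinitelyPresented_of_cover (hP : PeakReducible Ω N x₀ K) (hfin : Ω.Finite)
    (hM : {x | x ∈ MulAction.orbit G x₀ ∧ N x = N x₀}.Finite)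
    [hH : Group.IsFinitelyPresented (MulAction.stabilizer G x₀)]
    {F : Type*} [Group F] [Group.IsFinitelyPresented F] (f : F →* G) (t : G → F)
    (iH : MulAction.stabilizer G x₀ →* F) (ft : ∀ ω ∈ Ω, f (t ω) = ω) (fH : ∀ h, f (iH h) = h)
    (hFgen : ∀ C : Subgroup F, (∀ ω ∈ Ω, t ω ∈ C) → (∀ h, iH h ∈ C) → C = ⊤) :
    Group.IsFinitelyPresented G := by
  classical
  have fprod : ∀ l : List G, (∀ ω ∈ l, ω ∈ Ω) → f ((l.map t).prod) = l.prod := by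
    intro l hl
    induction l with
    | nil => simp
    | cons a l ih =>
      simp only [List.mem_cons, forall_eq_or_imp] at hl
      simp [ih hl.2, ft a hl.1]
  have hword : ∀ g : G, ∃ l : List G, (∀ ω ∈ l, ω ∈ Ω) ∧ l.prod = g := fun g =>
    exists_list_prod_of_closure hP.inv_mem (by rw [hP.gen]; trivial)
  have hsurj : Function.Surjective f := by
    intro g
    obtain ⟨l, hl, rfl⟩ := hword g
    exact ⟨_, fprod l hl⟩
  have hp : ∃ p : X → F, p x₀ = 1 ∧ ∀ x ∈ MulAction.orbit G x₀, f (p x) • x₀ = x := by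
    have : ∀ x, ∃ y : F, (x = x₀ → y = 1) ∧ (x ∈ MulAction.orbit G x₀ → f y • x₀ = x) := by
      intro x
      by_cases hx : x = x₀
      · exact ⟨1, by simp, by simp [hx]⟩
      · by_cases hx' : x ∈ MulAction.orbit G x₀
        · obtain ⟨g, rfl⟩ := hx'
          obtain ⟨y, rfl⟩ := hsurj g
          exact ⟨y, by simp [hx], by simp⟩
        · exact ⟨1, by simp, by simp [hx']⟩
    choose p h1 h2 using this
    exact ⟨p, h1 x₀ rfl, h2⟩
  obtain ⟨p, hp0, hp⟩ := hp
  have hpH : ∀ (ω : G) (x : X), ∃ h : MulAction.stabilizer G x₀, x ∈ MulAction.orbit G x₀ →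
      ω * f (p x) = f (p (ω • x)) * h := by
    intro ω x
    by_cases hx : x ∈ MulAction.orbit G x₀
    · have hx' : ω • x ∈ MulAction.orbit G x₀ := MulAction.mem_orbit_of_mem_orbit ω hx
      refine ⟨⟨(f (p (ω • x)))⁻¹ * (ω * f (p x)), ?_⟩, fun _ => by simp⟩
      rw [MulAction.mem_stabilizer_iff, mul_smul, mul_smul, hp x hx, inv_smul_eq_iff,
        hp _ hx']
    · exact ⟨1, fun h => absurd h hx⟩
  choose hh hhh using hpH
  have hHfg : ∃ T : Set (MulAction.stabilizer G x₀), T.Finite ∧ Subgroup.closure T = ⊤ := by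
    obtain ⟨n, φ, hφ, _⟩ := hH.out
    refine ⟨Set.range (fun i => φ (FreeGroup.of i)), Set.finite_range _, ?_⟩
    rw [Set.range_comp' φ FreeGroup.of, ← MonoidHom.map_closure, FreeGroup.closure_range_of,
      ← MonoidHom.range_eq_map, MonoidHom.range_eq_top.2 hφ]
  obtain ⟨T, hTfin, hT⟩ := hHfg
  choose wd hwd hwd' using hword
  let R₁ : Set F := (fun l : List G => (l.map t).prod) ''
    {l | ((∀ ω ∈ l, ω ∈ Ω) ∧ l.length ≤ K + 2) ∧ l.prod = 1}
  let R₂ : Set F := (fun z : G × X => (t z.1 * p z.2)⁻¹ *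
      (p (z.1 • z.2) * iH (hh z.1 z.2))) ''
    (Ω ×ˢ {x | x ∈ MulAction.orbit G x₀ ∧ N x = N x₀})
  let R₃ : Set F := (fun h : MulAction.stabilizer G x₀ => (iH h)⁻¹ * ((wd h).map t).prod) '' T
  refine isFinitelyPresented_of_relators f hsurj (R₁ ∪ R₂ ∪ R₃) ?_ ?_ ?_
  · refine ((Set.Finite.image _ ?_).union (Set.Finite.image _ (hfin.prod hM))).union (hTfin.image _)
    exact (finite_lists_of_length_le hfin (K + 2)).subset fun l hl => hl.1
  · rintro r ((⟨l, hl, rfl⟩ | ⟨⟨ω, x⟩, ⟨hω, hx⟩, rfl⟩) | ⟨h, _, rfl⟩)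
    · exact (fprod l hl.1.1).trans hl.2
    · simp only at hω hx ⊢
      rw [map_mul, map_inv, map_mul, map_mul, ft _ hω, fH, ← hhh ω x hx.1]
      simp
    · simp only
      rw [map_mul, map_inv, fH, fprod _ (hwd _), hwd']
      simp
  · set R := R₁ ∪ R₂ ∪ R₃ with hRdef
    set π := QuotientGroup.mk' (Subgroup.normalClosure R) with hπ
    have hπR : ∀ r ∈ R, π r = 1 := fun r hr =>
      (QuotientGroup.eq_one_iff r).2 (Subgroup.subset_normalClosure hr)
    have hker : Subgroup.normalClosure R ≤ f.ker := by
      refine Subgroup.normalClosure_le_normal ?_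
      rintro r ((⟨l, hl, rfl⟩ | ⟨⟨ω, x⟩, ⟨hω, hx⟩, rfl⟩) | ⟨h, _, rfl⟩)
      · exact (fprod l hl.1.1).trans hl.2
      · simp only at hω hx ⊢
        change f _ = 1
        rw [map_mul, map_inv, map_mul, map_mul, ft _ hω, fH, ← hhh ω x hx.1]
        simp
      · change f _ = 1
        rw [map_mul, map_inv, fH, fprod _ (hwd _), hwd']
        simp
    let f' : (F ⧸ Subgroup.normalClosure R) →* G := QuotientGroup.lift _ f hker
    have hf' : ∀ x, f' (π x) = f x := fun x => QuotientGroup.lift_mk _ _ _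
    have hL : LiftRel f' (fun g => π (t g)) Ω (K + 2) := by
      refine ⟨fun ω hω => by rw [hf', ft ω hω], fun l hl hlen hprod => ?_⟩
      have := hπR _ (Or.inl (Or.inl ⟨l, ⟨⟨hl, hlen⟩, hprod⟩, rfl⟩))
      simpa [map_list_prod, Function.comp_def] using this
    have hgen : Subgroup.closure ((fun g => π (t g)) '' Ω) = ⊤ := by
      set C := Subgroup.closure ((fun g => π (t g)) '' Ω) with hC
      have hΩC : ∀ ω ∈ Ω, π (t ω) ∈ C := fun ω hω => Subgroup.subset_closure ⟨ω, hω, rfl⟩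
      have hlC : ∀ l : List G, (∀ ω ∈ l, ω ∈ Ω) → π ((l.map t).prod) ∈ C := by
        intro l hl
        rw [map_list_prod]
        refine Subgroup.list_prod_mem _ ?_
        intro x hx
        simp only [List.map_map, List.mem_map, Function.comp] at hx
        obtain ⟨ω, hω, rfl⟩ := hx
        exact hΩC ω (hl ω hω)
      have hHC : ∀ h, iH h ∈ C.comap π := by
        have : Subgroup.closure T ≤ (C.comap π).comap iH := by
          rw [Subgroup.closure_le]
          intro h hh'
          have := hπR _ (Or.inr ⟨h, hh', rfl⟩)
          simp only [map_mul, map_inv] at this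
          change π (iH h) ∈ C
          rw [inv_mul_eq_one.1 this]
          exact hlC _ (hwd _)
        intro h
        exact this (by rw [hT]; trivial)
      have hF : C.comap π = ⊤ := hFgen _ hΩC hHC
      refine eq_top_iff.2 fun q _ => ?_
      obtain ⟨x, rfl⟩ := QuotientGroup.mk'_surjective _ q
      exact (show x ∈ C.comap π by rw [hF]; trivial)
    intro x hx
    obtain ⟨n, hn⟩ := hL.exists_path hP (q := π x) (by rw [hgen]; trivial)
    have hmin := hL.reduce hP hn le_rfl (by rw [hf', hx, one_smul])
    have key : ∀ q, ReflTransGen (Step f' (fun g => π (t g)) Ω N x₀ (N x₀ + 1)) 1 q →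
        ∃ h : MulAction.stabilizer G x₀, q = π (p (f' q • x₀)) * π (iH h) := by
      intro q hq
      induction hq with
      | refl => exact ⟨1, by simp [hp0]⟩
      | @tail q q' _ hs ih =>
        obtain ⟨ω, hω, rfl, h1, h2⟩ := hs
        obtain ⟨h, ih⟩ := ih
        have hx : f' q • x₀ ∈ MulAction.orbit G x₀ := ⟨_, rfl⟩
        have hm : N (f' q • x₀) = N x₀ := le_antisymm (by omega) (hP.min _)
        have hr := hπR _ (Or.inl (Or.inr ⟨(ω, f' q • x₀), ⟨hω, hx, hm⟩, rfl⟩))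
        simp only [map_mul, map_inv] at hr
        have hr' := inv_mul_eq_one.1 hr
        refine ⟨hh ω (f' q • x₀) * h, ?_⟩
        rw [map_mul f', hf', ft ω hω, mul_smul, map_mul, map_mul, ← mul_assoc, ← hr', mul_assoc,
          ← ih]
    obtain ⟨h, hh'⟩ := key _ hmin
    rw [hf', hx, one_smul, hp0, map_one, one_mul] at hh'
    have : f' (π x) = h := by rw [hh', hf', fH]
    rw [hf', hx] at this
    have h1 : h = 1 := Subtype.ext this.symm
    rw [hh', h1, map_one, map_one]

/-- A group with a peak-reducible action, finite minimal level and finitely presented stabilizer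
of the base point is finitely presented. -/
theorem PeakReducible.isFinitelyPresented (hP : PeakReducible Ω N x₀ K) (hfin : Ω.Finite)
    (hM : {x | x ∈ MulAction.orbit G x₀ ∧ N x = N x₀}.Finite)
    [hH : Group.IsFinitelyPresented (MulAction.stabilizer G x₀)] :
    Group.IsFinitelyPresented G := by
  classical
  have : Finite Ω := hfin
  refine hP.isFinitelyPresented_of_cover hfin hM
    (F := Monoid.Coprod (FreeGroup Ω) (MulAction.stabilizer G x₀))
    (Monoid.Coprod.lift (FreeGroup.lift (fun ω : Ω => (ω : G)))
      (MulAction.stabilizer G x₀).subtype)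
    (fun g => if h : g ∈ Ω then Monoid.Coprod.inl (FreeGroup.of ⟨g, h⟩) else 1)
    Monoid.Coprod.inr ?_ ?_ ?_
  · intro ω hω
    simp [hω]
  · intro h; simp
  · intro C h1 h2
    rw [eq_top_iff, ← Monoid.Coprod.range_inl_sup_range_inr, sup_le_iff]
    constructor
    · rw [MonoidHom.range_eq_map, ← FreeGroup.closure_range_of, MonoidHom.map_closure,
        Subgroup.closure_le]
      rintro _ ⟨_, ⟨ω, rfl⟩, rfl⟩
      simpa using h1 ω ω.2
    · rintro _ ⟨h, rfl⟩
      exact h2 h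

end PeakReduction

end Presentations

section AbelianExtensions

section Assembly

variable {G : Type*} [Group G]

theorem assembly_of_cover (L S : Subgroup G) (hfin : ((L ⊓ S : Subgroup G) : Set G).Finite)
    {ι : Type*} [Finite ι] (T : ι → Set G) (hTfin : ∀ k, (T k).Finite)
    (hTinv : ∀ k, ∀ t ∈ T k, t⁻¹ ∈ T k) (hTS : ∀ k, ∀ t ∈ T k, t ∈ S)
    (hS : S ≤ Subgroup.closure ((⋃ k, T k) ∪ ((L ⊓ S : Subgroup G) : Set G)))
    (E : Set G) (hEfin : E.Finite) (hEinv : ∀ l ∈ E, l⁻¹ ∈ E) (hE : Subgroup.closure E = L)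
    (h : ∀ k, ∀ t ∈ T k, ∀ l ∈ E, ∃ c ∈ L, ∃ τ ∈ Subgroup.closure (T k),
      t * l * t⁻¹ = l * c * τ ∧ ∀ t' ∈ T k, c * t' = t' * c)
    {F : Type*} [Group F] [Group.IsFinitelyPresented F] (f : F →* G) (i : L →* F) (j : S →* F)
    (fi : ∀ x, f (i x) = x) (fj : ∀ x, f (j x) = x)
    (hFgen : ∀ C : Subgroup F, (∀ x, i x ∈ C) → (∀ x, j x ∈ C) → C = ⊤) :
    Group.IsFinitelyPresented f.range := by
  classical
  have hEL : ∀ l ∈ E, l ∈ L := fun l hl => hE ▸ Subgroup.subset_closure hl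
  have hcS : ∀ k, Subgroup.closure (T k) ≤ S := fun k => (Subgroup.closure_le _).2 (hTS k)
  let i' : G → F := fun x => if hx : x ∈ L then i ⟨x, hx⟩ else 1
  let j' : G → F := fun x => if hx : x ∈ S then j ⟨x, hx⟩ else 1
  have i'_eq : ∀ x (hx : x ∈ L), i' x = i ⟨x, hx⟩ := fun x hx => dif_pos hx
  have j'_eq : ∀ x (hx : x ∈ S), j' x = j ⟨x, hx⟩ := fun x hx => dif_pos hx
  have fi' : ∀ x ∈ L, f (i' x) = x := fun x hx => by rw [i'_eq x hx, fi]
  have fj' : ∀ x ∈ S, f (j' x) = x := fun x hx => by rw [j'_eq x hx, fj]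
  have i'_mul : ∀ x ∈ L, ∀ y ∈ L, i' (x * y) = i' x * i' y := fun x hx y hy => by
    rw [i'_eq x hx, i'_eq y hy, i'_eq _ (mul_mem hx hy), ← map_mul]; rfl
  have j'_mul : ∀ x ∈ S, ∀ y ∈ S, j' (x * y) = j' x * j' y := fun x hx y hy => by
    rw [j'_eq x hx, j'_eq y hy, j'_eq _ (mul_mem hx hy), ← map_mul]; rfl
  have i'_one : i' 1 = 1 := by rw [i'_eq 1 (one_mem _)]; exact map_one i
  have j'_one : j' 1 = 1 := by rw [j'_eq 1 (one_mem _)]; exact map_one j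
  have j'_inv : ∀ x ∈ S, j' x⁻¹ = (j' x)⁻¹ := fun x hx => by
    rw [eq_inv_iff_mul_eq_one, ← j'_mul _ (inv_mem hx) _ hx, inv_mul_cancel, j'_one]
  have h' : ∀ (k : ι) (t l : G), ∃ c τ : G, t ∈ T k → l ∈ E → c ∈ L ∧
      τ ∈ Subgroup.closure (T k) ∧ t * l * t⁻¹ = l * c * τ ∧ ∀ t' ∈ T k, c * t' = t' * c := by
    intro k t l
    by_cases ht : t ∈ T k
    · by_cases hl : l ∈ E
      · obtain ⟨c, h1, τ, h2, h3⟩ := h k t ht l hl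
        exact ⟨c, τ, fun _ _ => ⟨h1, h2, h3⟩⟩
      · exact ⟨1, 1, fun _ h => absurd h hl⟩
    · exact ⟨1, 1, fun h => absurd h ht⟩
  choose c τ hc using h'
  let R₁ : Set F := (fun x => i' x * (j' x)⁻¹) '' ((L ⊓ S : Subgroup G) : Set G)
  let R₂ : ι → Set F := fun k => (fun z : G × G =>
    j' z.1 * i' z.2 * (j' z.1)⁻¹ * (i' z.2 * i' (c k z.1 z.2) * j' (τ k z.1 z.2))⁻¹) '' (T k ×ˢ E)
  let R₃ : ι → Set F := fun k => (fun z : (G × G) × G =>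
    i' (c k z.1.1 z.1.2) * j' z.2 * (j' z.2 * i' (c k z.1.1 z.1.2))⁻¹) '' ((T k ×ˢ E) ×ˢ T k)
  let R : Set F := R₁ ∪ ((⋃ k, R₂ k) ∪ ⋃ k, R₃ k)
  have hRf : ∀ r ∈ R, f r = 1 := by
    rintro r (⟨x, ⟨hx1, hx2⟩, rfl⟩ | hr | hr)
    · simp [fi' x hx1, fj' x hx2]
    · obtain ⟨k, ⟨t, l⟩, ⟨ht, hl⟩, rfl⟩ := Set.mem_iUnion.1 hr
      obtain ⟨h1, h2, h3, h4⟩ := hc k t l ht hl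
      simp only [map_mul, map_inv, fi' _ h1, fj' _ (hcS k h2), fi' l (hEL l hl),
        fj' t (hTS k t ht), h3]
      group
    · obtain ⟨k, ⟨⟨t, l⟩, t'⟩, ⟨⟨ht, hl⟩, ht'⟩, rfl⟩ := Set.mem_iUnion.1 hr
      obtain ⟨h1, h2, h3, h4⟩ := hc k t l ht hl
      simp only at ht'
      simp only [map_mul, map_inv, fi' _ h1, fj' t' (hTS k t' ht'), h4 t' ht']
      group
  refine isFinitelyPresented_of_relators f.rangeRestrict f.rangeRestrict_surjective R ?_ ?_ ?_
  · refine (hfin.image _).union ((Set.finite_iUnion fun k => ?_).union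
      (Set.finite_iUnion fun k => ?_))
    · exact ((hTfin k).prod hEfin).image _
    · exact (((hTfin k).prod hEfin).prod (hTfin k)).image _
  · intro r hr
    exact Subtype.ext (hRf r hr)
  set π := QuotientGroup.mk' (Subgroup.normalClosure R) with hπ
  have hπR : ∀ r ∈ R, π r = 1 := fun r hr =>
    (QuotientGroup.eq_one_iff r).2 (Subgroup.subset_normalClosure hr)
  have am : ∀ x ∈ L, x ∈ S → π (i' x) = π (j' x) := fun x h1 h2 => by
    have := hπR _ (Or.inl ⟨x, ⟨h1, h2⟩, rfl⟩)
    rw [map_mul, map_inv] at this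
    exact mul_inv_eq_one.1 this
  have rel₂ : ∀ k, ∀ t ∈ T k, ∀ l ∈ E, π (j' t) * π (i' l) * (π (j' t))⁻¹ =
      π (i' l) * π (i' (c k t l)) * π (j' (τ k t l)) := fun k t ht l hl => by
    have := hπR _ (Or.inr (Or.inl (Set.mem_iUnion.2 ⟨k, ⟨(t, l), ⟨ht, hl⟩, rfl⟩⟩)))
    simp only [map_mul, map_inv] at this
    exact mul_inv_eq_one.1 this
  have rel₃ : ∀ k, ∀ t ∈ T k, ∀ l ∈ E, ∀ t' ∈ T k, π (i' (c k t l)) * π (j' t') =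
      π (j' t') * π (i' (c k t l)) := fun k t ht l hl t' ht' => by
    have := hπR _ (Or.inr (Or.inr (Set.mem_iUnion.2 ⟨k, ⟨((t, l), t'), ⟨⟨ht, hl⟩, ht'⟩, rfl⟩⟩)))
    simp only [map_mul, map_inv] at this
    exact mul_inv_eq_one.1 this
  -- elements of `L` commuting with `T k` in the quotient
  let C : ι → Set G := fun k => {x | x ∈ L ∧ ∀ t ∈ Subgroup.closure (T k),
    π (i' x) * π (j' t) = π (j' t) * π (i' x)}
  have hcC : ∀ k, ∀ t ∈ T k, ∀ l ∈ E, c k t l ∈ C k := by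
    intro k t ht l hl
    refine ⟨(hc k t l ht hl).1, fun s hs => ?_⟩
    induction hs using Subgroup.closure_induction_left with
    | one => simp [j'_one]
    | mul_left x hx y hy ih =>
      rw [j'_mul _ (hTS k x hx) _ (hcS k hy), map_mul, ← mul_assoc, rel₃ k t ht l hl x hx,
        mul_assoc, ih, mul_assoc]
    | inv_mul_cancel x hx y hy ih =>
      rw [j'_mul _ (inv_mem (hTS k x hx)) _ (hcS k hy), map_mul, ← mul_assoc,
        rel₃ k t ht l hl _ (hTinv k x hx), mul_assoc, ih, mul_assoc]
  have one_C : ∀ k, 1 ∈ C k := fun k => ⟨one_mem _, fun t _ => by simp [i'_one]⟩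
  have mul_C : ∀ k, ∀ x ∈ C k, ∀ y ∈ C k, x * y ∈ C k := by
    rintro k x ⟨hx, hx'⟩ y ⟨hy, hy'⟩
    refine ⟨mul_mem hx hy, fun t ht => ?_⟩
    rw [i'_mul x hx y hy, map_mul, mul_assoc, hy' t ht, ← mul_assoc, hx' t ht, mul_assoc]
  have move₁ : ∀ k, ∀ s ∈ Subgroup.closure (T k), ∀ l ∈ E, ∃ x ∈ C k,
      ∃ s' ∈ Subgroup.closure (T k), π (j' s) * π (i' l) = π (i' (l * x)) * π (j' s') := by
    intro k s hs l hl
    have key : ∀ x ∈ T k, ∀ y ∈ Subgroup.closure (T k), (∃ z ∈ C k,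
        ∃ s' ∈ Subgroup.closure (T k), π (j' y) * π (i' l) = π (i' (l * z)) * π (j' s')) →
        ∃ z ∈ C k, ∃ s' ∈ Subgroup.closure (T k),
          π (j' (x * y)) * π (i' l) = π (i' (l * z)) * π (j' s') := by
      rintro x hx y hy ⟨z, hz, s', hs', e⟩
      have hx' : x ∈ Subgroup.closure (T k) := Subgroup.subset_closure hx
      obtain ⟨h1, h2, h3, h4⟩ := hc k x l hx hl
      refine ⟨c k x l * z, mul_C k _ (hcC k x hx l hl) z hz, τ k x l * x * s',
        mul_mem (mul_mem h2 hx') hs', ?_⟩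
      have e2 := rel₂ k x hx l hl
      rw [mul_inv_eq_iff_eq_mul] at e2
      have hcz := mul_C k _ (hcC k x hx l hl) z hz
      rw [j'_mul _ (hcS k hx') _ (hcS k hy), map_mul, mul_assoc, e, i'_mul _ (hEL l hl) _ hz.1,
        map_mul, ← mul_assoc, ← mul_assoc, e2, i'_mul _ (hEL l hl) _ hcz.1,
        i'_mul _ h1 _ hz.1, j'_mul _ (hcS k (mul_mem h2 hx')) _ (hcS k hs'),
        j'_mul _ (hcS k h2) _ (hcS k hx')]
      simp only [map_mul]
      have e3 := hz.2 _ (mul_mem h2 hx')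
      rw [j'_mul _ (hcS k h2) _ (hcS k hx'), map_mul] at e3
      calc _ = π (i' l) * π (i' (c k x l)) * ((π (j' (τ k x l)) * π (j' x)) * π (i' z)) *
            π (j' s') := by simp only [mul_assoc]
        _ = _ := by rw [← e3]; simp only [mul_assoc]
    induction hs using Subgroup.closure_induction_left with
    | one => exact ⟨1, one_C k, 1, one_mem _, by simp [j'_one]⟩
    | mul_left x hx y hy ih => exact key x hx y hy ih
    | inv_mul_cancel x hx y hy ih => exact key _ (hTinv k x hx) y hy ih
  have move : ∀ k, ∀ l ∈ L, ∀ s ∈ Subgroup.closure (T k), ∃ l' ∈ L,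
      ∃ s' ∈ Subgroup.closure (T k), π (j' s) * π (i' l) = π (i' l') * π (j' s') := by
    intro k l hl
    rw [← hE] at hl
    have key : ∀ x ∈ E, ∀ y ∈ L, (∀ s ∈ Subgroup.closure (T k), ∃ l' ∈ L,
      ∃ s' ∈ Subgroup.closure (T k), π (j' s) * π (i' y) = π (i' l') * π (j' s')) →
      ∀ s ∈ Subgroup.closure (T k), ∃ l' ∈ L,
      ∃ s' ∈ Subgroup.closure (T k), π (j' s) * π (i' (x * y)) = π (i' l') * π (j' s') := by
      intro x hx y hy ih s hs
      obtain ⟨z, hz, s₁, hs₁, e₁⟩ := move₁ k s hs x hx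
      obtain ⟨l', hl', s₂, hs₂, e₂⟩ := ih s₁ hs₁
      refine ⟨x * z * l', mul_mem (mul_mem (hEL x hx) hz.1) hl', s₂, hs₂, ?_⟩
      rw [i'_mul _ (hEL x hx) _ hy, map_mul, ← mul_assoc, e₁, mul_assoc, e₂,
        i'_mul _ (mul_mem (hEL x hx) hz.1) _ hl', map_mul, mul_assoc]
    induction hl using Subgroup.closure_induction_left with
    | one => exact fun s hs => ⟨1, one_mem _, s, hs, by simp [i'_one]⟩
    | mul_left x hx y hy ih => exact key x hx y (hE ▸ hy) ih
    | inv_mul_cancel x hx y hy ih => exact key _ (hEinv x hx) y (hE ▸ hy) ih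
  -- the product set `L * S` in the quotient
  let P : F → Prop := fun q => ∃ l ∈ L, ∃ s ∈ S, π q = π (i' l) * π (j' s)
  have PL : ∀ x ∈ L, ∀ q, P q → P (i' x * q) := by
    rintro x hx q ⟨l, hl, s, hs, e⟩
    exact ⟨x * l, mul_mem hx hl, s, hs, by rw [map_mul, e, i'_mul x hx l hl, map_mul, mul_assoc]⟩
  have PS : ∀ x ∈ S, ∀ q, P q → P (j' x * q) := by
    intro x hx
    have hgen : ∀ y ∈ (⋃ k, T k) ∪ ((L ⊓ S : Subgroup G) : Set G), y ∈ S ∧ y⁻¹ ∈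
        (⋃ k, T k) ∪ ((L ⊓ S : Subgroup G) : Set G) ∧ ∀ q, P q → P (j' y * q) := by
      rintro y (hy | hy)
      · obtain ⟨k, hy⟩ := Set.mem_iUnion.1 hy
        refine ⟨hTS k y hy, Or.inl (Set.mem_iUnion.2 ⟨k, hTinv k y hy⟩), ?_⟩
        rintro q ⟨l, hl, s, hs, e⟩
        obtain ⟨l', hl', s', hs', e'⟩ := move k l hl y (Subgroup.subset_closure hy)
        exact ⟨l', hl', s' * s, mul_mem (hcS k hs') hs, by
          rw [map_mul, e, ← mul_assoc, e', j'_mul _ (hcS k hs') _ hs, map_mul, mul_assoc]⟩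
      · refine ⟨hy.2, Or.inr (inv_mem hy), ?_⟩
        intro q hq
        obtain ⟨l, hl, s, hs, e⟩ := PL y hy.1 q hq
        exact ⟨l, hl, s, hs, by rw [← e, map_mul, map_mul, am y hy.1 hy.2]⟩
    have hcl : Subgroup.closure ((⋃ k, T k) ∪ ((L ⊓ S : Subgroup G) : Set G)) ≤ S :=
      (Subgroup.closure_le _).2 fun y hy => (hgen y hy).1
    replace hx := hS hx
    induction hx using Subgroup.closure_induction_left with
    | one => simp [j'_one]
    | mul_left x hx y hy ih =>
      intro q hq
      rw [j'_mul _ (hgen x hx).1 _ (hcl hy), mul_assoc]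
      exact (hgen x hx).2.2 _ (ih q hq)
    | inv_mul_cancel x hx y hy ih =>
      intro q hq
      rw [j'_mul _ (inv_mem (hgen x hx).1) _ (hcl hy), mul_assoc]
      exact (hgen _ (hgen x hx).2.1).2.2 _ (ih q hq)
  have Pall : ∀ q, P q := by
    have hP1 : P 1 := ⟨1, one_mem _, 1, one_mem _, by simp [i'_one, j'_one]⟩
    have htop : Subgroup.closure (Set.range i ∪ Set.range j) = ⊤ :=
      hFgen _ (fun x => Subgroup.subset_closure (Or.inl ⟨x, rfl⟩))
        (fun x => Subgroup.subset_closure (Or.inr ⟨x, rfl⟩))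
    have hgi : ∀ x : L, ∀ q, P q → P (i x * q) := fun x q hq => by
      rw [← i'_eq x x.2]; exact PL x x.2 q hq
    have hgj : ∀ x : S, ∀ q, P q → P (j x * q) := fun x q hq => by
      rw [← j'_eq x x.2]; exact PS x x.2 q hq
    intro q
    have hq : q ∈ Subgroup.closure (Set.range i ∪ Set.range j) := by rw [htop]; trivial
    induction hq using Subgroup.closure_induction_left with
    | one => exact hP1
    | mul_left x hx y _ ih =>
      rcases hx with ⟨x, rfl⟩ | ⟨x, rfl⟩
      exacts [hgi x y ih, hgj x y ih]
    | inv_mul_cancel x hx y _ ih =>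
      rcases hx with ⟨x, rfl⟩ | ⟨x, rfl⟩
      · rw [← map_inv]; exact hgi _ y ih
      · rw [← map_inv]; exact hgj _ y ih
  intro q hq
  obtain ⟨l, hl, s, hs, e⟩ := Pall q
  have hker : Subgroup.normalClosure R ≤ f.ker := Subgroup.normalClosure_le_normal hRf
  have hq' : f q = 1 := congrArg Subtype.val hq
  have e1 : f q = l * s := by
    have : (QuotientGroup.lift _ f hker) (π q) = (QuotientGroup.lift _ f hker) (π (i' l * j' s)) := by
      rw [e, ← map_mul π]
    change f q = f (i' l * j' s) at this
    rwa [map_mul, fi' l hl, fj' s hs] at this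
  have hls : l = s⁻¹ := by rw [hq'] at e1; exact eq_inv_of_mul_eq_one_left e1.symm
  have hlS : l ∈ S := hls ▸ inv_mem hs
  rw [e, am l hl hlS, ← map_mul, ← j'_mul l hlS s hs, hls, inv_mul_cancel, j'_one, map_one]

/-- Finite presentability of a group generated by two finitely presented subgroups `L`, `S` with
finite intersection, when the elements of `S` can be sorted past the elements of `L`. -/
theorem isFinitelyPresented_sup (L S : Subgroup G) [Group.IsFinitelyPresented L]
    [Group.IsFinitelyPresented S] (hfin : ((L ⊓ S : Subgroup G) : Set G).Finite)
    {ι : Type*} [Finite ι] (T : ι → Set G) (hTfin : ∀ k, (T k).Finite)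
    (hTinv : ∀ k, ∀ t ∈ T k, t⁻¹ ∈ T k) (hTS : ∀ k, ∀ t ∈ T k, t ∈ S)
    (hS : S ≤ Subgroup.closure ((⋃ k, T k) ∪ ((L ⊓ S : Subgroup G) : Set G)))
    (E : Set G) (hEfin : E.Finite) (hEinv : ∀ l ∈ E, l⁻¹ ∈ E) (hE : Subgroup.closure E = L)
    (h : ∀ k, ∀ t ∈ T k, ∀ l ∈ E, ∃ c ∈ L, ∃ τ ∈ Subgroup.closure (T k),
      t * l * t⁻¹ = l * c * τ ∧ ∀ t' ∈ T k, c * t' = t' * c) :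
    Group.IsFinitelyPresented (L ⊔ S : Subgroup G) := by
  have := assembly_of_cover L S hfin T hTfin hTinv hTS hS E hEfin hEinv hE h
    (F := Monoid.Coprod L S) (Monoid.Coprod.lift L.subtype S.subtype)
    Monoid.Coprod.inl Monoid.Coprod.inr (by simp) (by simp) (by
      intro C h1 h2
      rw [eq_top_iff, ← Monoid.Coprod.range_inl_sup_range_inr, sup_le_iff]
      constructor
      · rintro _ ⟨h, rfl⟩; exact h1 h
      · rintro _ ⟨h, rfl⟩; exact h2 h)
  rwa [Monoid.Coprod.range_lift, Subgroup.range_subtype, Subgroup.range_subtype] at this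

end Assembly

end AbelianExtensions

section ElementaryMatrices

section ConnSubgroup

theorem Conn.of_subgroup {G X : Type*} [Group G] [MulAction G X] (H : Subgroup G) {Ω : Set G}
    (hΩ : ∀ ω ∈ Ω, ω ∈ H) {N : X → ℕ} {x : X} {k : ℕ} {α β : H}
    (h : Conn Ω N x k (α : G) β) : Conn (Subtype.val ⁻¹' Ω) N x k α β := by
  obtain ⟨l, h1, h2, h3, h4⟩ := h
  obtain ⟨l, rfl⟩ : ∃ m : List H, m.map Subtype.val = l :=
    ⟨l.attachWith (· ∈ H) (fun ω hω => hΩ ω (h1 ω hω)), by simp⟩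
  have hprod : ∀ m : List H, (m.map Subtype.val).prod = ((m.prod : H) : G) := fun m =>
    (map_list_prod H.subtype m).symm
  refine ⟨l, fun ω hω => h1 ω (List.mem_map_of_mem hω), by simpa using h2,
    Subtype.ext (by rw [hprod] at h3; simpa using h3), fun l₁ l₂ h5 h6 h7 => ?_⟩
  have := h4 (l₁.map Subtype.val) (l₂.map Subtype.val) (by simp [h5])
    (fun h => h6 (List.map_eq_nil_iff.1 h)) (fun h => h7 (List.map_eq_nil_iff.1 h))
  rwa [hprod] at this

end ConnSubgroup

section Pattern

variable {ι : Type*} [Fintype ι] [DecidableEq ι]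

/-- The `ℓ¹` norm of an integer vector. -/
def nrm (z : ι → ℤ) : ℕ := ∑ i, (z i).natAbs

theorem nrm_update (z : ι → ℤ) (w : ι) (y : ℤ) :
    nrm (Function.update z w y) + (z w).natAbs = nrm z + y.natAbs := by
  have h1 := Finset.add_sum_erase Finset.univ (fun i => (z i).natAbs) (Finset.mem_univ w)
  have h2 := Finset.add_sum_erase Finset.univ
    (fun i => (Function.update z w y i).natAbs) (Finset.mem_univ w)
  have h3 : ∑ i ∈ Finset.univ.erase w, (Function.update z w y i).natAbs =
      ∑ i ∈ Finset.univ.erase w, (z i).natAbs := Finset.sum_congr rfl fun i hi => by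
    rw [Function.update_of_ne (Finset.ne_of_mem_erase hi)]
  simp only [Function.update_self] at h2
  unfold nrm
  omega

/-- The elementary automorphism adding `ε` times the coordinate `p` to the coordinate `w`. -/
def elem (p w : ι) (h : p ≠ w) (ε : ℤ) : (ι → ℤ) ≃ₗ[ℤ] (ι → ℤ) where
  toFun z := Function.update z w (z w + ε * z p)
  invFun z := Function.update z w (z w + -ε * z p)
  map_add' x y := by
    ext i; by_cases hi : i = w
    · subst hi; simp; ring
    · simp [hi]
  map_smul' c x := by
    ext i; by_cases hi : i = w
    · subst hi; simp; ring
    · simp [hi]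
  left_inv z := by
    ext i; by_cases hi : i = w
    · subst hi; simp [h]
    · simp [hi]
  right_inv z := by
    ext i; by_cases hi : i = w
    · subst hi; simp [h]
    · simp [hi]

theorem elem_apply (p w : ι) (h : p ≠ w) (ε : ℤ) (z : ι → ℤ) :
    elem p w h ε z = Function.update z w (z w + ε * z p) := rfl

theorem elem_inv (p w : ι) (h : p ≠ w) (ε : ℤ) : (elem p w h ε)⁻¹ = elem p w h (-ε) :=
  LinearEquiv.ext fun _ => rfl

/-- The rotation `(x_a, x_b) ↦ (ε x_b, -ε x_a)`. -/
def rot (a b : ι) (h : a ≠ b) (ε : ℤ) (hε : ε * ε = 1) : (ι → ℤ) ≃ₗ[ℤ] (ι → ℤ) where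
  toFun z := Function.update (Function.update z a (ε * z b)) b (-ε * z a)
  invFun z := Function.update (Function.update z a (-ε * z b)) b (ε * z a)
  map_add' x y := by
    ext i; simp only [Function.update_apply, Pi.add_apply]; split_ifs <;> ring
  map_smul' c x := by
    ext i; simp only [Function.update_apply, Pi.smul_apply, smul_eq_mul, RingHom.id_apply]
    split_ifs <;> ring
  left_inv z := by
    ext i; simp only [Function.update_apply]
    split_ifs <;> simp_all [← mul_assoc]
  right_inv z := by
    ext i; simp only [Function.update_apply]
    split_ifs <;> simp_all [← mul_assoc]

theorem rot_apply (a b : ι) (h : a ≠ b) (ε : ℤ) (hε : ε * ε = 1) (z : ι → ℤ) :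
    rot a b h ε hε z = Function.update (Function.update z a (ε * z b)) b (-ε * z a) := rfl

theorem rot_inv (a b : ι) (h : a ≠ b) (ε : ℤ) (hε : ε * ε = 1) :
    (rot a b h ε hε)⁻¹ = rot a b h (-ε) (by simpa using hε) :=
  LinearEquiv.ext fun z => by
    change Function.update (Function.update z a (-ε * z b)) b (ε * z a) = _
    rw [rot_apply, neg_neg]

/-- Negation of one coordinate. -/
def flipAt (a : ι) : (ι → ℤ) ≃ₗ[ℤ] (ι → ℤ) where
  toFun z := Function.update z a (- z a)
  invFun z := Function.update z a (- z a)
  map_add' x y := by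
    ext i; simp only [Function.update_apply, Pi.add_apply]; split_ifs <;> ring
  map_smul' c x := by
    ext i; simp only [Function.update_apply, Pi.smul_apply, smul_eq_mul, RingHom.id_apply]
    split_ifs <;> ring
  left_inv z := by
    ext i; simp only [Function.update_apply]
    split_ifs <;> simp_all
  right_inv z := by
    ext i; simp only [Function.update_apply]
    split_ifs <;> simp_all

theorem flipAt_apply (a : ι) (z : ι → ℤ) : flipAt a z = Function.update z a (- z a) := rfl

theorem flipAt_inv (a : ι) : (flipAt a)⁻¹ = flipAt a := LinearEquiv.ext fun _ => rfl

/-- Elementary automorphisms. -/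
def IsElem (φ : (ι → ℤ) ≃ₗ[ℤ] (ι → ℤ)) : Prop :=
  ∃ (p w : ι) (h : p ≠ w) (ε : ℤ), (ε = 1 ∨ ε = -1) ∧ φ = elem p w h ε

/-- Signed permutations of the coordinates. -/
def IsSignedPerm (φ : (ι → ℤ) ≃ₗ[ℤ] (ι → ℤ)) : Prop :=
  ∃ (π : Equiv.Perm ι) (s : ι → ℤ), (∀ i, s i = 1 ∨ s i = -1) ∧ ∀ z i, φ z (π i) = s i * z i

theorem IsSignedPerm.nrm {φ : (ι → ℤ) ≃ₗ[ℤ] (ι → ℤ)} (h : IsSignedPerm φ) (z : ι → ℤ) :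
    nrm (φ z) = nrm z := by
  obtain ⟨π, s, hs, h⟩ := h
  unfold RaagPaper.nrm
  rw [← Equiv.sum_comp π]
  refine Finset.sum_congr rfl fun i _ => ?_
  rw [h]
  rcases hs i with h | h <;> simp [h]

theorem IsSignedPerm.inv {φ : (ι → ℤ) ≃ₗ[ℤ] (ι → ℤ)} (h : IsSignedPerm φ) :
    IsSignedPerm φ⁻¹ := by
  obtain ⟨π, s, hs, h⟩ := h
  refine ⟨π⁻¹, fun i => s (π⁻¹ i), fun i => hs _, fun z i => ?_⟩
  have := h (φ⁻¹ z) (π⁻¹ i)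
  have e : φ (φ⁻¹ z) = z := by rw [← LinearEquiv.mul_apply]; simp
  rw [e] at this
  rw [← Equiv.Perm.mul_apply, mul_inv_cancel, Equiv.Perm.one_apply] at this
  dsimp only
  rw [this, ← mul_assoc]
  rcases hs (π⁻¹ i) with h | h <;> rw [h] <;> simp

theorem IsSignedPerm.conj {φ ψ : (ι → ℤ) ≃ₗ[ℤ] (ι → ℤ)} (h : IsSignedPerm φ) (hψ : IsElem ψ) :
    IsElem (φ * ψ * φ⁻¹) := by
  obtain ⟨π, s, hs, h⟩ := h
  obtain ⟨p, w, hpw, ε, hε, rfl⟩ := hψ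
  refine ⟨π p, π w, by simpa using hpw, ε * s p * s w, ?_, ?_⟩
  · rcases hε with h1 | h1 <;> rcases hs p with h2 | h2 <;> rcases hs w with h3 | h3 <;>
      simp [h1, h2, h3]
  · rw [mul_inv_eq_iff_eq_mul]
    ext z i
    obtain ⟨i, rfl⟩ := π.surjective i
    simp only [LinearEquiv.mul_apply, elem_apply, h]
    by_cases hi : i = w
    · subst hi
      simp only [Function.update_self]
      rcases hs i with h2 | h2 <;> rcases hs p with h3 | h3 <;> simp [h2, h3] <;> ring
    · rw [Function.update_of_ne hi, Function.update_of_ne (by simpa using hi), h]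

theorem isSignedPerm_rot (a b : ι) (h : a ≠ b) (ε : ℤ) (hε : ε = 1 ∨ ε = -1)
    (hε' : ε * ε = 1) : IsSignedPerm (rot a b h ε hε') := by
  refine ⟨Equiv.swap a b, fun i => if i = b then ε else if i = a then -ε else 1, ?_, ?_⟩
  · intro i; dsimp only; split_ifs <;> omega
  · intro z i
    rw [rot_apply]
    by_cases h1 : i = a
    · subst h1; simp [h]
    · by_cases h2 : i = b
      · subst h2; simp [h]
      · rw [Equiv.swap_apply_of_ne_of_ne h1 h2]; simp [h1, h2]

theorem isSignedPerm_flipAt (a : ι) : IsSignedPerm (flipAt a) := by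
  refine ⟨1, fun i => if i = a then -1 else 1, ?_, ?_⟩
  · intro i; dsimp only; split_ifs <;> omega
  · intro z i
    rw [flipAt_apply]
    by_cases h1 : i = a
    · subst h1; simp
    · simp [h1]

variable [Preorder ι]

/-- Vectors supported on the upper set of `u`. -/
def SuppAbove (u : ι) (z : ι → ℤ) : Prop := ∀ w, z w ≠ 0 → u ≤ w

/-- Automorphisms of `ℤ^ι` preserving the upper sets, and fixing the basis vectors outside `J`. -/
def patternGroup (J : Finset ι) : Subgroup ((ι → ℤ) ≃ₗ[ℤ] (ι → ℤ)) where
  carrier := {φ | (∀ u z, SuppAbove u z ↔ SuppAbove u (φ z)) ∧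
    ∀ u ∉ J, φ (Pi.single u 1) = Pi.single u 1}
  one_mem' := ⟨fun _ _ => Iff.rfl, fun _ _ => rfl⟩
  mul_mem' := by
    rintro φ ψ ⟨h1, h2⟩ ⟨h3, h4⟩
    exact ⟨fun u z => (h3 u z).trans (h1 u _), fun u hu => by
      rw [LinearEquiv.mul_apply, h4 u hu, h2 u hu]⟩
  inv_mem' := by
    rintro φ ⟨h1, h2⟩
    have e : ∀ z, φ (φ⁻¹ z) = z := fun z => by rw [← LinearEquiv.mul_apply]; simp
    refine ⟨fun u z => ?_, fun u hu => ?_⟩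
    · rw [h1 u (φ⁻¹ z), e]
    · apply φ.injective
      rw [e, h2 u hu]

/-- The finite generating set of a pattern group. -/
def patternGen (J : Finset ι) : Set ((ι → ℤ) ≃ₗ[ℤ] (ι → ℤ)) :=
  {φ | φ ∈ patternGroup J ∧ (IsElem φ ∨ IsSignedPerm φ)}

theorem mem_patternGroup_of {J : Finset ι} {φ : (ι → ℤ) ≃ₗ[ℤ] (ι → ℤ)}
    (h1 : ∀ u z, SuppAbove u z → SuppAbove u (φ z))
    (h2 : ∀ u z, SuppAbove u z → SuppAbove u (φ⁻¹ z))
    (h3 : ∀ u ∉ J, φ (Pi.single u 1) = Pi.single u 1) : φ ∈ patternGroup J := by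
  refine ⟨fun u z => ⟨h1 u z, fun h => ?_⟩, h3⟩
  have := h2 u _ h
  rwa [← LinearEquiv.mul_apply, inv_mul_cancel] at this

theorem elem_mem {J : Finset ι} {p w : ι} (h : p ≠ w) (ε : ℤ) (hp : p ∈ J) (hpw : p ≤ w) :
    elem p w h ε ∈ patternGroup J := by
  have key : ∀ ε u z, SuppAbove u z → SuppAbove u (elem p w h ε z) := by
    intro ε u z hz i hi
    rw [elem_apply] at hi
    by_cases hiw : i = w
    · subst hiw
      rw [Function.update_self] at hi
      by_cases h1 : z i = 0
      · by_cases h2 : z p = 0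
        · simp [h1, h2] at hi
        · exact (hz p h2).trans hpw
      · exact hz i h1
    · rw [Function.update_of_ne hiw] at hi
      exact hz i hi
  refine mem_patternGroup_of (key ε) (by rw [elem_inv]; exact key _) fun u hu => ?_
  have : u ≠ p := fun h => hu (h ▸ hp)
  rw [elem_apply]
  simp [Pi.single_apply, this.symm]

theorem elem_mem_iff {J : Finset ι} {p w : ι} (h : p ≠ w) {ε : ℤ} (hε : ε = 1 ∨ ε = -1) :
    elem p w h ε ∈ patternGroup J ↔ p ∈ J ∧ p ≤ w := by
  refine ⟨fun hm => ⟨?_, ?_⟩, fun hm => elem_mem h ε hm.1 hm.2⟩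
  · by_contra hp
    have := congrFun (hm.2 p hp) w
    rw [elem_apply] at this
    simp [h.symm] at this
    omega
  · have h0 : SuppAbove p (Pi.single p 1) := by
      intro i hi
      by_cases hip : i = p
      · exact hip ▸ le_rfl
      · simp [hip] at hi
    refine (hm.1 p _).1 h0 w ?_
    rw [elem_apply]
    simp [h.symm]
    omega

theorem rot_mem {J : Finset ι} {a b : ι} (h : a ≠ b) (ε : ℤ) (hε : ε * ε = 1) (ha : a ∈ J)
    (hb : b ∈ J) (hab : a ≤ b) (hba : b ≤ a) : rot a b h ε hε ∈ patternGroup J := by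
  have key : ∀ ε hε u z, SuppAbove u z → SuppAbove u (rot a b h ε hε z) := by
    intro ε hε u z hz i hi
    rw [rot_apply] at hi
    by_cases hib : i = b
    · subst hib
      simp only [Function.update_self] at hi
      exact (hz a (fun h => by simp [h] at hi)).trans hab
    · rw [Function.update_of_ne hib] at hi
      by_cases hia : i = a
      · subst hia
        simp only [Function.update_self] at hi
        exact (hz b (fun h => by simp [h] at hi)).trans hba
      · rw [Function.update_of_ne hia] at hi
        exact hz i hi
  refine mem_patternGroup_of (key ε hε) (by rw [rot_inv]; exact key _ _) fun u hu => ?_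
  have h1 : a ≠ u := fun h => hu (h ▸ ha)
  have h2 : b ≠ u := fun h => hu (h ▸ hb)
  rw [rot_apply]
  ext i
  simp only [Function.update_apply, Pi.single_apply, h1, h2, if_false, mul_zero]
  split_ifs <;> simp_all

theorem flipAt_mem {J : Finset ι} {a : ι} (ha : a ∈ J) : flipAt a ∈ patternGroup J := by
  have key : ∀ u z, SuppAbove u z → SuppAbove u (flipAt a z) := by
    intro u z hz i hi
    rw [flipAt_apply] at hi
    by_cases hia : i = a
    · subst hia
      simp only [Function.update_self] at hi
      exact hz i (fun h => by simp [h] at hi)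
    · rw [Function.update_of_ne hia] at hi
      exact hz i hi
  refine mem_patternGroup_of key (by rw [flipAt_inv]; exact key) fun u hu => ?_
  have h1 : a ≠ u := fun h => hu (h ▸ ha)
  rw [flipAt_apply]
  ext i
  simp only [Function.update_apply, Pi.single_apply, h1, if_false]
  split_ifs <;> simp_all

theorem finite_nrm_le (n : ℕ) : {z : ι → ℤ | nrm z ≤ n}.Finite := by
  refine (Set.finite_Icc (fun _ => -(n : ℤ)) (fun _ : ι => (n : ℤ))).subset ?_
  intro z hz
  have : ∀ i, (z i).natAbs ≤ n := fun i =>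
    (Finset.single_le_sum (f := fun i => (z i).natAbs) (fun _ _ => Nat.zero_le _)
      (Finset.mem_univ i)).trans hz
  constructor <;> intro i <;> have := this i <;> simp only <;> omega

theorem nrm_single (v : ι) : nrm (Pi.single v (1 : ℤ)) = 1 := by
  unfold nrm
  rw [Finset.sum_eq_single v] <;> simp +contextual

theorem linearEquiv_ext_single {φ ψ : (ι → ℤ) ≃ₗ[ℤ] (ι → ℤ)}
    (h : ∀ i, φ (Pi.single i 1) = ψ (Pi.single i 1)) : φ = ψ := by
  apply LinearEquiv.toLinearMap_injective
  refine (Pi.basisFun ℤ ι).ext fun i => ?_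
  simpa using h i

theorem patternGen_finite (J : Finset ι) : (patternGen J).Finite := by
  have : (Set.pi Set.univ fun _ : ι => {z : ι → ℤ | nrm z ≤ 2}).Finite :=
    Set.Finite.pi fun _ => finite_nrm_le 2
  refine Set.Finite.of_finite_image (f := fun φ => fun i => φ (Pi.single i 1))
    (this.subset ?_) fun φ _ ψ _ h => linearEquiv_ext_single fun i => congrFun h i
  rintro _ ⟨φ, ⟨_, h⟩, rfl⟩ i -
  simp only [Set.mem_ofPred_eq]
  rcases h with ⟨p, w, hpw, ε, hε, rfl⟩ | h
  · have := nrm_update (Pi.single i (1 : ℤ)) w ((Pi.single i (1 : ℤ) : ι → ℤ) w +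
      ε * (Pi.single i (1 : ℤ) : ι → ℤ) p)
    rw [nrm_single] at this
    rw [elem_apply]
    by_cases h1 : p = i
    · subst h1
      simp only [Pi.single_eq_same, Pi.single_eq_of_ne hpw.symm] at this ⊢
      omega
    · simp only [Pi.single_eq_of_ne h1] at this ⊢
      simp at this ⊢
      omega
  · rw [h.nrm, nrm_single]; omega

end Pattern

end ElementaryMatrices

section MatrixPresentation

section PatternPeak

variable {ι : Type*} [Fintype ι] [DecidableEq ι]

theorem elem_ne {p w : ι} (h : p ≠ w) (ε : ℤ) (z : ι → ℤ) {i : ι} (hi : i ≠ w) :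
    elem p w h ε z i = z i := by simp [elem_apply, hi]

theorem nrm_elem (p w : ι) (h : p ≠ w) (ε : ℤ) (z : ι → ℤ) :
    nrm (elem p w h ε z) + (z w).natAbs = nrm z + (z w + ε * z p).natAbs :=
  nrm_update z w _

theorem elem_comm {p w u q : ι} (h : p ≠ w) (h' : u ≠ q) (ε δ : ℤ) (h1 : p ≠ q) (h2 : u ≠ w) :
    elem p w h ε * elem u q h' δ = elem u q h' δ * elem p w h ε := by
  ext z i
  simp only [LinearEquiv.mul_apply, elem_apply, Function.update_apply]
  grind

theorem elem_chain {a b c : ι} (hab : a ≠ b) (hbc : b ≠ c) (hac : a ≠ c) (ε δ : ℤ) :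
    elem a b hab ε * elem b c hbc δ =
      elem b c hbc δ * elem a c hac (-(ε * δ)) * elem a b hab ε := by
  ext z i
  simp only [LinearEquiv.mul_apply, elem_apply, Function.update_apply]
  grind

theorem elem_rot {a b : ι} (h : a ≠ b) {ε : ℤ} (hε' : ε * ε = 1) :
    elem b a h.symm ε =
      rot a b h ε hε' * (elem b a h.symm (-ε) * elem a b h ε) := by
  ext z i
  simp only [LinearEquiv.mul_apply, elem_apply, rot_apply, Function.update_apply]
  grind

theorem elem_same_target {p u w : ι} (hpw : p ≠ w) (huw : u ≠ w) (hpu : p ≠ u) {ε δ : ℤ}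
    (hδ : δ * δ = 1) : elem u w huw δ * (elem p u hpu (-(ε * δ)) * elem p w hpw ε) =
      elem p u hpu (-(ε * δ)) * elem u w huw δ := by
  ext z i
  simp only [LinearEquiv.mul_apply, elem_apply, Function.update_apply]
  grind

variable [Preorder ι] {J : Finset ι} {z : ι → ℤ}

theorem elem_gen {p w : ι} (h : p ≠ w) {ε : ℤ} (hε : ε = 1 ∨ ε = -1) (hp : p ∈ J)
    (hpw : p ≤ w) : elem p w h ε ∈ patternGen J :=
  ⟨elem_mem h ε hp hpw, Or.inl ⟨p, w, h, ε, hε, rfl⟩⟩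

theorem patternGen_inv : ∀ ω ∈ patternGen J, ω⁻¹ ∈ patternGen J := by
  rintro ω ⟨h1, ⟨p, w, h, ε, hε, rfl⟩ | h2⟩
  · refine ⟨inv_mem h1, Or.inl ⟨p, w, h, -ε, by omega, elem_inv _ _ _ _⟩⟩
  · exact ⟨inv_mem h1, Or.inr h2.inv⟩

theorem conn_commute {α β : (ι → ℤ) ≃ₗ[ℤ] (ι → ℤ)} (hα : α ∈ patternGen J)
    (hβ : β ∈ patternGen J) (h : α * β = β * α) (hN : nrm (α (β z)) < nrm z) :
    Conn (patternGen J) nrm z 2 α β :=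
  Conn.trans (γ := β * α) (Conn.edge hβ rfl)
    (Conn.edge (patternGen_inv α hα) (by rw [← h]; group)) (by rw [← h]; exact hN)

theorem conn_signedPerm {α β : (ι → ℤ) ≃ₗ[ℤ] (ι → ℤ)} (hα : α ∈ patternGen J)
    (hα' : IsSignedPerm α) (hβ : β ∈ patternGen J) (hN : nrm (β z) < nrm z) :
    Conn (patternGen J) nrm z 2 α β := by
  have hβ' : IsElem β := hβ.2.resolve_right fun h => by rw [h.nrm] at hN; omega
  have hm : α * β * α⁻¹ ∈ patternGen J :=
    ⟨mul_mem (mul_mem hα.1 hβ.1) (inv_mem hα.1), Or.inl (hα'.conj hβ')⟩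
  refine Conn.trans (γ := α * β) (Conn.edge hm (by group))
    (Conn.edge (patternGen_inv α hα) (by group)) ?_
  · change nrm (α (β z)) < _
    rwa [hα'.nrm]

theorem conn_same_target {p u w : ι} (hpw : p ≠ w) (huw : u ≠ w) (hpu : p ≠ u) {ε δ : ℤ}
    (hε : ε = 1 ∨ ε = -1) (hδ : δ = 1 ∨ δ = -1) (hp : p ∈ J) (hu : u ∈ J) (lpu : p ≤ u)
    (luw : u ≤ w) (hzp : z p ≠ 0) (hle : (z p).natAbs ≤ (z u).natAbs)
    (h1 : nrm (elem p w hpw ε z) ≤ nrm z) (h2 : nrm (elem u w huw δ z) ≤ nrm z) :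
    Conn (patternGen J) nrm z 3 (elem p w hpw ε) (elem u w huw δ) := by
  have n1 := nrm_elem p w hpw ε z
  have n2 := nrm_elem u w huw δ z
  have hκ : -(ε * δ) = 1 ∨ -(ε * δ) = -1 := by
    rcases hε with rfl | rfl <;> rcases hδ with rfl | rfl <;> simp
  set g := elem p u hpu (-(ε * δ)) with hg
  have n3 := nrm_elem p u hpu (-(ε * δ)) (elem p w hpw ε z)
  have n4 := nrm_elem p u hpu (-(ε * δ)) (elem u w huw δ z)
  rw [elem_ne hpw ε z huw, elem_ne hpw ε z hpw] at n3
  rw [elem_ne huw δ z huw, elem_ne huw δ z hpw] at n4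
  have hgm : g ∈ patternGen J := elem_gen hpu hκ hp lpu
  refine Conn.trans (j := 1) (k := 2) (γ := g * elem p w hpw ε) (Conn.edge hgm rfl)
    (Conn.trans (j := 1) (k := 1) (γ := g * elem u w huw δ)
      (Conn.edge (elem_gen huw hδ hu luw) ?_) (Conn.edge (patternGen_inv _ hgm) (by group)) ?_) ?_
  · exact elem_same_target hpw huw hpu (by rcases hδ with rfl | rfl <;> simp)
  · change nrm (elem p u hpu (-(ε * δ)) (elem u w huw δ z)) < _
    rcases hε with rfl | rfl <;> rcases hδ with rfl | rfl <;> omega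
  · change nrm (elem p u hpu (-(ε * δ)) (elem p w hpw ε z)) < _
    rcases hε with rfl | rfl <;> rcases hδ with rfl | rfl <;> omega

theorem conn_rot {a b : ι} (h : a ≠ b) {ε : ℤ} (hε : ε = 1 ∨ ε = -1) (ha : a ∈ J) (hb : b ∈ J)
    (hab : a ≤ b) (hba : b ≤ a) (hN : nrm (elem b a h.symm ε z) < nrm z) :
    Conn (patternGen J) nrm z 2 (elem a b h ε) (elem b a h.symm ε) := by
  have hε' : ε * ε = 1 := by rcases hε with rfl | rfl <;> simp
  have hsp := isSignedPerm_rot a b h ε hε hε'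
  have e := elem_rot h hε'
  refine Conn.trans (j := 1) (k := 1) (γ := elem b a h.symm (-ε) * elem a b h ε)
    (Conn.edge (elem_gen h.symm (by omega) hb hba) rfl)
    (Conn.edge ⟨rot_mem h ε hε' ha hb hab hba, Or.inr hsp⟩ e.symm) ?_
  rw [e, LinearEquiv.mul_apply, hsp.nrm] at hN
  exact hN

theorem conn_chain {a b c : ι} (hab : a ≠ b) (hbc : b ≠ c) (hac : a ≠ c) {ε δ : ℤ}
    (hε : ε = 1 ∨ ε = -1) (hδ : δ = 1 ∨ δ = -1) (ha : a ∈ J) (hb : b ∈ J) (lab : a ≤ b)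
    (lba : b ≤ a) (lbc : b ≤ c) (hza : z a ≠ 0) (hzb : z b ≠ 0)
    (h1 : nrm (elem a b hab ε z) ≤ nrm z) (h2 : nrm (elem b c hbc δ z) ≤ nrm z)
    (h3 : nrm (elem a b hab ε z) < nrm z ∨ nrm (elem b c hbc δ z) < nrm z) :
    Conn (patternGen J) nrm z 4 (elem a b hab ε) (elem b c hbc δ) := by
  have n1 := nrm_elem a b hab ε z
  have n2 := nrm_elem b c hbc δ z
  have hA := elem_gen (J := J) hab hε ha lab
  have hB := elem_gen (J := J) hbc hδ hb lbc
  by_cases hle : (z a).natAbs ≤ (z b).natAbs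
  · have hκ : -(ε * δ) = 1 ∨ -(ε * δ) = -1 := by
      rcases hε with rfl | rfl <;> rcases hδ with rfl | rfl <;> simp
    have n3 := nrm_elem a c hac (-(ε * δ)) (elem a b hab ε z)
    have n4 := nrm_elem a b hab ε (elem b c hbc δ z)
    rw [elem_ne hab ε z hbc.symm, elem_ne hab ε z hab] at n3
    rw [elem_ne hbc δ z hbc, elem_ne hbc δ z hac] at n4
    refine Conn.mono (j := 3) (Conn.trans (j := 1) (k := 2)
      (γ := elem a c hac (-(ε * δ)) * elem a b hab ε)
      (Conn.edge (elem_gen hac hκ ha (lab.trans lbc)) rfl) (Conn.trans (j := 1) (k := 1)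
        (γ := elem a b hab ε * elem b c hbc δ) (Conn.edge hB ?_)
        (Conn.edge (patternGen_inv _ hA) (by group)) ?_) ?_) (by omega)
    · rw [elem_chain hab hbc hac, mul_assoc]
    · change nrm (elem a b hab ε (elem b c hbc δ z)) < _
      omega
    · change nrm (elem a c hac (-(ε * δ)) (elem a b hab ε z)) < _
      rcases hε with rfl | rfl <;> rcases hδ with rfl | rfl <;> omega
  · have n3 := nrm_elem b a hab.symm ε z
    have n4 := nrm_elem b a hab.symm ε (elem b c hbc δ z)
    rw [elem_ne hbc δ z hac, elem_ne hbc δ z hbc] at n4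
    have hg : nrm (elem b a hab.symm ε z) < nrm z := by rcases hε with rfl | rfl <;> omega
    refine Conn.trans (j := 2) (k := 2) (γ := elem b a hab.symm ε)
      (conn_rot hab hε ha hb lab lba hg)
      (conn_commute (elem_gen hab.symm hε hb lba) hB (elem_comm _ _ _ _ hbc hab.symm) ?_) hg
    omega

/-- Local peak reduction for pattern groups. -/
theorem pattern_local_conn {α β : (ι → ℤ) ≃ₗ[ℤ] (ι → ℤ)} (hα : α ∈ patternGen J)
    (hβ : β ∈ patternGen J) (hJ : ∀ p ∈ J, z p ≠ 0 → ∀ u ∈ J, z u ≠ 0 → p ≤ u)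
    (h1 : nrm (α z) ≤ nrm z) (h2 : nrm (β z) < nrm z) : Conn (patternGen J) nrm z 4 α β := by
  obtain ⟨hβm, ⟨u, q, huq, δ, hδ, rfl⟩ | hβ'⟩ := id hβ
  swap
  · rw [hβ'.nrm] at h2; omega
  obtain ⟨hαm, ⟨p, w, hpw, ε, hε, rfl⟩ | hα'⟩ := id hα
  swap
  · exact (conn_signedPerm hα hα' hβ h2).mono (by omega)
  obtain ⟨hp, lpw⟩ := (elem_mem_iff hpw hε).1 hαm
  obtain ⟨hu, luq⟩ := (elem_mem_iff huq hδ).1 hβm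
  have n1 := nrm_elem p w hpw ε z
  have n2 := nrm_elem u q huq δ z
  have hzu : z u ≠ 0 := by
    intro h; rw [h] at n2; simp at n2; omega
  have hzq : z q ≠ 0 := by
    intro h; rw [h] at n2; simp at n2; omega
  by_cases hzp : z p = 0
  · have hup : u ≠ p := fun h => hzu (h ▸ hzp)
    have hqp : q ≠ p := fun h => hzq (h ▸ hzp)
    have fixp : ∀ (y : ι → ℤ), y p = 0 → ∀ x hx κ, elem p x hx κ y = y := by
      intro y hy x hx κ
      rw [elem_apply, hy]; simp
    have hβp : elem u q huq δ z p = 0 := by rw [elem_ne huq δ z hqp.symm, hzp]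
    by_cases hwu : w = u
    · subst hwu
      have hκ : ε * δ = 1 ∨ ε * δ = -1 := by
        rcases hε with rfl | rfl <;> rcases hδ with rfl | rfl <;> simp
      refine Conn.mono (j := 3) (Conn.trans (j := 1) (k := 2)
        (γ := elem w q huq δ * elem p w hpw ε) (Conn.edge hβ rfl) (Conn.trans (j := 1) (k := 1)
          (γ := elem p q hqp.symm (-(ε * δ)) * (elem w q huq δ * elem p w hpw ε))
          (Conn.edge (elem_gen _ (by omega) hp (lpw.trans luq)) rfl)
          (Conn.edge (patternGen_inv _ hα) ?_) ?_) ?_) (by omega)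
      · rw [inv_mul_eq_iff_eq_mul, elem_chain hpw huq hqp.symm, ← mul_assoc, elem_comm]
        · exact hqp.symm.trans_eq rfl
        · exact huq
      · simp only [LinearEquiv.smul_def, LinearEquiv.mul_apply]
        rw [fixp z hzp, fixp _ hβp]; exact h2
      · simp only [LinearEquiv.smul_def, LinearEquiv.mul_apply]
        rw [fixp z hzp]; exact h2
    · refine (conn_commute hα hβ (elem_comm _ _ _ _ hqp.symm (Ne.symm hwu)) ?_).mono (by omega)
      rw [fixp _ hβp]; exact h2
  · have lpu := hJ p hp hzp u hu hzu
    have lup := hJ u hu hzu p hp hzp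
    by_cases hwq : w = q
    · subst hwq
      by_cases hpu : p = u
      · subst hpu
        have : ε = δ := by rcases hε with rfl | rfl <;> rcases hδ with rfl | rfl <;> omega
        subst this
        exact Conn.rfl
      · by_cases hle : (z p).natAbs ≤ (z u).natAbs
        · exact (conn_same_target hpw huq hpu hε hδ hp hu lpu luq hzp hle h1 h2.le).mono
            (by omega)
        · exact ((conn_same_target huq hpw (Ne.symm hpu) hδ hε hu hp lup lpw hzu (by omega)
            h2.le h1).mono (by omega)).symm patternGen_inv
    · by_cases hpq : p = q
      · subst hpq
        by_cases hwu : w = u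
        · subst hwu
          have : ε = δ := by rcases hε with rfl | rfl <;> rcases hδ with rfl | rfl <;> omega
          subst this
          exact (conn_rot hpw hε hp hu lpu lup h2).mono (by omega)
        · exact (conn_chain huq hpw (Ne.symm hwu) hδ hε hu hp lup lpu lpw hzu hzp h2.le h1
            (Or.inl h2)).symm patternGen_inv
      · by_cases hwu : w = u
        · subst hwu
          exact conn_chain hpw huq hpq hε hδ hp hu lpu lup luq hzp hzu h1 h2.le (Or.inr h2)
        · refine (conn_commute hα hβ (elem_comm _ _ _ _ hpq (Ne.symm hwu)) ?_).mono (by omega)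
          have n4 := nrm_elem p w hpw ε (elem u q huq δ z)
          rw [elem_ne huq δ z hwq, elem_ne huq δ z hpq] at n4
          omega

end PatternPeak

end MatrixPresentation

section BlockTriangular

section PatternFP

variable {ι : Type*} [Fintype ι] [DecidableEq ι] [Preorder ι] {J : Finset ι} {v : ι}

theorem patternGroup_mono {J' : Finset ι} (h : J ⊆ J') : patternGroup J ≤ patternGroup J' :=
  fun _ hφ => ⟨hφ.1, fun u hu => hφ.2 u fun hu' => hu (h hu')⟩

theorem patternGroup_fix {φ : (ι → ℤ) ≃ₗ[ℤ] (ι → ℤ)} (hφ : φ ∈ patternGroup J) {y : ι → ℤ}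
    (hy : ∀ w ∈ J, y w = 0) : φ y = y := by
  conv_lhs => rw [pi_eq_sum_univ' y]
  conv_rhs => rw [pi_eq_sum_univ' y]
  rw [map_sum]
  refine Finset.sum_congr rfl fun i _ => ?_
  rw [map_smul]
  by_cases hi : i ∈ J
  · simp [hy i hi]
  · congr 1
    have := hφ.2 i hi
    convert this using 2

theorem exists_support {g : (ι → ℤ) ≃ₗ[ℤ] (ι → ℤ)} (hg : g ∈ patternGroup J) (hv : v ∈ J) :
    ∃ p ∈ J, g (Pi.single v 1) p ≠ 0 := by
  by_contra! h
  have h1 := patternGroup_fix (inv_mem hg) h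
  rw [← LinearEquiv.mul_apply, inv_mul_cancel, LinearEquiv.coe_one, id] at h1
  have := h v hv
  rw [← h1] at this
  simp at this

theorem natAbs_eq_one_of_support {g : (ι → ℤ) ≃ₗ[ℤ] (ι → ℤ)} (hg : g ∈ patternGroup J)
    (hv : v ∈ J) {p : ι} (hp : ∀ u ∈ J, u ≠ p → g (Pi.single v 1) u = 0) :
    (g (Pi.single v 1) p).natAbs = 1 := by
  set z := g (Pi.single v 1) with hz
  have e : g⁻¹ z = Pi.single v 1 := by
    rw [hz, ← LinearEquiv.mul_apply, inv_mul_cancel, LinearEquiv.coe_one, id]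
  have hdec : z = z p • Pi.single p 1 + Function.update z p 0 := by
    ext i
    by_cases hi : i = p
    · subst hi; simp
    · simp [hi]
  have hfix : g⁻¹ (Function.update z p 0) = Function.update z p 0 := by
    refine patternGroup_fix (inv_mem hg) fun w hw => ?_
    by_cases hwp : w = p
    · subst hwp; simp
    · simp [hwp, hp w hw]
  rw [hdec, map_add, map_smul, hfix] at e
  have e2 := congrFun e v
  have h0 : Function.update z p 0 v = 0 := by
    by_cases hwp : v = p
    · subst hwp; simp
    · simp [hwp, hp v hv]
  rw [Pi.add_apply, h0, add_zero, Pi.smul_apply, Pi.single_eq_same, smul_eq_mul] at e2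
  exact Int.isUnit_iff_natAbs_eq.1 (IsUnit.of_mul_eq_one _ e2)

theorem suppAbove_orbit {g : (ι → ℤ) ≃ₗ[ℤ] (ι → ℤ)} (hg : g ∈ patternGroup J) :
    SuppAbove v (g (Pi.single v 1)) := by
  refine (hg.1 v _).1 fun w hw => ?_
  by_cases h : w = v
  · rw [h]
  · simp [h] at hw

theorem nrm_pos {z : ι → ℤ} (h : z ≠ 0) : 1 ≤ nrm z := by
  by_contra! h'
  apply h
  have : nrm z = 0 := by omega
  unfold nrm at this
  rw [Finset.sum_eq_zero_iff] at this
  ext i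
  simpa using this i (Finset.mem_univ i)

theorem exists_reduce (hv : v ∈ J) (hmax : ∀ u ∈ J, v ≤ u → u ≤ v)
    {g : (ι → ℤ) ≃ₗ[ℤ] (ι → ℤ)} (hg : g ∈ patternGroup J) :
    (∃ ω ∈ patternGen J, nrm (ω (g (Pi.single v 1))) < nrm (g (Pi.single v 1))) ∨
    ∃ ω ∈ patternGen J, ω (g (Pi.single v 1)) = Pi.single v 1 := by
  obtain ⟨p, hp, hzp⟩ := exists_support hg hv
  have hsupp := suppAbove_orbit (v := v) hg
  set z := g (Pi.single v 1) with hz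
  have red : ∀ a ∈ J, ∀ b, a ≠ b → z a ≠ 0 → z b ≠ 0 → a ≤ b → (z a).natAbs ≤ (z b).natAbs →
      ∃ ω ∈ patternGen J, nrm (ω z) < nrm z := by
    intro a ha b hab hza hzb lab hle
    by_cases hs : 0 < z a * z b
    · refine ⟨elem a b hab (-1), elem_gen hab (Or.inr rfl) ha lab, ?_⟩
      have := nrm_elem a b hab (-1) z
      rcases pos_and_pos_or_neg_and_neg_of_mul_pos hs with h | h <;> omega
    · have hs' : z a * z b < 0 := lt_of_le_of_ne (not_lt.1 hs) (mul_ne_zero hza hzb)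
      refine ⟨elem a b hab 1, elem_gen hab (Or.inl rfl) ha lab, ?_⟩
      have := nrm_elem a b hab 1 z
      rcases mul_neg_iff.1 hs' with h | h <;> omega
  have lpv := hmax p hp (hsupp p hzp)
  by_cases hq : ∃ q ∈ J, q ≠ p ∧ z q ≠ 0
  · obtain ⟨q, hq, hqp, hzq⟩ := hq
    have lqv := hmax q hq (hsupp q hzq)
    left
    by_cases hle : (z p).natAbs ≤ (z q).natAbs
    · exact red p hp q hqp.symm hzp hzq (lpv.trans (hsupp q hzq)) hle
    · exact red q hq p hqp hzq hzp (lqv.trans (hsupp p hzp)) (by omega)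
  · push Not at hq
    have h1 : (z p).natAbs = 1 := natAbs_eq_one_of_support hg hv hq
    by_cases hw : ∃ w, w ≠ p ∧ z w ≠ 0
    · obtain ⟨w, hwp, hzw⟩ := hw
      exact Or.inl (red p hp w hwp.symm hzp hzw (lpv.trans (hsupp w hzw)) (by omega))
    · push Not at hw
      right
      have hzp' : z p = 1 ∨ z p = -1 := by omega
      have hzz : z p * z p = 1 := by rcases hzp' with h | h <;> simp [h]
      by_cases hpv : v = p
      · subst hpv
        rcases hzp' with h | h
        · refine ⟨1, ⟨one_mem _, Or.inr ⟨1, fun _ => 1, by simp, by simp⟩⟩, ?_⟩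
          ext i
          by_cases hi : i = v
          · subst hi; simpa using h
          · simpa [hi] using hw i hi
        · refine ⟨flipAt v, ⟨flipAt_mem hv, Or.inr (isSignedPerm_flipAt v)⟩, ?_⟩
          ext i
          by_cases hi : i = v
          · subst hi; simp [flipAt_apply, h]
          · simpa [flipAt_apply, hi] using hw i hi
      · refine ⟨rot v p hpv (z p) hzz, ⟨rot_mem hpv _ hzz hv hp (hsupp p hzp) lpv,
          Or.inr (isSignedPerm_rot _ _ _ _ hzp' _)⟩, ?_⟩
        ext i
        rw [rot_apply]
        by_cases hi : i = p
        · subst hi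
          simp [hw v hpv, Ne.symm hpv]
        · by_cases hiv : i = v
          · subst hiv; simp [hi, hzz]
          · simp [hi, hiv, hw i hi]

theorem mem_patternGroup_erase {φ : (ι → ℤ) ≃ₗ[ℤ] (ι → ℤ)} (hφ : φ ∈ patternGroup J)
    (h : φ (Pi.single v 1) = Pi.single v 1) : φ ∈ patternGroup (J.erase v) := by
  refine ⟨hφ.1, fun u hu => ?_⟩
  by_cases huv : u = v
  · rw [huv, h]
  · exact hφ.2 u fun h' => hu (Finset.mem_erase.2 ⟨huv, h'⟩)

theorem closure_patternGen_step (hv : v ∈ J) (hmax : ∀ u ∈ J, v ≤ u → u ≤ v)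
    (ih : patternGroup (J.erase v) ≤ Subgroup.closure (patternGen (J.erase v))) :
    patternGroup J ≤ Subgroup.closure (patternGen J) := by
  have hle : Subgroup.closure (patternGen (J.erase v)) ≤ Subgroup.closure (patternGen J) :=
    Subgroup.closure_mono fun φ hφ => ⟨patternGroup_mono (Finset.erase_subset _ _) hφ.1, hφ.2⟩
  have key : ∀ n, ∀ g ∈ patternGroup J, nrm (g (Pi.single v 1)) = n →
      g ∈ Subgroup.closure (patternGen J) := by
    intro n
    induction n using Nat.strong_induction_on with
    | _ n IH =>
      intro g hg hn
      have cancel : ∀ ω ∈ patternGen J, ω * g ∈ Subgroup.closure (patternGen J) →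
          g ∈ Subgroup.closure (patternGen J) := by
        intro ω hω h
        have := mul_mem (inv_mem (Subgroup.subset_closure hω)) h
        rwa [inv_mul_cancel_left] at this
      rcases exists_reduce hv hmax hg with ⟨ω, hω, h⟩ | ⟨ω, hω, h⟩
      · exact cancel ω hω (IH _ (hn ▸ h) _ (mul_mem hω.1 hg) rfl)
      · exact cancel ω hω (hle (ih (mem_patternGroup_erase (mul_mem hω.1 hg) h)))
  exact fun g hg => key _ g hg rfl

theorem closure_preimage_eq_top {G : Type*} [Group G] (H : Subgroup G) (Ω : Set G)
    (hΩ : ∀ ω ∈ Ω, ω ∈ H) (h : H ≤ Subgroup.closure Ω) :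
    Subgroup.closure (Subtype.val ⁻¹' Ω : Set H) = ⊤ := by
  have hmap : (Subgroup.closure (Subtype.val ⁻¹' Ω : Set H)).map H.subtype =
      Subgroup.closure Ω := by
    rw [MonoidHom.map_closure]
    congr 1
    ext x
    constructor
    · rintro ⟨y, hy, rfl⟩; exact hy
    · intro hx; exact ⟨⟨x, hΩ x hx⟩, hx, rfl⟩
  rw [eq_top_iff]
  intro x _
  have hx := h x.2
  rw [← hmap] at hx
  obtain ⟨y, hy, e⟩ := hx
  rwa [← Subtype.ext (a1 := y) (a2 := x) e]

theorem pattern_peakReducible (hmax : ∀ u ∈ J, v ≤ u → u ≤ v)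
    (hgen : patternGroup J ≤ Subgroup.closure (patternGen J)) :
    PeakReducible (G := patternGroup J) (Subtype.val ⁻¹' patternGen J) nrm
      (Pi.single v (1 : ℤ) : ι → ℤ) 4 where
  inv_mem ω hω := patternGen_inv _ hω
  local_conn g α hα β hβ h1 h2 := by
    refine Conn.of_subgroup _ (fun ω hω => hω.1) (pattern_local_conn hα hβ ?_ h1 h2)
    intro p hp hzp u hu hzu
    have hs := suppAbove_orbit (v := v) g.2
    exact (hmax p hp (hs p hzp)).trans (hs u hzu)
  min g := by
    rw [nrm_single]
    refine nrm_pos fun h => ?_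
    have h2 : (g : (ι → ℤ) ≃ₗ[ℤ] (ι → ℤ)) (Pi.single v 1) = 0 := h
    rw [LinearEquiv.map_eq_zero_iff] at h2
    have := congrFun h2 v
    simp at this
  gen := closure_preimage_eq_top _ _ (fun ω hω => hω.1) hgen

/-- The stabilizer of a basis vector in a pattern group. -/
def stabilizerEquiv (J : Finset ι) (v : ι) : patternGroup (J.erase v) ≃*
    MulAction.stabilizer (patternGroup J) (Pi.single v (1 : ℤ) : ι → ℤ) where
  toFun x := ⟨⟨x.1, patternGroup_mono (Finset.erase_subset _ _) x.2⟩,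
    x.2.2 v (Finset.notMem_erase v J)⟩
  invFun x := ⟨x.1.1, mem_patternGroup_erase x.1.2 x.2⟩
  left_inv _ := rfl
  right_inv _ := rfl
  map_mul' _ _ := rfl

theorem pattern_main (J : Finset ι) : Group.IsFinitelyPresented (patternGroup J) ∧
    patternGroup J ≤ Subgroup.closure (patternGen J) := by
  induction hn : J.card generalizing J with
  | zero =>
    rw [Finset.card_eq_zero] at hn
    subst hn
    have h1 : ∀ φ ∈ patternGroup (∅ : Finset ι), φ = 1 := fun φ hφ =>
      linearEquiv_ext_single fun i => by rw [hφ.2 i (by simp)]; rfl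
    have : Finite (patternGroup (∅ : Finset ι)) := by
      have : Subsingleton (patternGroup (∅ : Finset ι)) :=
        ⟨fun a b => Subtype.ext ((h1 a a.2).trans (h1 b b.2).symm)⟩
      infer_instance
    exact ⟨inferInstance, fun φ hφ => by rw [h1 φ hφ]; exact one_mem _⟩
  | succ n ih =>
    obtain ⟨v, hv, hmax⟩ := Finset.exists_maximal (s := J) (by
      rw [← Finset.card_pos]; omega)
    obtain ⟨ih1, ih2⟩ := ih (J.erase v) (by rw [Finset.card_erase_of_mem hv]; omega)
    have hmax' : ∀ u ∈ J, v ≤ u → u ≤ v := fun u hu h => hmax hu h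
    have hgen := closure_patternGen_step hv hmax' ih2
    refine ⟨?_, hgen⟩
    have : Group.IsFinitelyPresented
        (MulAction.stabilizer (patternGroup J) (Pi.single v (1 : ℤ) : ι → ℤ)) :=
      ih1.equiv (stabilizerEquiv J v)
    refine (pattern_peakReducible hmax' hgen).isFinitelyPresented
      ((patternGen_finite J).preimage Subtype.val_injective.injOn) ?_
    refine (finite_nrm_le 1).subset fun z hz => ?_
    have := hz.2
    rw [nrm_single] at this
    exact this.le

end PatternFP

end BlockTriangular

section Words

/-- The inverse of a letter `(v, ε)`. -/
def bar (x : V × Bool) : V × Bool := (x.1, !x.2)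

@[simp] lemma bar_fst (x : V × Bool) : (bar x).1 = x.1 := rfl

@[simp] lemma bar_snd (x : V × Bool) : (bar x).2 = !x.2 := rfl

@[simp] lemma bar_bar (x : V × Bool) : bar (bar x) = x := by simp [bar]

lemma bar_ne (x : V × Bool) : bar x ≠ x := by
  intro h
  have := congrArg Prod.snd h
  simp at this

lemma eq_or_eq_bar {x y : V × Bool} (h : x.1 = y.1) : x = y ∨ x = bar y := by
  obtain ⟨u, ε⟩ := x
  obtain ⟨v, δ⟩ := y
  cases ε <;> cases δ <;> simp_all [bar]

/-- The group element of a letter. -/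
def ev (Γ : SimpleGraph V) (x : V × Bool) : Raag Γ := if x.2 then gen Γ x.1 else (gen Γ x.1)⁻¹

/-- The group element of a word. -/
def evl (Γ : SimpleGraph V) (w : List (V × Bool)) : Raag Γ := (w.map (ev Γ)).prod

@[simp] lemma evl_nil (Γ : SimpleGraph V) : evl Γ [] = 1 := rfl

@[simp] lemma evl_cons (Γ : SimpleGraph V) (x : V × Bool) (w : List (V × Bool)) :
    evl Γ (x :: w) = ev Γ x * evl Γ w := by simp [evl]

@[simp] lemma evl_append (Γ : SimpleGraph V) (w w' : List (V × Bool)) :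
    evl Γ (w ++ w') = evl Γ w * evl Γ w' := by simp [evl]

@[simp] lemma ev_bar (Γ : SimpleGraph V) (x : V × Bool) : ev Γ (bar x) = (ev Γ x)⁻¹ := by
  obtain ⟨v, ε⟩ := x
  cases ε <;> simp [ev]

@[simp] lemma ev_true (Γ : SimpleGraph V) (v : V) : ev Γ (v, true) = gen Γ v := rfl

@[simp] lemma ev_false (Γ : SimpleGraph V) (v : V) : ev Γ (v, false) = (gen Γ v)⁻¹ := rfl

lemma gen_commute {Γ : SimpleGraph V} {u v : V} (h : Γ.Adj u v) :
    Commute (gen Γ u) (gen Γ v) := by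
  have h1 : (PresentedGroup.mk (Rels Γ) (FreeGroup.of u * FreeGroup.of v * (FreeGroup.of u)⁻¹ *
      (FreeGroup.of v)⁻¹)) = 1 :=
    PresentedGroup.one_of_mem ⟨u, v, h, rfl⟩
  have h2 : gen Γ u * gen Γ v * (gen Γ u)⁻¹ * (gen Γ v)⁻¹ = 1 := by
    simp only [map_mul, map_inv] at h1
    exact h1
  have h3 := mul_inv_eq_one.1 h2
  exact mul_inv_eq_iff_eq_mul.1 h3

lemma ev_commute {Γ : SimpleGraph V} {x y : V × Bool} (h : Γ.Adj x.1 y.1) :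
    Commute (ev Γ x) (ev Γ y) := by
  have := gen_commute h
  unfold ev
  split_ifs
  · exact this
  · exact this.inv_right
  · exact this.inv_left
  · exact this.inv_inv

/-- Every group element is represented by a word. -/
lemma exists_evl (Γ : SimpleGraph V) (g : Raag Γ) : ∃ w, evl Γ w = g := by
  have : ∀ g ∈ Subgroup.closure (Set.range (PresentedGroup.of (rels := Rels Γ))),
      ∃ w, evl Γ w = g := by
    intro g hg
    induction hg using Subgroup.closure_induction'' with
    | mem x hx =>
      obtain ⟨v, rfl⟩ := hx
      exact ⟨[(v, true)], by simp [gen]⟩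
    | inv_mem x hx =>
      obtain ⟨v, rfl⟩ := hx
      exact ⟨[(v, false)], by simp [gen]⟩
    | one => exact ⟨[], rfl⟩
    | mul x y _ _ hx hy =>
      obtain ⟨w, rfl⟩ := hx
      obtain ⟨w', rfl⟩ := hy
      exact ⟨w ++ w', by simp⟩
  exact this g (by rw [PresentedGroup.closure_range_of]; trivial)

lemma mulEquiv_ext_gen {Γ : SimpleGraph V} {φ ψ : MulAut (Raag Γ)}
    (h : ∀ v, φ (gen Γ v) = ψ (gen Γ v)) : φ = ψ := by
  have : (φ : Raag Γ →* Raag Γ) = ψ := PresentedGroup.ext h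
  ext g
  exact DFunLike.congr_fun this g

section piles

variable (Γ : SimpleGraph V) [DecidableRel Γ.Adj]

/-- Put the letter `y` on top of a family of piles indexed by the vertices. -/
def push (y : V × Bool) (π : V → List (Option Bool)) : V → List (Option Bool) := fun u =>
  if u = y.1 then some y.2 :: π u else if Γ.Adj y.1 u then π u else none :: π u

/-- Remove the letter `bar y` from the top of a family of piles. -/
def pop (y : V × Bool) (π : V → List (Option Bool)) : V → List (Option Bool) := fun u =>
  if Γ.Adj y.1 u then π u else (π u).tail

/-- The piles of a word. -/
def pile : List (V × Bool) → V → List (Option Bool)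
  | [] => fun _ => []
  | y :: w => push Γ y (pile w)

/-- The word `w` has an occurrence of `bar x` preceded only by letters adjacent to `x`. -/
def Canc (x : V × Bool) : List (V × Bool) → Prop
  | [] => False
  | y :: w => y = bar x ∨ (Γ.Adj x.1 y.1 ∧ Canc x w)

/-- A word is reduced if no letter can be cancelled. -/
def Red : List (V × Bool) → Prop
  | [] => True
  | x :: w => Red w ∧ ¬ Canc Γ x w

variable {Γ}

lemma pop_push (y : V × Bool) (π : V → List (Option Bool)) : pop Γ y (push Γ (bar y) π) = π := by
  funext u
  unfold pop push
  by_cases h : u = y.1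
  · subst h; simp
  · by_cases h' : Γ.Adj y.1 u <;> simp [h, h']

lemma push_comm {x y : V × Bool} (h : Γ.Adj x.1 y.1) (π : V → List (Option Bool)) :
    push Γ x (push Γ y π) = push Γ y (push Γ x π) := by
  funext u
  unfold push
  by_cases hx : u = x.1
  · subst hx
    simp [h.ne, h.symm]
  · by_cases hy : u = y.1
    · subst hy
      simp [h.ne', h]
    · by_cases h1 : Γ.Adj x.1 u <;> by_cases h2 : Γ.Adj y.1 u <;> simp [hx, hy, h1, h2]

lemma pop_comm (x y : V × Bool) (π : V → List (Option Bool)) :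
    pop Γ x (pop Γ y π) = pop Γ y (pop Γ x π) := by
  funext u
  unfold pop
  by_cases h1 : Γ.Adj x.1 u <;> by_cases h2 : Γ.Adj y.1 u <;> simp [h1, h2]

lemma canc_iff_head (x : V × Bool) (w : List (V × Bool)) :
    Canc Γ x w ↔ (pile Γ w x.1).head? = some (some (!x.2)) := by
  induction w with
  | nil => simp [Canc, pile]
  | cons y w ih =>
    simp only [Canc, pile, push]
    by_cases h : x.1 = y.1
    · have : (y = bar x) ↔ y.2 = !x.2 := by
        constructor
        · rintro rfl; rfl
        · intro h'; exact Prod.ext h.symm h'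
      simp [h, this]
    · have : y ≠ bar x := by rintro rfl; exact h rfl
      by_cases h' : Γ.Adj x.1 y.1
      · simp [h, this, h', h'.symm, ih]
      · simp [h, this, h', show ¬ Γ.Adj y.1 x.1 from fun e => h' e.symm]

lemma Red.canc_split {w : List (V × Bool)} (hw : Red Γ w) {x : V × Bool} (hc : Canc Γ x w) :
    ∃ w', Red Γ w' ∧ evl Γ w = ev Γ (bar x) * evl Γ w' ∧ pile Γ w = push Γ (bar x) (pile Γ w') ∧
      ¬ Canc Γ (bar x) w' ∧ (∀ y ∈ w', y ∈ w) ∧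
      ∀ z, Γ.Adj z.1 x.1 → (Canc Γ z w' ↔ Canc Γ z w) := by
  induction w with
  | nil => exact hc.elim
  | cons y w ih =>
    by_cases hy : y = bar x
    · subst hy
      refine ⟨w, hw.1, by simp, rfl, hw.2, fun y h => List.mem_cons_of_mem _ h, fun z hz => ?_⟩
      have : bar x ≠ bar z := by
        intro h
        have := congrArg Prod.fst h
        simp at this
        exact hz.ne this.symm
      simp [Canc, this, hz]
    · obtain ⟨hadj, hc'⟩ : Γ.Adj x.1 y.1 ∧ Canc Γ x w := by
        rcases hc with h | h
        · exact absurd h hy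
        · exact h
      obtain ⟨w', h1, h2, h3, h4, h5, h6⟩ := ih hw.1 hc'
      refine ⟨y :: w', ⟨h1, ?_⟩, ?_, ?_, ?_, ?_, ?_⟩
      · rw [h6 y hadj.symm]; exact hw.2
      · rw [evl_cons, evl_cons, h2, ← mul_assoc, ← mul_assoc]
        congr 1
        exact ev_commute (by simpa using hadj.symm)
      · simp only [pile, h3]
        exact push_comm (by simpa using hadj.symm) _
      · rintro (h | h)
        · simp at h
          subst h
          exact hadj.ne rfl
        · exact h4 h.2
      · intro z hz
        rcases List.mem_cons.1 hz with h | h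
        · simp [h]
        · exact List.mem_cons_of_mem _ (h5 z h)
      · intro z hz
        simp [Canc, h6 z hz]

variable (Γ) in
/-- The action of a letter on families of piles. -/
def actF (x : V × Bool) (π : V → List (Option Bool)) : V → List (Option Bool) :=
  if (π x.1).head? = some (some (!x.2)) then pop Γ x π else push Γ x π

lemma actF_of_canc {x : V × Bool} {w : List (V × Bool)} (h : Canc Γ x w) :
    actF Γ x (pile Γ w) = pop Γ x (pile Γ w) := by
  rw [actF, if_pos ((canc_iff_head x w).1 h)]

lemma actF_of_not_canc {x : V × Bool} {w : List (V × Bool)} (h : ¬ Canc Γ x w) :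
    actF Γ x (pile Γ w) = pile Γ (x :: w) := by
  rw [actF, if_neg (fun e => h ((canc_iff_head x w).2 e))]
  rfl

lemma Red.exists_actF {w : List (V × Bool)} (hw : Red Γ w) (x : V × Bool) :
    ∃ w', Red Γ w' ∧ actF Γ x (pile Γ w) = pile Γ w' ∧ evl Γ w' = ev Γ x * evl Γ w ∧
      ∀ y ∈ w', y ∈ x :: w := by
  by_cases hc : Canc Γ x w
  · obtain ⟨w', h1, h2, h3, h4, h5, h6⟩ := hw.canc_split hc
    refine ⟨w', h1, ?_, by simp [h2], fun y hy => List.mem_cons_of_mem _ (h5 y hy)⟩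
    rw [actF_of_canc hc, h3, pop_push]
  · exact ⟨x :: w, ⟨hw, hc⟩, actF_of_not_canc hc, by simp, fun y hy => hy⟩

/-- Every word is equal in the group to a reduced word on the same letters. -/
lemma exists_red (u : List (V × Bool)) :
    ∃ w, Red Γ w ∧ evl Γ w = evl Γ u ∧ ∀ y ∈ w, y ∈ u := by
  induction u with
  | nil => exact ⟨[], trivial, rfl, fun y h => h⟩
  | cons x u ih =>
    obtain ⟨w, h1, h2, h3⟩ := ih
    obtain ⟨w', h4, -, h5, h6⟩ := h1.exists_actF x
    refine ⟨w', h4, by rw [h5, h2, evl_cons], fun y hy => ?_⟩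
    rcases List.mem_cons.1 (h6 y hy) with h | h
    · simp [h]
    · exact List.mem_cons_of_mem _ (h3 y h)

lemma Red.actF_bar {w : List (V × Bool)} (hw : Red Γ w) (x : V × Bool) :
    actF Γ (bar x) (actF Γ x (pile Γ w)) = pile Γ w := by
  by_cases hc : Canc Γ x w
  · obtain ⟨w', h1, h2, h3, h4, h5, h6⟩ := hw.canc_split hc
    rw [actF_of_canc hc, h3, pop_push, actF_of_not_canc h4]
    rfl
  · rw [actF_of_not_canc hc, actF_of_canc (by left; simp)]
    have := pop_push (Γ := Γ) (bar x) (pile Γ w)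
    rwa [bar_bar] at this

lemma push_apply_of_adj {x : V × Bool} {u : V} (h : Γ.Adj x.1 u) (π : V → List (Option Bool)) :
    push Γ x π u = π u := by simp [push, h, h.ne']

lemma pop_apply_of_adj {x : V × Bool} {u : V} (h : Γ.Adj x.1 u) (π : V → List (Option Bool)) :
    pop Γ x π u = π u := by simp [pop, h]

lemma actF_apply_of_adj {x : V × Bool} {u : V} (h : Γ.Adj x.1 u) (π : V → List (Option Bool)) :
    actF Γ x π u = π u := by
  unfold actF
  split_ifs
  · exact pop_apply_of_adj h π
  · exact push_apply_of_adj h π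

lemma Red.push_pop {w : List (V × Bool)} (hw : Red Γ w) {x y : V × Bool} (h : Γ.Adj x.1 y.1)
    (hc : Canc Γ y w) : push Γ x (pop Γ y (pile Γ w)) = pop Γ y (push Γ x (pile Γ w)) := by
  obtain ⟨w', h1, h2, h3, h4, h5, h6⟩ := hw.canc_split hc
  rw [h3, pop_push, push_comm (by simpa using h), pop_push]

lemma Red.actF_comm {w : List (V × Bool)} (hw : Red Γ w) {x y : V × Bool} (h : Γ.Adj x.1 y.1) :
    actF Γ x (actF Γ y (pile Γ w)) = actF Γ y (actF Γ x (pile Γ w)) := by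
  have hx := actF_apply_of_adj (x := y) h.symm (pile Γ w)
  have hy := actF_apply_of_adj (x := x) h (pile Γ w)
  have hl (h1 : Canc Γ x w) : actF Γ x (actF Γ y (pile Γ w)) = pop Γ x (actF Γ y (pile Γ w)) := by
    rw [actF, if_pos (by rw [hx]; exact (canc_iff_head x w).1 h1)]
  have hl' (h1 : ¬ Canc Γ x w) :
      actF Γ x (actF Γ y (pile Γ w)) = push Γ x (actF Γ y (pile Γ w)) := by
    rw [actF, if_neg (by rw [hx]; exact fun e => h1 ((canc_iff_head x w).2 e))]
  have hr (h1 : Canc Γ y w) : actF Γ y (actF Γ x (pile Γ w)) = pop Γ y (actF Γ x (pile Γ w)) := by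
    rw [actF, if_pos (by rw [hy]; exact (canc_iff_head y w).1 h1)]
  have hr' (h1 : ¬ Canc Γ y w) :
      actF Γ y (actF Γ x (pile Γ w)) = push Γ y (actF Γ x (pile Γ w)) := by
    rw [actF, if_neg (by rw [hy]; exact fun e => h1 ((canc_iff_head y w).2 e))]
  by_cases h1 : Canc Γ x w <;> by_cases h2 : Canc Γ y w
  · rw [hl h1, hr h2, actF_of_canc h1, actF_of_canc h2, pop_comm]
  · rw [hl h1, hr' h2, actF_of_canc h1, actF_of_not_canc h2]
    exact (hw.push_pop h.symm h1).symm
  · rw [hl' h1, hr h2, actF_of_canc h2, actF_of_not_canc h1]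
    exact hw.push_pop h h2
  · rw [hl' h1, hr' h2, actF_of_not_canc h1, actF_of_not_canc h2]
    exact push_comm h _

variable (Γ) in
/-- The piles of reduced words. -/
abbrev RedPile := {π : V → List (Option Bool) // ∃ w, Red Γ w ∧ pile Γ w = π}

variable (Γ) in
/-- The action of a letter on piles of reduced words. -/
def actX (x : V × Bool) (π : RedPile Γ) : RedPile Γ :=
  ⟨actF Γ x π.1, by
    obtain ⟨w, hw, h⟩ := π.2
    obtain ⟨w', h1, h2, -⟩ := hw.exists_actF x
    exact ⟨w', h1, by rw [← h, h2]⟩⟩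

lemma actX_bar (x : V × Bool) (π : RedPile Γ) : actX Γ (bar x) (actX Γ x π) = π := by
  obtain ⟨_, w, hw, rfl⟩ := π
  exact Subtype.ext (hw.actF_bar x)

lemma actX_comm {x y : V × Bool} (h : Γ.Adj x.1 y.1) (π : RedPile Γ) :
    actX Γ x (actX Γ y π) = actX Γ y (actX Γ x π) := by
  obtain ⟨_, w, hw, rfl⟩ := π
  exact Subtype.ext (hw.actF_comm h)

variable (Γ) in
/-- A generator as a permutation of the piles of reduced words. -/
def genPerm (v : V) : Equiv.Perm (RedPile Γ) where
  toFun := actX Γ (v, true)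
  invFun := actX Γ (v, false)
  left_inv := actX_bar (v, true)
  right_inv := actX_bar (v, false)

variable (Γ) in
/-- The action of the group on the piles of reduced words. -/
def raagPerm : Raag Γ →* Equiv.Perm (RedPile Γ) :=
  PresentedGroup.toGroup (f := genPerm Γ) (by
    rintro r ⟨u, v, h, rfl⟩
    simp only [map_mul, map_inv, FreeGroup.lift_apply_of]
    rw [mul_inv_eq_one, mul_inv_eq_iff_eq_mul]
    ext1 π
    exact actX_comm h π)

lemma raagPerm_ev (x : V × Bool) (π : RedPile Γ) : raagPerm Γ (ev Γ x) π = actX Γ x π := by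
  have h (v : V) : raagPerm Γ (gen Γ v) = genPerm Γ v := PresentedGroup.toGroup.of _
  obtain ⟨v, ε⟩ := x
  cases ε
  · rw [ev_false, map_inv, h]; rfl
  · rw [ev_true, h]; rfl

/-- The number of letters in a family of piles. -/
def pileSize (π : V → List (Option Bool)) : ℕ := ∑ u, ((π u).filter Option.isSome).length

lemma pileSize_push (x : V × Bool) (π : V → List (Option Bool)) :
    pileSize (push Γ x π) = pileSize π + 1 := by
  have : ∀ u, ((push Γ x π u).filter Option.isSome).length =
      ((π u).filter Option.isSome).length + if u = x.1 then 1 else 0 := by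
    intro u
    unfold push
    by_cases h : u = x.1
    · simp [h]
    · by_cases h' : Γ.Adj x.1 u <;> simp [h, h']
  simp [pileSize, this, Finset.sum_add_distrib]

lemma pileSize_pile (w : List (V × Bool)) : pileSize (pile Γ w) = w.length := by
  induction w with
  | nil => simp [pile, pileSize]
  | cons x w ih => simp [pile, pileSize_push, ih]

variable (Γ) in
/-- The piles of a group element. -/
def pileOf (g : Raag Γ) : RedPile Γ := raagPerm Γ g ⟨pile Γ [], [], trivial, rfl⟩

variable (Γ) in
/-- The word length of a group element. -/
def len (g : Raag Γ) : ℕ := pileSize (pileOf Γ g).1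

lemma pileOf_mul (x : V × Bool) (g : Raag Γ) :
    (pileOf Γ (ev Γ x * g)).1 = actF Γ x (pileOf Γ g).1 := by
  unfold pileOf
  rw [map_mul, Equiv.Perm.mul_apply, raagPerm_ev]
  rfl

lemma Red.pileOf {w : List (V × Bool)} (hw : Red Γ w) : (pileOf Γ (evl Γ w)).1 = pile Γ w := by
  induction w with
  | nil => simp [RaagPaper.pileOf]
  | cons x w ih => rw [evl_cons, pileOf_mul, ih hw.1, actF_of_not_canc hw.2]

lemma Red.len {w : List (V × Bool)} (hw : Red Γ w) : len Γ (evl Γ w) = w.length := by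
  rw [RaagPaper.len, hw.pileOf, pileSize_pile]

lemma len_evl_le (u : List (V × Bool)) : len Γ (evl Γ u) ≤ u.length := by
  induction u with
  | nil => exact (Red.len (w := []) trivial).le
  | cons x u ih =>
    obtain ⟨w, hw, h, -⟩ := exists_red (Γ := Γ) u
    rw [← h, hw.len] at ih
    rw [evl_cons, ← h, RaagPaper.len, pileOf_mul, hw.pileOf, List.length_cons]
    by_cases hc : Canc Γ x w
    · obtain ⟨w', h1, h2, h3, h4, h5, h6⟩ := hw.canc_split hc
      have : pileSize (pile Γ w) = pileSize (pile Γ w') + 1 := by rw [h3, pileSize_push]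
      rw [pileSize_pile] at this
      rw [actF_of_canc hc, h3, pop_push]
      omega
    · rw [actF_of_not_canc hc, pileSize_pile, List.length_cons]
      omega

variable (Γ) in
lemma exists_red_evl (g : Raag Γ) : ∃ w, Red Γ w ∧ evl Γ w = g := by
  obtain ⟨u, rfl⟩ := exists_evl Γ g
  obtain ⟨w, h1, h2, -⟩ := exists_red (Γ := Γ) u
  exact ⟨w, h1, h2⟩

lemma red_singleton (x : V × Bool) : Red Γ [x] := ⟨trivial, fun h => h⟩

lemma len_ev (x : V × Bool) : len Γ (ev Γ x) = 1 := by
  have := (red_singleton (Γ := Γ) x).len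
  simpa using this

lemma len_eq_zero {g : Raag Γ} (h : len Γ g = 0) : g = 1 := by
  obtain ⟨w, hw, rfl⟩ := exists_red_evl Γ g
  rw [hw.len, List.length_eq_zero_iff] at h
  simp [h]

lemma len_eq_one {g : Raag Γ} (h : len Γ g = 1) : ∃ x, g = ev Γ x := by
  obtain ⟨w, hw, rfl⟩ := exists_red_evl Γ g
  rw [hw.len, List.length_eq_one_iff] at h
  obtain ⟨x, rfl⟩ := h
  exact ⟨x, by simp⟩

lemma len_one : len Γ 1 = 0 := (Red.len (Γ := Γ) (w := []) trivial)

lemma ev_injective : Function.Injective (ev Γ) := by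
  intro x y h
  have h1 := (red_singleton (Γ := Γ) x).pileOf
  have h2 := (red_singleton (Γ := Γ) y).pileOf
  simp only [evl_cons, evl_nil, mul_one] at h1 h2
  rw [h, h2] at h1
  have := congrFun h1 x.1
  simp only [pile, push] at this
  by_cases hxy : x.1 = y.1
  · simp [hxy] at this
    exact Prod.ext hxy this.symm
  · by_cases ha : Γ.Adj y.1 x.1 <;> simp [hxy, ha] at this

lemma adj_of_commute {x y : V × Bool} (hne : x.1 ≠ y.1) (h : Commute (ev Γ x) (ev Γ y)) :
    Γ.Adj x.1 y.1 := by
  by_contra ha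
  have hr {x y : V × Bool} (hne : x.1 ≠ y.1) : Red Γ [x, y] :=
    ⟨red_singleton y, by rintro (h | h); exacts [hne (by rw [h]; rfl), h.2]⟩
  have h1 := (hr hne).pileOf
  have h2 := (hr hne.symm).pileOf
  simp only [evl_cons, evl_nil, mul_one] at h1 h2
  rw [h.eq, h2] at h1
  have := congrFun h1 x.1
  simp [pile, push, hne, show ¬ Γ.Adj y.1 x.1 from fun e => ha e.symm] at this

end piles

end Words

section Whitehead

/-- Integral weights on the letters and the basepoint `none` that define an automorphism
multiplying letters by powers of the vertex `v`. -/
structure Adm (Γ : SimpleGraph V) (v : V) (s : Option (V × Bool) → ℤ) : Prop where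
  lk : ∀ x : V × Bool, Γ.Adj v x.1 → s (some (bar x)) = s (some x)
  closed : ∀ x y : V × Bool, Γ.Adj x.1 y.1 → ¬ Γ.Adj v x.1 → ¬ Γ.Adj v y.1 →
    s (some x) = s (some y)

/-- The image of the generator `u` under the automorphism with multiplier `a` and weights `s`. -/
def whGen (Γ : SimpleGraph V) (a : V × Bool) (s : Option (V × Bool) → ℤ) (u : V) : Raag Γ :=
  if u = a.1 then gen Γ u else
    ev Γ a ^ (s none - s (some (u, false))) * gen Γ u * ev Γ a ^ (s (some (u, true)) - s none)

variable {Γ : SimpleGraph V} {a : V × Bool} {s s' : Option (V × Bool) → ℤ}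

lemma Adm.add (h : Adm Γ a.1 s) (h' : Adm Γ a.1 s') : Adm Γ a.1 (s + s') :=
  ⟨fun x hx => by simp [h.lk x hx, h'.lk x hx],
    fun x y hxy hx hy => by simp [h.closed x y hxy hx hy, h'.closed x y hxy hx hy]⟩

lemma Adm.neg (h : Adm Γ a.1 s) : Adm Γ a.1 (-s) :=
  ⟨fun x hx => by simp [h.lk x hx], fun x y hxy hx hy => by simp [h.closed x y hxy hx hy]⟩

lemma Adm.zero : Adm Γ a.1 0 := ⟨fun _ _ => rfl, fun _ _ _ _ _ => rfl⟩

lemma ev_commute_gen {u : V} (h : Γ.Adj a.1 u) : Commute (ev Γ a) (gen Γ u) :=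
  ev_commute (y := (u, true)) h

lemma Adm.whGen_lk (h : Adm Γ a.1 s) {u : V} (hu : Γ.Adj a.1 u) : whGen Γ a s u = gen Γ u := by
  rw [whGen, if_neg hu.ne', ((ev_commute_gen hu).zpow_left _).eq, mul_assoc, ← zpow_add]
  have := h.lk (u, true) hu
  simp only [bar, Bool.not_true] at this
  simp [this]

lemma Adm.commute_whGen (h : Adm Γ a.1 s) {u v : V} (huv : Γ.Adj u v) :
    Commute (whGen Γ a s u) (whGen Γ a s v) := by
  have key {u v : V} (huv : Γ.Adj u v) (hu : Γ.Adj a.1 u) :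
      Commute (whGen Γ a s u) (whGen Γ a s v) := by
    rw [h.whGen_lk hu, whGen]
    have hc := (ev_commute_gen hu).symm
    split_ifs
    · exact gen_commute huv
    · exact ((hc.zpow_right _).mul_right (gen_commute huv)).mul_right (hc.zpow_right _)
  by_cases hu : Γ.Adj a.1 u
  · exact key huv hu
  · by_cases hv : Γ.Adj a.1 v
    · exact (key huv.symm hv).symm
    · have hua : u ≠ a.1 := by rintro rfl; exact hv huv
      have hva : v ≠ a.1 := by rintro rfl; exact hu huv.symm
      have h1 := h.closed (u, true) (v, true) huv hu hv
      have h2 := h.closed (u, false) (v, true) huv hu hv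
      have h3 := h.closed (u, true) (v, false) huv hu hv
      rw [whGen, whGen, if_neg hua, if_neg hva, h2, ← h3, h1]
      have e : s (some (v, true)) - s none = -(s none - s (some (v, true))) := by ring
      rw [e, zpow_neg]
      exact (Commute.conj_iff _).2 (gen_commute huv)

/-- The endomorphism with multiplier `a` and weights `s`. -/
def whHom (h : Adm Γ a.1 s) : Raag Γ →* Raag Γ :=
  PresentedGroup.toGroup (f := whGen Γ a s) (by
    rintro r ⟨u, v, huv, rfl⟩
    simp only [map_mul, map_inv, FreeGroup.lift_apply_of]
    rw [mul_inv_eq_one, mul_inv_eq_iff_eq_mul]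
    exact h.commute_whGen huv)

lemma whHom_gen (h : Adm Γ a.1 s) (u : V) : whHom h (gen Γ u) = whGen Γ a s u :=
  PresentedGroup.toGroup.of _

lemma whHom_self (h : Adm Γ a.1 s) : whHom h (ev Γ a) = ev Γ a := by
  have : whHom h (gen Γ a.1) = gen Γ a.1 := by rw [whHom_gen, whGen, if_pos rfl]
  unfold ev
  split_ifs
  · exact this
  · rw [map_inv, this]

lemma whHom_comp (h : Adm Γ a.1 s) (h' : Adm Γ a.1 s') (u : V) :
    whHom h (whHom h' (gen Γ u)) = whGen Γ a (s + s') u := by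
  rw [whHom_gen, whGen, whGen]
  split_ifs with hu
  · rw [whHom_gen, whGen, if_pos hu]
  · simp only [map_mul, map_zpow, whHom_self]
    rw [whHom_gen, whGen, if_neg hu]
    simp only [Pi.add_apply]
    have e1 : s none + s' none - (s (some (u, false)) + s' (some (u, false))) =
      (s' none - s' (some (u, false))) + (s none - s (some (u, false))) := by ring
    have e2 : s (some (u, true)) + s' (some (u, true)) - (s none + s' none) =
      (s (some (u, true)) - s none) + (s' (some (u, true)) - s' none) := by ring
    rw [e1, e2, zpow_add, zpow_add]
    simp only [mul_assoc]

lemma whGen_zero (u : V) : whGen Γ a 0 u = gen Γ u := by simp [whGen]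

/-- The automorphism with multiplier `a` and weights `s`. -/
def wh (h : Adm Γ a.1 s) : MulAut (Raag Γ) :=
  MonoidHom.toMulEquiv (whHom h) (whHom h.neg)
    (PresentedGroup.ext fun u => by
      change whHom h.neg (whHom h (gen Γ u)) = gen Γ u
      rw [whHom_comp, neg_add_cancel, whGen_zero])
    (PresentedGroup.ext fun u => by
      change whHom h (whHom h.neg (gen Γ u)) = gen Γ u
      rw [whHom_comp, add_neg_cancel, whGen_zero])

lemma wh_gen (h : Adm Γ a.1 s) (u : V) : wh h (gen Γ u) = whGen Γ a s u := whHom_gen h u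

lemma wh_self (h : Adm Γ a.1 s) : wh h (ev Γ a) = ev Γ a := whHom_self h

lemma wh_ev (h : Adm Γ a.1 s) {x : V × Bool} (hx : x.1 ≠ a.1) :
    wh h (ev Γ x) = ev Γ a ^ (s none - s (some (bar x))) * ev Γ x *
      ev Γ a ^ (s (some x) - s none) := by
  obtain ⟨u, ε⟩ := x
  cases ε
  · rw [ev_false, map_inv, wh_gen, whGen, if_neg hx]
    simp only [mul_inv_rev, bar, Bool.not_false, ← zpow_neg, neg_sub, mul_assoc]
  · rw [ev_true, wh_gen, whGen, if_neg hx]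
    rfl

lemma wh_ev_same (h : Adm Γ a.1 s) {x : V × Bool} (hx : x.1 = a.1) : wh h (ev Γ x) = ev Γ x := by
  rcases eq_or_eq_bar hx with rfl | rfl
  · exact wh_self h
  · rw [ev_bar, map_inv, wh_self]

lemma wh_ev_lk (h : Adm Γ a.1 s) {x : V × Bool} (hx : Γ.Adj a.1 x.1) :
    wh h (ev Γ x) = ev Γ x := by
  have : wh h (gen Γ x.1) = gen Γ x.1 := by rw [wh_gen, h.whGen_lk hx]
  unfold ev
  split_ifs
  · exact this
  · rw [map_inv, this]

lemma wh_mul (h : Adm Γ a.1 s) (h' : Adm Γ a.1 s') : wh h * wh h' = wh (h.add h') :=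
  mulEquiv_ext_gen fun u => by
    rw [wh_gen, MulAut.mul_apply]
    exact whHom_comp h h' u

lemma wh_zero : wh (Adm.zero (Γ := Γ) (a := a)) = 1 :=
  mulEquiv_ext_gen fun u => by rw [wh_gen, whGen_zero]; rfl

lemma wh_congr (h : Adm Γ a.1 s) (h' : Adm Γ a.1 s') (c : ℤ) (h0 : s none = s' none + c)
    (hs : ∀ x : V × Bool, x.1 ≠ a.1 → ¬ Γ.Adj a.1 x.1 → s (some x) = s' (some x) + c) :
    wh h = wh h' :=
  mulEquiv_ext_gen fun u => by
    by_cases hu : Γ.Adj a.1 u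
    · rw [wh_gen, wh_gen, h.whGen_lk hu, h'.whGen_lk hu]
    · rw [wh_gen, wh_gen, whGen, whGen]
      split_ifs with hu'
      · rfl
      · rw [h0, hs _ hu' hu, hs _ hu' hu, add_sub_add_right_eq_sub, add_sub_add_right_eq_sub]

lemma wh_inv (h : Adm Γ a.1 s) : (wh h)⁻¹ = wh h.neg := by
  rw [inv_eq_iff_mul_eq_one, wh_mul, ← wh_zero (a := a)]
  exact wh_congr _ _ 0 (by simp) (by simp)

lemma Adm.bar (h : Adm Γ a.1 s) : Adm Γ (bar a).1 s := h

lemma wh_bar (h : Adm Γ a.1 s) : wh h.bar = wh h.neg :=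
  mulEquiv_ext_gen fun u => by
    rw [wh_gen, wh_gen, whGen, whGen, bar_fst]
    split_ifs
    · rfl
    · simp only [ev_bar, inv_zpow', Pi.neg_apply]
      congr 2
      · congr 1
        ring
      · ring

/-- The indicator of a set of letters. -/
def ind (A : Option (V × Bool) → Bool) : Option (V × Bool) → ℤ := fun o => if A o then 1 else 0

/-- `(A, a)` defines a Whitehead automorphism. -/
structure IsWh (Γ : SimpleGraph V) (A : Option (V × Bool) → Bool) (a : V × Bool) : Prop where
  mem : A (some a) = true
  not_mem : A (some (bar a)) = false
  lk : ∀ x : V × Bool, Γ.Adj a.1 x.1 → A (some x) = false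
  closed : ∀ x y : V × Bool, Γ.Adj x.1 y.1 → ¬ Γ.Adj a.1 x.1 → ¬ Γ.Adj a.1 y.1 →
    A (some x) = A (some y)

variable {A : Option (V × Bool) → Bool}

lemma IsWh.adm (h : IsWh Γ A a) : Adm Γ a.1 (ind A) :=
  ⟨fun x hx => by simp [ind, h.lk x hx, h.lk (RaagPaper.bar x) hx],
    fun x y hxy hx hy => by simp [ind, h.closed x y hxy hx hy]⟩

variable (Γ) in
/-- The set of Whitehead automorphisms. -/
def whSet : Set (MulAut (Raag Γ)) :=
  {φ | ∃ (A : Option (V × Bool) → Bool) (a : V × Bool) (h : IsWh Γ A a), φ = wh h.adm}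

lemma whSet_finite : (whSet Γ).Finite := by
  classical
  have : whSet Γ ⊆ Set.range (fun p : (Option (V × Bool) → Bool) × (V × Bool) =>
      if h : IsWh Γ p.1 p.2 then wh h.adm else 1) := by
    rintro φ ⟨A, a, h, rfl⟩
    exact ⟨(A, a), by simp [h]⟩
  exact (Set.finite_range _).subset this

lemma wh_mem_whSet (h : Adm Γ a.1 s) (c : ℤ) (h0 : s none = c ∨ s none = c + 1)
    (hs : ∀ x : V × Bool, x.1 ≠ a.1 → ¬ Γ.Adj a.1 x.1 → s (some x) = c ∨ s (some x) = c + 1) :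
    wh h ∈ whSet Γ := by
  classical
  let A : Option (V × Bool) → Bool := fun o => match o with
    | none => s none = c + 1
    | some x => if x.1 = a.1 then x = a else if Γ.Adj a.1 x.1 then false else s (some x) = c + 1
  have hA : IsWh Γ A a := by
    refine ⟨by simp [A], by simp [A, bar_ne], fun x hx => by simp [A, hx, hx.ne'], ?_⟩
    intro x y hxy hx hy
    have hxa : x.1 ≠ a.1 := by intro e; rw [e] at hxy; exact hy hxy
    have hya : y.1 ≠ a.1 := by intro e; rw [e] at hxy; exact hx hxy.symm
    simp [A, hxa, hya, hx, hy, h.closed x y hxy hx hy]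
  refine ⟨A, a, hA, wh_congr _ _ c ?_ ?_⟩
  · rcases h0 with e | e <;> simp [ind, A, e] <;> ring
  · intro x hx hx'
    rcases hs x hx hx' with e | e <;> simp [ind, A, e, hx, hx'] <;> ring

lemma whSet_inv {φ : MulAut (Raag Γ)} (h : φ ∈ whSet Γ) : φ⁻¹ ∈ whSet Γ := by
  obtain ⟨A, a, h, rfl⟩ := h
  rw [wh_inv]
  refine wh_mem_whSet _ (-1) ?_ ?_
  · simp only [ind, Pi.neg_apply]; split_ifs <;> simp
  · intro x _ _
    simp only [ind, Pi.neg_apply]; split_ifs <;> simp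

open Classical in
/-- The complementary set of letters, which defines the same Whitehead automorphism with the
inverse multiplier. -/
noncomputable def flipSet (Γ : SimpleGraph V) (A : Option (V × Bool) → Bool) (a : V × Bool) :
    Option (V × Bool) → Bool
  | none => !A none
  | some x => if Γ.Adj a.1 x.1 then false else !A (some x)

lemma IsWh.flip (h : IsWh Γ A a) : IsWh Γ (flipSet Γ A a) (bar a) := by
  refine ⟨by simp [flipSet, h.not_mem], by simp [flipSet, h.mem], fun x hx => ?_, ?_⟩
  · simp only [bar_fst] at hx; simp [flipSet, hx]
  · intro x y hxy hx hy
    simp only [bar_fst] at hx hy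
    simp [flipSet, hx, hy, h.closed x y hxy hx hy]

lemma IsWh.wh_flip (h : IsWh Γ A a) : wh h.flip.adm = wh h.adm := by
  have h1 : Adm Γ a.1 (ind (flipSet Γ A a)) := h.flip.adm
  refine (wh_bar h1).trans (wh_congr h1.neg h.adm (-1) ?_ ?_)
  · rcases hA : A none with _ | _ <;> simp [ind, flipSet, hA]
  · intro x _ hx
    rcases hA : A (some x) with _ | _ <;> simp [ind, flipSet, hA, hx]

end Whitehead

section Cuts

/-- The power of the letter `a` with exponent `p - q`. -/
def slot (a : V × Bool) : Bool → Bool → List (V × Bool)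
  | true, false => [a]
  | false, true => [bar a]
  | _, _ => []

/-- The Boolean difference. -/
def dif (p q : Bool) : ℕ := if p = q then 0 else 1

/-- The number of letters `v` and their inverses in a word. -/
def cnt (v : V) : List (V × Bool) → ℕ
  | [] => 0
  | y :: w => (if y.1 = v then 1 else 0) + cnt v w

section

variable (Γ : SimpleGraph V) [DecidableRel Γ.Adj]

/-- The image of a word under the Whitehead automorphism of `(A, a)`, started in state `p`. -/
def img (A : Option (V × Bool) → Bool) (a : V × Bool) : Bool → List (V × Bool) → List (V × Bool)
  | p, [] => slot a p (A none)
  | p, y :: w => if Γ.Adj a.1 y.1 then y :: img A a p w else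
      slot a p (A (some (bar y))) ++
        if y.1 = a.1 then img A a (A (some y)) w else y :: img A a (A (some y)) w

/-- The number of places where a word crosses the boundary of `A`, letters adjacent to `v` being
ignored. -/
def cut (A : Option (V × Bool) → Bool) (v : V) : Bool → List (V × Bool) → ℕ
  | p, [] => dif p (A none)
  | p, y :: w => if Γ.Adj v y.1 then cut A v p w else
      dif p (A (some (bar y))) + cut A v (A (some y)) w

end

variable {Γ : SimpleGraph V} [DecidableRel Γ.Adj] {A : Option (V × Bool) → Bool} {a : V × Bool}

lemma evl_slot (p q : Bool) :
    evl Γ (slot a p q) = ev Γ a ^ ((if p then 1 else 0 : ℤ) - if q then 1 else 0) := by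
  cases p <;> cases q <;> simp [slot]

lemma length_slot (p q : Bool) : (slot a p q).length = dif p q := by
  cases p <;> cases q <;> rfl

lemma evl_img (h : IsWh Γ A a) (w : List (V × Bool)) (p : Bool) :
    evl Γ (img Γ A a p w) =
      ev Γ a ^ ((if p then 1 else 0 : ℤ) - ind A none) * wh h.adm (evl Γ w) := by
  induction w generalizing p with
  | nil => simp only [img, evl_slot, ind, evl_nil, map_one, mul_one]
  | cons y w ih =>
    rw [evl_cons, map_mul, img]
    by_cases h1 : Γ.Adj a.1 y.1
    · rw [if_pos h1, evl_cons, ih, wh_ev_lk _ h1, ← mul_assoc, ← mul_assoc,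
        ((ev_commute (Γ := Γ) h1).zpow_left _).eq]
    rw [if_neg h1]
    by_cases h2 : y.1 = a.1
    · rw [if_pos h2, evl_append, ih, evl_slot, wh_ev_same _ h2]
      simp only [← mul_assoc]
      congr 1
      rcases eq_or_eq_bar h2 with rfl | rfl
      · rw [h.mem, h.not_mem, ← zpow_add, ← zpow_add_one]
        congr 1
        simp
        ring
      · rw [bar_bar, h.mem, h.not_mem, ← zpow_add, ev_bar, ← zpow_sub_one]
        congr 1
        simp
        ring
    · rw [if_neg h2, evl_append, evl_cons, ih, evl_slot, wh_ev _ h2]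
      simp only [← mul_assoc, ← zpow_add]
      congr 4
      simp only [ind]
      ring

lemma length_img (w : List (V × Bool)) (p : Bool) :
    (img Γ A a p w).length + cnt a.1 w = w.length + cut Γ A a.1 p w := by
  induction w generalizing p with
  | nil => simp [img, cut, cnt, length_slot]
  | cons y w ih =>
    rw [img, cut, cnt]
    split_ifs with h1 h2 h2
    · exact absurd h2 h1.ne'
    · have := ih p
      simp only [List.length_cons]
      omega
    · have := ih (A (some y))
      simp only [List.length_append, List.length_cons, length_slot]
      omega
    · have := ih (A (some y))
      simp only [List.length_append, List.length_cons, length_slot]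
      omega

lemma canc_slot_append {y : V × Bool} (hy : y.1 ≠ a.1) (hya : ¬ Γ.Adj y.1 a.1) {p q : Bool}
    {u : List (V × Bool)} (h : Canc Γ y (slot a p q ++ u)) : p = q ∧ Canc Γ y u := by
  have h1 : a ≠ bar y := by rintro rfl; exact hy rfl
  have h2 : bar a ≠ bar y := by
    intro e
    have := congrArg Prod.fst e
    exact hy this.symm
  cases p <;> cases q <;> simp_all [slot, Canc]

lemma canc_slot_append_lk {y : V × Bool} (hya : Γ.Adj a.1 y.1) {p q : Bool}
    {u : List (V × Bool)} (h : Canc Γ y (slot a p q ++ u)) : Canc Γ y u := by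
  have h1 : a ≠ bar y := by rintro rfl; exact hya.ne rfl
  have h2 : bar a ≠ bar y := by
    intro e
    have := congrArg Prod.fst e
    exact hya.ne this
  cases p <;> cases q <;> simp_all [slot, Canc]

lemma canc_slot {y : V × Bool} (hy : y.1 ≠ a.1) {p q : Bool} : ¬ Canc Γ y (slot a p q) := by
  have h1 : a ≠ bar y := by rintro rfl; exact hy rfl
  have h2 : bar a ≠ bar y := by
    intro e
    have := congrArg Prod.fst e
    exact hy this.symm
  cases p <;> cases q <;> simp_all [slot, Canc]

lemma canc_img_lk {y : V × Bool} (hy : Γ.Adj a.1 y.1) {w : List (V × Bool)} {p : Bool}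
    (h : Canc Γ y (img Γ A a p w)) : Canc Γ y w := by
  induction w generalizing p with
  | nil => exact (canc_slot hy.ne' h).elim
  | cons z w ih =>
    rw [img] at h
    split_ifs at h with h1 h2
    · rcases h with h | h
      · exact Or.inl h
      · exact Or.inr ⟨h.1, ih h.2⟩
    · have := ih (canc_slot_append_lk hy h)
      exact Or.inr ⟨by rw [h2]; exact hy.symm, this⟩
    · rcases canc_slot_append_lk hy h with h | h
      · exact Or.inl h
      · exact Or.inr ⟨h.1, ih h.2⟩

/-- The power of `a` that lies in `A` or not according to `p`. -/
def side (a : V × Bool) (p : Bool) : V × Bool := if p then a else bar a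

lemma side_fst (p : Bool) : (side a p).1 = a.1 := by cases p <;> rfl

lemma IsWh.side_eq (h : IsWh Γ A a) {z : V × Bool} (hz : z.1 = a.1) :
    side a (A (some z)) = z := by
  rcases eq_or_eq_bar hz with rfl | rfl
  · simp [side, h.mem]
  · simp [side, h.not_mem]

lemma IsWh.apply_bar (h : IsWh Γ A a) {z : V × Bool} (hz : z.1 = a.1) :
    A (some (bar z)) = !A (some z) := by
  rcases eq_or_eq_bar hz with rfl | rfl
  · simp [h.not_mem, h.mem]
  · simp [h.not_mem, h.mem]

lemma canc_img_self (h : IsWh Γ A a) {w : List (V × Bool)} {p : Bool}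
    (hc : Canc Γ (side a p) (img Γ A a p w)) : Canc Γ (side a p) w := by
  induction w with
  | nil =>
    have h1 := bar_ne a
    have h2 := (bar_ne a).symm
    rw [img] at hc
    rcases hA : A none with _ | _ <;> cases p <;> simp_all [slot, side, Canc]
  | cons z w ih =>
    rw [img] at hc
    split_ifs at hc with h1 h2
    · rcases hc with hc | hc
      · exact Or.inl hc
      · exact Or.inr ⟨hc.1, ih hc.2⟩
    · left
      rcases eq_or_eq_bar h2 with rfl | rfl
      · cases p
        · simp [side]
        · simp only [h.not_mem, h.mem, slot, side, if_true, List.singleton_append] at hc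
          rcases hc with hc | hc
          · exact absurd hc.symm (bar_ne _)
          · exact absurd rfl hc.1.ne
      · cases p
        · simp only [bar_bar, h.not_mem, h.mem, slot, side, List.singleton_append] at hc
          rcases hc with hc | hc
          · simp at hc
            exact absurd hc (bar_ne _)
          · exact absurd rfl hc.1.ne
        · simp [side]
    · exfalso
      have h3 : z ≠ bar (side a p) := by
        intro e
        exact h2 (by rw [e]; exact side_fst p)
      have h4 : ¬ Γ.Adj (side a p).1 z.1 := by rw [side_fst]; exact h1
      have h5 : ¬ Canc Γ (side a p) (z :: img Γ A a (A (some z)) w) := by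
        rintro (e | e)
        exacts [h3 e, h4 e.1]
      have h6 := bar_ne a
      have h7 := h6.symm
      have h8 : Γ.Adj a.1 a.1 → False := fun e => e.ne rfl
      rcases hA : A (some (bar z)) with _ | _ <;> cases p <;>
        simp_all [slot, side, Canc]

lemma not_canc_img (h : IsWh Γ A a) {y : V × Bool} (hy : y.1 ≠ a.1) (hya : ¬ Γ.Adj a.1 y.1)
    {w : List (V × Bool)} {p : Bool} (hp : p ≠ A (some y)) (hw : ¬ Canc Γ (side a p) w) :
    ¬ Canc Γ y (img Γ A a p w) := by
  have hya' : ¬ Γ.Adj y.1 a.1 := fun e => hya e.symm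
  induction w with
  | nil => exact canc_slot hy
  | cons z w ih =>
    intro hc
    rw [img] at hc
    split_ifs at hc with h1 h2
    · rcases hc with rfl | hc
      · exact hya h1
      · exact ih (fun e => hw (Or.inr ⟨by rw [side_fst]; exact h1, e⟩)) hc.2
    · have := (canc_slot_append hy hya' hc).1
      refine hw (Or.inl ?_)
      rw [this, h.side_eq (by exact h2), bar_bar]
    · obtain ⟨h3, h4⟩ := canc_slot_append hy hya' hc
      rcases h4 with rfl | h4
      · rw [bar_bar] at h3; exact hp h3
      · exact hp (h3.trans (h.closed _ _ h4.1.symm h1 hya))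

lemma canc_img (h : IsWh Γ A a) {y : V × Bool} (hy : y.1 ≠ a.1) (hya : ¬ Γ.Adj a.1 y.1)
    {w : List (V × Bool)} (hw : Red Γ w)
    (hc : Canc Γ y (img Γ A a (A (some y)) w)) : Canc Γ y w := by
  have hya' : ¬ Γ.Adj y.1 a.1 := fun e => hya e.symm
  induction w with
  | nil => exact (canc_slot hy hc).elim
  | cons z w ih =>
    rw [img] at hc
    split_ifs at hc with h1 h2
    · rcases hc with hc | hc
      · exact Or.inl hc
      · exact Or.inr ⟨hc.1, ih hw.1 hc.2⟩
    · exfalso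
      obtain ⟨h3, h4⟩ := canc_slot_append hy hya' hc
      refine not_canc_img h hy hya ?_ ?_ h4
      · rw [h3, h.apply_bar h2]
        cases A (some z) <;> simp
      · rw [h.side_eq h2]; exact hw.2
    · obtain ⟨h3, h4⟩ := canc_slot_append hy hya' hc
      rcases h4 with h4 | h4
      · exact Or.inl h4
      · refine Or.inr ⟨h4.1, ih hw.1 ?_⟩
        rw [h.closed y z h4.1 hya h1]
        exact h4.2

lemma red_img (h : IsWh Γ A a) {w : List (V × Bool)} (hw : Red Γ w) (p : Bool) :
    Red Γ (img Γ A a p w) := by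
  induction w generalizing p with
  | nil =>
    rw [img]
    cases p <;> cases A none <;> first | exact trivial | exact red_singleton _
  | cons z w ih =>
    rw [img]
    split_ifs with h1 h2
    · exact ⟨ih hw.1 p, fun e => hw.2 (canc_img_lk h1 e)⟩
    · have h3 := ih hw.1 (A (some z))
      have h4 : ¬ Canc Γ z (img Γ A a (A (some z)) w) := by
        intro e
        have := canc_img_self h (p := A (some z)) (w := w) (by rw [h.side_eq h2]; exact e)
        rw [h.side_eq h2] at this
        exact hw.2 this
      have h5 : slot a p (A (some (bar z))) = [] ∨ slot a p (A (some (bar z))) = [z] := by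
        rcases eq_or_eq_bar h2 with rfl | rfl <;> cases p <;> simp [h.mem, h.not_mem, slot]
      rcases h5 with h5 | h5 <;> rw [h5]
      · exact h3
      · exact ⟨h3, h4⟩
    · have h3 : Red Γ (z :: img Γ A a (A (some z)) w) :=
        ⟨ih hw.1 _, fun e => hw.2 (canc_img h h2 h1 hw.1 e)⟩
      have h4 (b : V × Bool) (hb : b.1 = a.1) : ¬ Canc Γ b (z :: img Γ A a (A (some z)) w) := by
        rintro (e | e)
        · exact h2 (by rw [e]; exact hb)
        · exact h1 (by rw [← hb]; exact e.1)
      cases p <;> cases A (some (bar z)) <;> simp only [slot, List.nil_append, List.singleton_append]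
      · exact h3
      · exact ⟨h3, h4 _ rfl⟩
      · exact ⟨h3, h4 _ rfl⟩
      · exact h3

lemma len_wh_le (h : IsWh Γ A a) (u : List (V × Bool)) :
    len Γ (wh h.adm (evl Γ u)) + cnt a.1 u ≤ u.length + cut Γ A a.1 (A none) u := by
  have h1 := evl_img h u (A none)
  rw [show ((if A none then 1 else 0 : ℤ) - ind A none) = 0 by simp [ind], zpow_zero, one_mul] at h1
  rw [← h1, ← length_img]
  exact Nat.add_le_add_right (len_evl_le _) _

lemma len_wh (h : IsWh Γ A a) {w : List (V × Bool)} (hw : Red Γ w) :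
    len Γ (wh h.adm (evl Γ w)) + cnt a.1 w = w.length + cut Γ A a.1 (A none) w := by
  have h1 := evl_img h w (A none)
  rw [show ((if A none then 1 else 0 : ℤ) - ind A none) = 0 by simp [ind], zpow_zero, one_mul] at h1
  rw [← h1, ← length_img, (red_img h hw _).len]

end Cuts

section CutIntersections

variable {Γ : SimpleGraph V} [DecidableRel Γ.Adj] {A B C : Option (V × Bool) → Bool}
  {a m : V × Bool}

lemma cut_le_dif_add (v : V) (p q : Bool) (w : List (V × Bool)) :
    cut Γ A v p w ≤ dif p q + cut Γ A v q w := by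
  have tri (p q r : Bool) : dif p r ≤ dif p q + dif q r := by
    cases p <;> cases q <;> cases r <;> decide
  induction w with
  | nil => exact tri _ _ _
  | cons y w ih =>
    rw [cut, cut]
    split_ifs
    · exact ih
    · have := tri p q (A (some (bar y)))
      omega

/-- The difference of two sets of letters. -/
def dSet (A B : Option (V × Bool) → Bool) : Option (V × Bool) → Bool := fun o => A o && !B o

lemma cut_dSet_add_le {a b : V} (hAa : ∀ x : V × Bool, Γ.Adj a x.1 → A (some x) = false)
    (hAb : ∀ x : V × Bool, Γ.Adj b x.1 → A (some x) = false)
    (hBa : ∀ x : V × Bool, Γ.Adj a x.1 → B (some x) = false)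
    (hBb : ∀ x : V × Bool, Γ.Adj b x.1 → B (some x) = false)
    (p q : Bool) (w : List (V × Bool)) :
    cut Γ (dSet A B) a (p && !q) w + cut Γ (dSet B A) b (q && !p) w ≤
      cut Γ A a p w + cut Γ B b q w := by
  have sub (p q r t : Bool) :
      dif (p && !q) (r && !t) + dif (q && !p) (t && !r) ≤ dif p r + dif q t := by
    cases p <;> cases q <;> cases r <;> cases t <;> decide
  induction w generalizing p q with
  | nil => exact sub p q (A none) (B none)
  | cons y w ih =>
    simp only [cut]
    split_ifs with h1 h2 h2
    · exact ih p q
    · have e1 : A (some y) = false := hAa y h1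
      have e2 : B (some y) = false := hBa y h1
      have e3 : A (some (bar y)) = false := hAa (bar y) h1
      have e4 : B (some (bar y)) = false := hBa (bar y) h1
      simp only [dSet, e1, e2, e3, e4, Bool.false_and]
      have i0 := ih false false
      have i1 := ih true false
      have l1 := cut_le_dif_add (Γ := Γ) (A := A) a false true w
      cases p <;> cases q <;> simp_all [dif] <;> omega
    · have e1 : A (some y) = false := hAb y h2
      have e2 : B (some y) = false := hBb y h2
      have e3 : A (some (bar y)) = false := hAb (bar y) h2
      have e4 : B (some (bar y)) = false := hBb (bar y) h2
      simp only [dSet, e1, e2, e3, e4, Bool.false_and]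
      have i0 := ih false false
      have i1 := ih false true
      have l1 := cut_le_dif_add (Γ := Γ) (A := B) b false true w
      cases p <;> cases q <;> simp_all [dif] <;> omega
    · have i := ih (A (some y)) (B (some y))
      have := sub p q (A (some (bar y))) (B (some (bar y)))
      simp only [dSet] at *
      omega

lemma cnt_slot_append {v : V} (hv : v ≠ a.1) (p q : Bool) (u : List (V × Bool)) :
    cnt v (slot a p q ++ u) = cnt v u := by
  cases p <;> cases q <;> simp [slot, cnt, hv.symm]

lemma cnt_img {v : V} (hv : v ≠ a.1) (p : Bool) (w : List (V × Bool)) :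
    cnt v (img Γ A a p w) = cnt v w := by
  induction w generalizing p with
  | nil =>
    have := cnt_slot_append hv p (A none) []
    simpa [img, cnt] using this
  | cons y w ih =>
    rw [img]
    split_ifs with h1 h2
    · simp [cnt, ih]
    · rw [cnt_slot_append hv, ih, cnt, h2, if_neg hv.symm, zero_add]
    · rw [cnt_slot_append hv, cnt, cnt, ih]

lemma cut_slot_append_adj {v : V} (hv : Γ.Adj v a.1) (r p q : Bool) (u : List (V × Bool)) :
    cut Γ C v r (slot a p q ++ u) = cut Γ C v r u := by
  cases p <;> cases q <;> simp [slot, cut, hv]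

lemma cut_img_adj {v : V} (hv : Γ.Adj v a.1) (p r : Bool) (w : List (V × Bool)) :
    cut Γ C v r (img Γ A a p w) = cut Γ C v r w := by
  induction w generalizing p r with
  | nil =>
    have := cut_slot_append_adj (C := C) hv r p (A none) []
    simpa [img] using this
  | cons y w ih =>
    rw [img]
    split_ifs with h1 h2
    · simp [cut, ih]
    · rw [cut_slot_append_adj hv, ih, cut, h2, if_pos hv]
    · rw [cut_slot_append_adj hv, cut, cut]
      simp [ih]

lemma cut_img_disjoint (hdisj : ∀ o, (A o && C o) = false) {v : V} (hv : ¬ Γ.Adj v a.1)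
    (hCa : C (some a) = false) (hCa' : C (some (bar a)) = false)
    (hCl : ∀ x : V × Bool, Γ.Adj a.1 x.1 → C (some x) = false)
    (hAl : ∀ x : V × Bool, Γ.Adj v x.1 → A (some x) = false)
    (p r : Bool) (hpr : (p && r) = false) (w : List (V × Bool)) :
    cut Γ C v r (img Γ A a p w) ≤ cut Γ C v r w := by
  have hslot (p q r : Bool) (u : List (V × Bool)) : cut Γ C v r (slot a p q ++ u) =
      if p = q then cut Γ C v r u else dif r false + cut Γ C v false u := by
    cases p <;> cases q <;> simp [slot, cut, hv, hCa, hCa']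
  induction w generalizing p r with
  | nil =>
    have h1 := hslot p (A none) r []
    have h2 := hdisj none
    rw [List.append_nil] at h1
    rw [img, h1, cut, cut]
    revert hpr h2
    cases p <;> cases r <;> cases A none <;> cases C none <;> decide
  | cons y w ih =>
    rw [img]
    split_ifs with h1 h2
    · simp only [cut]
      split_ifs with h3
      · exact ih p r hpr
      · have := ih p (C (some y)) (by simp [hCl y h1])
        omega
    · rw [hslot, cut, h2, if_neg hv]
      have e1 : C (some y) = false := by rcases eq_or_eq_bar h2 with rfl | rfl <;> assumption
      have e2 : C (some (bar y)) = false := by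
        rcases eq_or_eq_bar h2 with rfl | rfl
        · assumption
        · rwa [bar_bar]
      have := ih (A (some y)) false (by simp)
      rw [e1, e2]
      split_ifs
      · have := cut_le_dif_add (Γ := Γ) (A := C) v r false (img Γ A a (A (some y)) w)
        omega
      · omega
    · rw [hslot, cut, cut, cut]
      split_ifs with h3 h4 h4
      · have := ih false r rfl
        rwa [hAl y h4]
      · have := ih (A (some y)) (C (some y)) (hdisj _)
        omega
      · have e1 := hAl y h4
        have e2 := hAl (bar y) h4
        rw [e2] at h3
        rw [e1]
        have : r = false := by cases p <;> simp_all
        subst this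
        have := ih false false rfl
        simp only [dif, if_true]
        omega
      · have := ih (A (some y)) (C (some y)) (hdisj _)
        have h5 := hdisj (some (bar y))
        have h6 : dif r false + dif false (C (some (bar y))) ≤ dif r (C (some (bar y))) := by
          revert hpr h5 h3
          cases p <;> cases r <;> cases A (some (bar y)) <;> cases C (some (bar y)) <;> decide
        omega

variable (Γ) in
/-- The total length of the images of the generators. -/
def autNorm (φ : MulAut (Raag Γ)) : ℕ := ∑ v, len Γ (φ (gen Γ v))

variable (Γ) in
/-- The change of the total length of a family of words under a Whitehead automorphism. -/
def gain (w : V → List (V × Bool)) (A : Option (V × Bool) → Bool) (a : V) : ℤ :=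
  ∑ v, ((cut Γ A a (A none) (w v) : ℤ) - cnt a (w v))

variable (Γ) in
/-- A family of reduced words representing an automorphism. -/
structure Reps (φ : MulAut (Raag Γ)) (w : V → List (V × Bool)) : Prop where
  red : ∀ v, Red Γ (w v)
  eval : ∀ v, evl Γ (w v) = φ (gen Γ v)

variable (Γ) in
lemma exists_reps (φ : MulAut (Raag Γ)) : ∃ w, Reps Γ φ w := by
  choose w hw using fun v => exists_red_evl Γ (φ (gen Γ v))
  exact ⟨w, fun v => (hw v).1, fun v => (hw v).2⟩

variable {φ : MulAut (Raag Γ)} {w : V → List (V × Bool)}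

lemma Reps.autNorm_eq (hw : Reps Γ φ w) : (autNorm Γ φ : ℤ) = ∑ v, ((w v).length : ℤ) := by
  rw [autNorm, Nat.cast_sum]
  exact Finset.sum_congr rfl fun v _ => by rw [← hw.eval, (hw.red v).len]

lemma Reps.autNorm_wh (hw : Reps Γ φ w) (h : IsWh Γ A a) :
    (autNorm Γ (wh h.adm * φ) : ℤ) = autNorm Γ φ + gain Γ w A a.1 := by
  rw [hw.autNorm_eq, gain, ← Finset.sum_add_distrib, autNorm, Nat.cast_sum]
  refine Finset.sum_congr rfl fun v _ => ?_
  have := len_wh h (hw.red v)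
  rw [MulAut.mul_apply, ← hw.eval]
  omega

lemma Reps.autNorm_wh_wh_le (hw : Reps Γ φ w) (h : IsWh Γ A a) (hC : IsWh Γ C m)
    (hne : m.1 ≠ a.1)
    (hcut : ∀ v, cut Γ C m.1 (C none) (img Γ A a (A none) (w v)) ≤ cut Γ C m.1 (C none) (w v)) :
    (autNorm Γ (wh hC.adm * (wh h.adm * φ)) : ℤ) ≤
      autNorm Γ φ + gain Γ w A a.1 + gain Γ w C m.1 := by
  rw [hw.autNorm_eq, gain, gain, ← Finset.sum_add_distrib, ← Finset.sum_add_distrib, autNorm,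
    Nat.cast_sum]
  refine Finset.sum_le_sum fun v _ => ?_
  have h1 := len_wh_le hC (img Γ A a (A none) (w v))
  have h2 := evl_img h (w v) (A none)
  rw [show ((if A none then 1 else 0 : ℤ) - ind A none) = 0 by simp [ind], zpow_zero, one_mul] at h2
  rw [h2, cnt_img hne] at h1
  have h3 := length_img (Γ := Γ) (A := A) (a := a) (w v) (A none)
  have h4 := hcut v
  rw [MulAut.mul_apply, MulAut.mul_apply, ← hw.eval]
  omega

end CutIntersections

section SignedPermutations

variable {Γ : SimpleGraph V}

/-- The automorphism maps generators to letters. -/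
def IsSgn (φ : MulAut (Raag Γ)) : Prop := ∀ v, ∃ x, φ (gen Γ v) = ev Γ x

lemma IsSgn.exists_ev {φ : MulAut (Raag Γ)} (h : IsSgn φ) (x : V × Bool) :
    ∃ y, φ (ev Γ x) = ev Γ y := by
  obtain ⟨v, ε⟩ := x
  obtain ⟨y, hy⟩ := h v
  cases ε
  · exact ⟨bar y, by rw [ev_false, map_inv, hy, ev_bar]⟩
  · exact ⟨y, hy⟩

lemma sgn_finite : {φ : MulAut (Raag Γ) | IsSgn φ}.Finite := by
  classical
  choose! f hf using fun (φ : MulAut (Raag Γ)) (h : IsSgn φ) => h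
  refine Set.Finite.of_finite_image (f := f) (Set.toFinite _) ?_
  intro φ hφ ψ hψ h
  exact mulEquiv_ext_gen fun v => by rw [hf φ hφ v, hf ψ hψ v, h]

variable [DecidableRel Γ.Adj]

lemma IsSgn.len_le {φ : MulAut (Raag Γ)} (h : IsSgn φ) (g : Raag Γ) : len Γ (φ g) ≤ len Γ g := by
  obtain ⟨w, hw, rfl⟩ := exists_red_evl Γ g
  choose f hf using h.exists_ev
  have : φ (evl Γ w) = evl Γ (w.map f) := by
    rw [evl, map_list_prod, evl, List.map_map, List.map_map]
    congr 2
    funext x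
    exact hf x
  rw [this, hw.len]
  exact (len_evl_le _).trans (by simp)

lemma IsSgn.exists_perm {φ : MulAut (Raag Γ)} (h : IsSgn φ) :
    ∃ e : Equiv.Perm (V × Bool), (∀ x, φ (ev Γ x) = ev Γ (e x)) ∧ (∀ x, e (bar x) = bar (e x)) ∧
      ∀ x y, Γ.Adj x.1 y.1 → Γ.Adj (e x).1 (e y).1 := by
  choose f hf using h.exists_ev
  have hinj : Function.Injective f := by
    intro x y hxy
    apply ev_injective (Γ := Γ)
    apply φ.injective
    rw [hf, hf, hxy]
  have hbar (x : V × Bool) : f (bar x) = bar (f x) := by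
    apply ev_injective (Γ := Γ)
    rw [← hf, ev_bar, ev_bar, map_inv, hf]
  refine ⟨Equiv.ofBijective f ⟨hinj, Finite.surjective_of_injective hinj⟩, hf, hbar, ?_⟩
  intro x y hxy
  have hc : Commute (φ (ev Γ x)) (φ (ev Γ y)) := (ev_commute hxy).map φ
  rw [hf, hf] at hc
  refine adj_of_commute ?_ hc
  intro e
  rcases eq_or_eq_bar e with e | e
  · exact hxy.ne (congrArg Prod.fst (hinj e))
  · change f x = bar (f y) at e
    rw [← hbar] at e
    have e' : x = bar y := hinj e
    exact hxy.ne (by rw [e']; rfl)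

lemma IsSgn.inv {φ : MulAut (Raag Γ)} (h : IsSgn φ) : IsSgn φ⁻¹ := by
  obtain ⟨e, he, -⟩ := h.exists_perm
  intro v
  refine ⟨e.symm (v, true), ?_⟩
  change φ.symm _ = _
  rw [MulEquiv.symm_apply_eq, he, Equiv.apply_symm_apply]
  rfl

lemma IsSgn.len_eq {φ : MulAut (Raag Γ)} (h : IsSgn φ) (g : Raag Γ) : len Γ (φ g) = len Γ g := by
  refine le_antisymm (h.len_le g) ?_
  have := h.inv.len_le (φ g)
  rwa [MulAut.inv_apply_self] at this

lemma IsSgn.autNorm_mul {σ : MulAut (Raag Γ)} (h : IsSgn σ) (φ : MulAut (Raag Γ)) :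
    autNorm Γ (σ * φ) = autNorm Γ φ := by
  unfold autNorm
  exact Finset.sum_congr rfl fun v _ => h.len_eq _

lemma one_le_len (φ : MulAut (Raag Γ)) (v : V) : 1 ≤ len Γ (φ (gen Γ v)) := by
  by_contra h
  have h1 := len_eq_zero (Γ := Γ) (g := φ (gen Γ v)) (by omega)
  rw [map_eq_one_iff φ φ.injective] at h1
  have := len_ev (Γ := Γ) (v, true)
  rw [ev_true, h1, len_one] at this
  omega

lemma card_le_autNorm (φ : MulAut (Raag Γ)) : Fintype.card V ≤ autNorm Γ φ := by
  unfold autNorm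
  calc Fintype.card V = ∑ v : V, 1 := by simp
    _ ≤ _ := Finset.sum_le_sum fun v _ => one_le_len φ v

lemma autNorm_one : autNorm Γ 1 = Fintype.card V := by
  unfold autNorm
  calc _ = ∑ v : V, 1 := Finset.sum_congr rfl fun v _ => len_ev (v, true)
    _ = Fintype.card V := by simp

lemma isSgn_of_autNorm {φ : MulAut (Raag Γ)} (h : autNorm Γ φ = Fintype.card V) : IsSgn φ := by
  intro v
  apply len_eq_one
  have h1 : ∑ v : V, 1 = ∑ v, len Γ (φ (gen Γ v)) := by
    rw [← autNorm, h]; simp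
  exact ((Finset.sum_eq_sum_iff_of_le fun v _ => one_le_len φ v).1 h1 v (Finset.mem_univ v)).symm

lemma IsSgn.conj_mem {σ φ : MulAut (Raag Γ)} (hσ : IsSgn σ) (hφ : φ ∈ whSet Γ) :
    σ * φ * σ⁻¹ ∈ whSet Γ := by
  obtain ⟨A, a, hA, rfl⟩ := hφ
  obtain ⟨e, he, hbar, hadj⟩ := hσ.exists_perm
  obtain ⟨e', he', hbar', hadj'⟩ := hσ.inv.exists_perm
  have hee' (x : V × Bool) : e' (e x) = x := by
    apply ev_injective (Γ := Γ)
    rw [← he', ← he, MulAut.inv_apply_self]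
  have he'e (x : V × Bool) : e (e' x) = x := by
    apply ev_injective (Γ := Γ)
    rw [← he, ← he', MulAut.apply_inv_self]
  have hadj1 (x : V × Bool) : Γ.Adj (e a).1 x.1 → Γ.Adj a.1 (e' x).1 := by
    intro h
    have := hadj' _ _ h
    rwa [hee'] at this
  have hadj2 (x : V × Bool) : ¬ Γ.Adj (e a).1 x.1 → ¬ Γ.Adj a.1 (e' x).1 := by
    intro h h'
    have := hadj _ _ h'
    rw [he'e] at this
    exact h this
  have hB : IsWh Γ (fun o => A (o.map e')) (e a) := by
    refine ⟨by simp [hee', hA.mem], by simp [← hbar, hee', hA.not_mem], fun x hx => ?_, ?_⟩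
    · exact hA.lk _ (hadj1 x hx)
    · intro x y hxy hx hy
      exact hA.closed _ _ (hadj' _ _ hxy) (hadj2 x hx) (hadj2 y hy)
  refine ⟨_, _, hB, mulEquiv_ext_gen fun u => ?_⟩
  obtain ⟨y, hy⟩ : ∃ y, e y = (u, true) := ⟨e' (u, true), he'e _⟩
  rw [← ev_true, ← hy, MulAut.mul_apply, MulAut.mul_apply, he', hee']
  by_cases h1 : y.1 = a.1
  · have h2 : (e y).1 = (e a).1 := by
      rcases eq_or_eq_bar h1 with rfl | rfl
      · rfl
      · rw [hbar]; rfl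
    rw [wh_ev_same _ h1, wh_ev_same _ h2, he]
  · have h2 : (e y).1 ≠ (e a).1 := by
      intro h
      rcases eq_or_eq_bar h with h | h
      · exact h1 (by rw [e.injective h])
      · rw [← hbar] at h
        exact h1 (by rw [e.injective h]; rfl)
    rw [wh_ev _ h1, wh_ev _ h2]
    simp only [map_mul, map_zpow, he, ind, Option.map_none, Option.map_some, ← hbar, hee']

end SignedPermutations

section WhiteheadRelations

variable {Γ : SimpleGraph V} {A B C : Option (V × Bool) → Bool} {a b m : V × Bool}

/-- The value of a Boolean as an integer. -/
def bz (p : Bool) : ℤ := if p then 1 else 0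

lemma ind_eq (A : Option (V × Bool) → Bool) (o : Option (V × Bool)) : ind A o = bz (A o) := rfl

/-- A set of letters on which an admissible set does not separate a vertex from its inverse
contains the link. -/
lemma IsWh.adj_of_ne (h : IsWh Γ A a) {y x : V × Bool} (hy : A (some y) ≠ A (some (bar y)))
    (hya : ¬ Γ.Adj a.1 y.1) (hx : Γ.Adj y.1 x.1) : Γ.Adj a.1 x.1 := by
  by_contra hxa
  have h1 := h.closed y x hx hya hxa
  have h2 := h.closed (bar y) x hx hya hxa
  exact hy (h1.trans h2.symm)

lemma disjoint_identity {G : Type*} [Group G] (g h x : G) (p0 p p' q0 q q' t : Bool)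
    (h0 : (p0 && q0) = false) (h1 : (p && q) = false) (h2 : (p' && q') = false) :
    (h ^ bz q0 * g * h ^ (-bz q0)) ^ (bz p0 - bz p') * (h ^ (bz q0 - bz q') * x *
        h ^ (bz q - bz q0)) * (h ^ bz q0 * g * h ^ (-bz q0)) ^ (bz p - bz p0) =
      (g ^ (bz p0 + bz t * bz q0 - bz t) * h * g ^ (-(bz p0 + bz t * bz q0))) ^ (bz q0 - bz q') *
        (g ^ (bz p0 + bz t * bz q0 - (bz p' + bz t * bz q')) * x *
          g ^ (bz p + bz t * bz q - (bz p0 + bz t * bz q0))) *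
        (g ^ (bz p0 + bz t * bz q0 - bz t) * h * g ^ (-(bz p0 + bz t * bz q0))) ^
          (bz q - bz q0) := by
  cases p0 <;> cases q0 <;> cases p <;> cases q <;> cases p' <;> cases q' <;> cases t <;>
    first
    | (exfalso; simp at h0 h1 h2; done)
    | simp [bz, mul_assoc]

lemma wh_edge_sub (hA : IsWh Γ A a) (hB : IsWh Γ B a) (h : ∀ o, B o = true → A o = true) :
    wh hB.adm * (wh hA.adm)⁻¹ ∈ whSet Γ := by
  rw [wh_inv, wh_mul]
  have key (o) : (ind B + -ind A) o = -1 ∨ (ind B + -ind A) o = -1 + 1 := by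
    have := h o
    simp only [Pi.add_apply, Pi.neg_apply, ind]
    rcases hA : A o with _ | _ <;> rcases hB : B o with _ | _ <;> simp_all
  exact wh_mem_whSet _ (-1) (key _) fun x _ _ => key _

lemma wh_edge_disjoint (hA : IsWh Γ A a) (hC : IsWh Γ C (bar a))
    (h : ∀ o, (A o && C o) = false) : wh hC.adm * (wh hA.adm)⁻¹ ∈ whSet Γ := by
  have h1 : Adm Γ a.1 (ind C) := hC.adm
  rw [show wh hC.adm = wh h1.neg from wh_bar h1, wh_inv, wh_mul]
  have key (o) : (-ind C + -ind A) o = -1 ∨ (-ind C + -ind A) o = -1 + 1 := by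
    have := h o
    simp only [Pi.add_apply, Pi.neg_apply, ind]
    rcases hA : A o with _ | _ <;> rcases hC : C o with _ | _ <;> simp_all
  exact wh_mem_whSet _ (-1) (key _) fun x _ _ => key _

/-- The commutation relation of Whitehead automorphisms with disjoint sets. -/
lemma wh_disjoint (hA : IsWh Γ A a) (hC : IsWh Γ C m) (hd : ∀ o, (A o && C o) = false)
    (hne : m.1 ≠ a.1) (hCl : ∀ x : V × Bool, Γ.Adj a.1 x.1 → C (some x) = false)
    (hAl : ∀ x : V × Bool, Γ.Adj m.1 x.1 → A (some x) = false)
    (haC : C (some (bar a)) = false) :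
    wh hC.adm * wh hA.adm * (wh hC.adm)⁻¹ ∈ whSet Γ := by
  have hAm : A (some m) = false := by have := hd (some m); simpa [hC.mem] using this
  have hCa : C (some a) = false := by have := hd (some a); simpa [hA.mem] using this
  have hma : ¬ Γ.Adj a.1 m.1 := fun h => by have := hCl m h; simp [hC.mem] at this
  have hma' : ¬ Γ.Adj m.1 a.1 := fun h => hma h.symm
  set t := A (some (bar m)) with ht
  have hlk (htt : t = true) (x : V × Bool) (hx : Γ.Adj m.1 x.1) : Γ.Adj a.1 x.1 :=
    hA.adj_of_ne (y := m) (by rw [hAm, ← ht, htt]; simp) hma hx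
  let s : Option (V × Bool) → ℤ := fun o =>
    bz (A o) + bz t * (if o = some m then 0 else bz (C o))
  have hs : Adm Γ a.1 s := by
    constructor
    · intro x hx
      have h1 := hA.lk x hx
      have h2 := hA.lk (bar x) hx
      have h3 := hCl x hx
      have h4 := hCl (bar x) hx
      simp [s, h1, h2, h3, h4, bz]
    · intro x y hxy hx hy
      have h1 := hA.closed x y hxy hx hy
      rcases htt : t with _ | _
      · simp [s, htt, h1, bz]
      · have hxm : ¬ Γ.Adj m.1 x.1 := fun h => hx (hlk htt x h)
        have hym : ¬ Γ.Adj m.1 y.1 := fun h => hy (hlk htt y h)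
        have hxm' : x ≠ m := by rintro rfl; exact hym hxy
        have hym' : y ≠ m := by rintro rfl; exact hxm hxy.symm
        simp [s, h1, hC.closed x y hxy hxm hym, hxm', hym']
  have key (o) : s o = 0 ∨ s o = 0 + 1 := by
    have h1 := hd o
    by_cases ho : o = some m
    · subst ho
      simp [s, hAm, bz]
    · simp only [s, ho, if_false]
      revert h1
      cases A o <;> cases C o <;> cases t <;> decide
  have hmem : wh hs ∈ whSet Γ := wh_mem_whSet hs 0 (key _) fun x _ _ => key _
  suffices h : wh hC.adm * wh hA.adm = wh hs * wh hC.adm by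
    rw [h, mul_inv_cancel_right]; exact hmem
  have eCa : wh hC.adm (ev Γ a) = ev Γ m ^ bz (C none) * ev Γ a * ev Γ m ^ (-bz (C none)) := by
    rw [wh_ev _ hne.symm]
    simp [ind_eq, hCa, haC, bz]
  have esm : wh hs (ev Γ m) = ev Γ a ^ (bz (A none) + bz t * bz (C none) - bz t) * ev Γ m *
      ev Γ a ^ (-(bz (A none) + bz t * bz (C none))) := by
    rw [wh_ev _ hne]
    have : bar m ≠ m := bar_ne m
    simp [s, ← ht, hC.not_mem, hAm, bz, this]
  have h0 := hd none
  refine mulEquiv_ext_gen fun u => ?_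
  set x : V × Bool := (u, true) with hx
  rw [← ev_true, ← hx, MulAut.mul_apply, MulAut.mul_apply]
  by_cases hxa : x.1 = a.1
  · have hxa' : x = a ∨ x = bar a := eq_or_eq_bar hxa
    have main : wh hC.adm (wh hA.adm (ev Γ a)) = wh hs (wh hC.adm (ev Γ a)) := by
      rw [wh_self, eCa, map_mul, map_mul, map_zpow, map_zpow, wh_self, esm]
      revert h0
      cases A none <;> cases C none <;> cases t <;> simp [bz, mul_assoc]
    rcases hxa' with h | h
    · rw [h, main]
    · rw [h, ev_bar, map_inv, map_inv, map_inv, map_inv, main]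
  by_cases hxm : x.1 = m.1
  · have main : wh hC.adm (wh hA.adm (ev Γ m)) = wh hs (wh hC.adm (ev Γ m)) := by
      rw [wh_self, esm, wh_ev _ hne, map_mul, map_mul, map_zpow, map_zpow, wh_self, eCa]
      simp only [ind_eq, hAm, ← ht]
      revert h0
      cases A none <;> cases C none <;> cases t <;> simp [bz, mul_assoc]
    rcases eq_or_eq_bar hxm with h | h
    · rw [h, main]
    · rw [h, ev_bar, map_inv, map_inv, map_inv, map_inv, main]
  by_cases hla : Γ.Adj a.1 x.1
  · have hc := (ev_commute (Γ := Γ) hla)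
    rw [wh_ev_lk hA.adm hla, wh_ev _ hxm]
    simp only [ind_eq, hCl x hla, hCl (bar x) hla, map_mul, map_zpow, esm, wh_ev_lk hs hla]
    revert h0
    cases A none <;> cases C none <;> cases t <;> simp [bz, mul_assoc]
    rw [← mul_assoc (ev Γ x), ← hc.eq]
    simp [mul_assoc]
  by_cases hlm : Γ.Adj m.1 x.1
  · have htf : t = false := by
      rcases htt : t with _ | _
      · rfl
      · exact absurd (hlk htt x hlm) hla
    rw [wh_ev_lk hC.adm hlm, wh_ev _ hxa, wh_ev _ hxa]
    simp only [map_mul, map_zpow, eCa, wh_ev_lk hC.adm hlm, s, htf, ind_eq, hAl x hlm,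
      hAl (bar x) hlm]
    revert h0
    cases A none <;> cases C none <;> simp [bz]
  · rw [wh_ev hA.adm hxa, wh_ev hC.adm hxm]
    simp only [map_mul, map_zpow, wh_ev hC.adm hxm, wh_ev hs hxa, eCa, esm]
    have e1 : x ≠ m := by rintro rfl; exact hxm rfl
    have e2 : bar x ≠ m := by intro h; exact hxm (by rw [← h]; rfl)
    have := disjoint_identity (ev Γ a) (ev Γ m) (ev Γ x) (A none) (A (some x)) (A (some (bar x)))
      (C none) (C (some x)) (C (some (bar x))) t h0 (hd _) (hd _)
    simpa [s, e1, e2, ind_eq] using this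

end WhiteheadRelations

section RankOneRelations

variable {Γ : SimpleGraph V} {A B C : Option (V × Bool) → Bool} {a b m : V × Bool}

lemma wh_commute_adj {s s' : Option (V × Bool) → ℤ} (h : Adm Γ a.1 s) (h' : Adm Γ b.1 s')
    (hab : Γ.Adj a.1 b.1) : wh h * wh h' = wh h' * wh h := by
  refine mulEquiv_ext_gen fun u => ?_
  set x : V × Bool := (u, true) with hx
  rw [← ev_true, ← hx, MulAut.mul_apply, MulAut.mul_apply]
  by_cases hxa : x.1 = a.1
  · have hbx : Γ.Adj b.1 x.1 := by rw [hxa]; exact hab.symm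
    rw [wh_ev_lk h' hbx, wh_ev_same h hxa, wh_ev_lk h' hbx]
  by_cases hxb : x.1 = b.1
  · have hax : Γ.Adj a.1 x.1 := by rw [hxb]; exact hab
    rw [wh_ev_lk h hax, wh_ev_same h' hxb, wh_ev_lk h hax]
  rw [wh_ev h hxa, wh_ev h' hxb]
  simp only [map_mul, map_zpow, wh_ev_lk h hab, wh_ev_lk h' hab.symm, wh_ev h hxa, wh_ev h' hxb]
  have hc (i j : ℤ) : ev Γ a ^ i * ev Γ b ^ j = ev Γ b ^ j * ev Γ a ^ i :=
    ((ev_commute hab).zpow_zpow i j).eq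
  simp only [mul_assoc, hc]
  rw [← mul_assoc, ← hc, mul_assoc]

/-- Replace the letter `a` by its inverse in a set of letters. -/
def swapAt (A : Option (V × Bool) → Bool) (a : V × Bool) : Option (V × Bool) → Bool :=
  fun o => if o = some a then false else if o = some (bar a) then true else A o

lemma IsWh.not_adj (hA : IsWh Γ A a) (hb : A (some b) = true) : ¬ Γ.Adj a.1 b.1 :=
  fun h => by have := hA.lk b h; simp [hb] at this

lemma IsWh.swapAt (hA : IsWh Γ A a) (hB : IsWh Γ A b) (hne : a.1 ≠ b.1) :
    IsWh Γ (swapAt A a) b := by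
  have hab : ¬ Γ.Adj a.1 b.1 := hA.not_adj hB.mem
  have hba : ¬ Γ.Adj b.1 a.1 := fun h => hab h.symm
  have e1 : b ≠ a := by rintro rfl; exact hne rfl
  have e2 : b ≠ RaagPaper.bar a := by rintro rfl; exact hne rfl
  have e3 : RaagPaper.bar b ≠ a := by rintro rfl; exact hne rfl
  have e4 : RaagPaper.bar b ≠ RaagPaper.bar a := by intro h; exact hne (congrArg Prod.fst h).symm
  have off {x : V × Bool} (hx : x.1 ≠ a.1) : RaagPaper.swapAt A a (some x) = A (some x) := by
    have h1 : x ≠ a := by rintro rfl; exact hx rfl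
    have h2 : x ≠ RaagPaper.bar a := by rintro rfl; exact hx rfl
    simp [RaagPaper.swapAt, h1, h2]
  have hlk {x : V × Bool} (hx : Γ.Adj a.1 x.1) : Γ.Adj b.1 x.1 :=
    hB.adj_of_ne (y := a) (by rw [hA.mem, hA.not_mem]; simp) hba hx
  refine ⟨?_, ?_, ?_, ?_⟩
  · rw [off hne.symm, hB.mem]
  · rw [off (x := RaagPaper.bar b) hne.symm, hB.not_mem]
  · intro x hx
    rw [off, hB.lk x hx]
    rintro h
    exact hba (h ▸ hx)
  · intro x y hxy hx hy
    rw [off, off, hB.closed x y hxy hx hy]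
    · intro h; exact hx (hlk (h ▸ hxy.symm))
    · intro h; exact hy (hlk (h ▸ hxy))

lemma swap_identity {G : Type*} [Group G] (g h x : G) (p0 p p' : Bool) :
    g⁻¹ ^ (-bz p0 + bz p') *
      ((h ^ bz p0 * g * h ^ (1 - bz p0)) ^ (-bz p0 + bz p') *
        (h ^ (bz p0 - bz p') * x * h ^ (bz p - bz p0)) *
       (h ^ bz p0 * g * h ^ (1 - bz p0)) ^ (-bz p + bz p0)) *
       g⁻¹ ^ (-bz p + bz p0) = x := by
  cases p0 <;> cases p <;> cases p' <;> simp [bz, mul_assoc]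

/-- Two Whitehead automorphisms with the same set and distinct multipliers differ by a third
one, up to a signed permutation. -/
lemma isSgn_swap (hA : IsWh Γ A a) (hB : IsWh Γ A b) (hne : a.1 ≠ b.1) :
    IsSgn (wh hB.adm * (wh hA.adm)⁻¹ * (wh (hA.swapAt hB hne).adm)⁻¹) := by
  have hab : ¬ Γ.Adj a.1 b.1 := hA.not_adj hB.mem
  have hba : ¬ Γ.Adj b.1 a.1 := fun h => hab h.symm
  set σ := wh hB.adm * (wh hA.adm)⁻¹ * (wh (hA.swapAt hB hne).adm)⁻¹ with hσ
  have hap (g : Raag Γ) : σ g = wh hB.adm (wh hA.adm.neg (wh (hA.swapAt hB hne).adm.neg g)) := by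
    rw [hσ, wh_inv, wh_inv]; rfl
  have iB : ind (swapAt A a) none = bz (A none) := rfl
  have ea : wh hB.adm (ev Γ a) = ev Γ b ^ bz (A none) * ev Γ a * ev Γ b ^ (1 - bz (A none)) := by
    rw [wh_ev _ hne]
    simp [ind_eq, hA.mem, hA.not_mem, bz]
  have eb : wh hA.adm.neg (ev Γ b) =
      ev Γ a ^ (-bz (A none)) * ev Γ b * ev Γ a ^ (-1 + bz (A none)) := by
    rw [wh_ev _ hne.symm]
    simp [ind_eq, hB.mem, hB.not_mem, bz]
  have sb : σ (ev Γ b) = (ev Γ a)⁻¹ := by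
    rw [hap, wh_self, eb]
    simp only [map_mul, map_zpow, ea, wh_self]
    cases A none <;> simp [bz]
  have sa : σ (ev Γ a) = ev Γ b := by
    rw [hap, wh_ev _ hne]
    have h1 : swapAt A a (some a) = false := by simp [swapAt]
    have h2 : swapAt A a (some (bar a)) = true := by simp [swapAt, bar_ne]
    simp only [Pi.neg_apply, iB, ind_eq, h1, h2, map_mul, map_zpow, eb, ea, wh_self]
    cases A none <;> simp [bz, mul_assoc]
  intro u
  set x : V × Bool := (u, true) with hx
  rw [← ev_true, ← hx]
  by_cases hxa : x.1 = a.1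
  · rcases eq_or_eq_bar hxa with h | h
    · exact ⟨b, by rw [h, sa]⟩
    · exact ⟨bar b, by rw [h, ev_bar, map_inv, sa, ev_bar]⟩
  by_cases hxb : x.1 = b.1
  · rcases eq_or_eq_bar hxb with h | h
    · exact ⟨bar a, by rw [h, sb, ev_bar]⟩
    · exact ⟨a, by rw [h, ev_bar, map_inv, sb, inv_inv]⟩
  refine ⟨x, ?_⟩
  have h1 : x ≠ a := by intro h; exact hxa (congrArg Prod.fst h)
  have h2 : x ≠ bar a := by intro h; exact hxa (by rw [h]; rfl)
  have h3 : bar x ≠ a := by intro h; exact hxa (by rw [← h]; rfl)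
  have h4 : bar x ≠ bar a := by intro h; rw [← bar_bar x, h, bar_bar] at h1; exact h1 rfl
  have off1 : swapAt A a (some x) = A (some x) := by simp [swapAt, h1, h2]
  have off2 : swapAt A a (some (bar x)) = A (some (bar x)) := by simp [swapAt, h3, h4]
  have key : σ (ev Γ x) = σ (ev Γ b) ^ (-bz (A none) + bz (A (some (bar x)))) *
      wh hB.adm (wh hA.adm.neg (ev Γ x)) * σ (ev Γ b) ^ (-bz (A (some x)) + bz (A none)) := by
    rw [hap, hap, wh_ev _ hxb, wh_self]
    simp only [map_mul, map_zpow, Pi.neg_apply, ind_eq, off1, off2, sub_neg_eq_add]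
    rfl
  rw [key, sb, wh_ev hA.adm.neg hxa]
  simp only [map_mul, map_zpow, ea, wh_ev hB.adm hxb, Pi.neg_apply, ind_eq, sub_neg_eq_add]
  exact swap_identity _ _ _ _ _ _

end RankOneRelations

section PeakReduction

variable {Γ : SimpleGraph V} {A B C : Option (V × Bool) → Bool} {a b m : V × Bool}

variable (Γ) in
/-- The subgroup generated by Whitehead automorphisms and inversions. -/
def longGroup : Subgroup (MulAut (Raag Γ)) :=
  Subgroup.closure (whSet Γ ∪ {α | IsInversion Γ α})

variable (Γ) in
/-- The Whitehead automorphisms together with the signed permutations in the long-range group. -/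
def longGen : Set (MulAut (Raag Γ)) := whSet Γ ∪ {σ | IsSgn σ ∧ σ ∈ longGroup Γ}

lemma whSet_subset_longGroup {φ : MulAut (Raag Γ)} (h : φ ∈ whSet Γ) : φ ∈ longGroup Γ :=
  Subgroup.subset_closure (Or.inl h)

lemma IsWh.mem_whSet (hA : IsWh Γ A a) : wh hA.adm ∈ whSet Γ := ⟨A, a, hA, rfl⟩

lemma IsWh.change (hA : IsWh Γ A a) (hc : A (some b) = true) (hc' : A (some (bar b)) = false)
    (hlk : ∀ x, Γ.Adj a.1 x → Γ.Adj b.1 x) : IsWh Γ A b := by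
  have hab : ¬ Γ.Adj a.1 b.1 := hA.not_adj hc
  refine ⟨hc, hc', fun x hx => ?_, fun x y hxy hx hy => ?_⟩
  · by_cases hax : Γ.Adj a.1 x.1
    · exact hA.lk x hax
    · rw [← hc']
      exact (hA.closed (RaagPaper.bar b) x hx hab hax).symm
  · exact hA.closed x y hxy (fun h => hx (hlk _ h)) (fun h => hy (hlk _ h))

lemma IsWh.eq_false_of_adj (hA : IsWh Γ A a) (hb : A (some b) = false) (hab : ¬ Γ.Adj a.1 b.1)
    (x : V × Bool) (hx : Γ.Adj b.1 x.1) : A (some x) = false := by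
  by_cases hax : Γ.Adj a.1 x.1
  · exact hA.lk x hax
  · rw [← hb]
    exact (hA.closed b x hx hab hax).symm

variable [DecidableRel Γ.Adj]

lemma longGen_inv {ω : MulAut (Raag Γ)} (h : ω ∈ longGen Γ) : ω⁻¹ ∈ longGen Γ := by
  rcases h with h | h
  · exact Or.inl (whSet_inv h)
  · exact Or.inr ⟨h.1.inv, inv_mem h.2⟩

lemma cut_congr_adj {u v : V} (h : ∀ x, Γ.Adj u x ↔ Γ.Adj v x) (p : Bool) (w : List (V × Bool)) :
    cut Γ A u p w = cut Γ A v p w := by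
  induction w generalizing p with
  | nil => rfl
  | cons y w ih => rw [cut, cut, ih, ih]; simp only [h]

lemma gain_swap {u v : V} (h : ∀ x, Γ.Adj u x ↔ Γ.Adj v x) (w : V → List (V × Bool)) :
    gain Γ w A v + gain Γ w B u = gain Γ w A u + gain Γ w B v := by
  simp only [gain, ← Finset.sum_add_distrib, cut_congr_adj h]
  exact Finset.sum_congr rfl fun x _ => by ring

variable {φ : MulAut (Raag Γ)} {w : V → List (V × Bool)}

lemma conn_of_mem {ω α β : MulAut (Raag Γ)} (hω : ω ∈ longGen Γ) (h : ω * α = β) :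
    Conn (longGen Γ) (autNorm Γ) φ 1 α β := Conn.edge hω h

lemma conn_of_whSet {ω α β : MulAut (Raag Γ)} (hω : ω ∈ whSet Γ) (h : ω * α = β) :
    Conn (longGen Γ) (autNorm Γ) φ 1 α β := Conn.edge (Or.inl hω) h

lemma Reps.gain_flip (hw : Reps Γ φ w) (hA : IsWh Γ A a) :
    gain Γ w (flipSet Γ A a) a.1 = gain Γ w A a.1 := by
  have h1 := hw.autNorm_wh hA
  have h2 := hw.autNorm_wh hA.flip
  rw [hA.wh_flip, bar_fst] at h2
  omega

lemma Reps.strict (hw : Reps Γ φ w) (hA : IsWh Γ A a) (h : gain Γ w A a.1 < 0) :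
    autNorm Γ (wh hA.adm • φ) < autNorm Γ φ := by
  have h1 := hw.autNorm_wh hA
  rw [smul_eq_mul]
  omega

lemma Reps.conn_swap (hw : Reps Γ φ w) (hA : IsWh Γ A a) (hB : IsWh Γ A b) (hne : a.1 ≠ b.1)
    (h : gain Γ w A b.1 < 0) :
    Conn (longGen Γ) (autNorm Γ) φ 2 (wh hA.adm) (wh hB.adm) := by
  have hs := isSgn_swap hA hB hne
  set σ := wh hB.adm * (wh hA.adm)⁻¹ * (wh (hA.swapAt hB hne).adm)⁻¹ with hσ
  have e : σ * (wh (hA.swapAt hB hne).adm * wh hA.adm) = wh hB.adm := by rw [hσ]; group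
  have hm : σ ∈ longGroup Γ :=
    mul_mem (mul_mem (whSet_subset_longGroup hB.mem_whSet)
      (inv_mem (whSet_subset_longGroup hA.mem_whSet)))
      (inv_mem (whSet_subset_longGroup (hA.swapAt hB hne).mem_whSet))
  refine Conn.trans (conn_of_whSet ((hA.swapAt hB hne).mem_whSet) rfl)
    (conn_of_mem (Or.inr ⟨hs, hm⟩) e) ?_
  have := hw.strict hB h
  rw [← e, smul_eq_mul, mul_assoc, hs.autNorm_mul] at this
  exact this

lemma Reps.conn_commute (hw : Reps Γ φ w) (hA : IsWh Γ A a) (hC : IsWh Γ C m)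
    (hd : ∀ o, (A o && C o) = false) (hma : ¬ Γ.Adj m.1 a.1) (hne : m.1 ≠ a.1)
    (haC : C (some (bar a)) = false) (h : gain Γ w A a.1 + gain Γ w C m.1 < 0) :
    Conn (longGen Γ) (autNorm Γ) φ 2 (wh hA.adm) (wh hC.adm) := by
  have hAm : A (some m) = false := by have := hd (some m); simpa [hC.mem] using this
  have hCa : C (some a) = false := by have := hd (some a); simpa [hA.mem] using this
  have hCl := hC.eq_false_of_adj hCa hma
  have hAl := hA.eq_false_of_adj hAm fun h => hma h.symm
  refine Conn.trans (conn_of_whSet hC.mem_whSet rfl)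
    (conn_of_whSet ((whSet_inv (wh_disjoint hA hC hd hne hCl hAl haC))) ?_) ?_
  · group
  · have := hw.autNorm_wh_wh_le hA hC hne fun v =>
      cut_img_disjoint hd hma hCa haC hCl hAl _ _ (hd none) _
    rw [smul_eq_mul, mul_assoc]
    omega

lemma Reps.conn_disjoint (hw : Reps Γ φ w) (hA : IsWh Γ A a) (hC : IsWh Γ C m)
    (hd : ∀ o, (A o && C o) = false) (hma : ¬ Γ.Adj m.1 a.1)
    (h : gain Γ w A a.1 + gain Γ w C m.1 < 0) :
    Conn (longGen Γ) (autNorm Γ) φ 3 (wh hA.adm) (wh hC.adm) := by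
  have hd' (o) : (C o && A o) = false := by rw [Bool.and_comm]; exact hd o
  have hAm : A (some m) = false := by have := hd (some m); simpa [hC.mem] using this
  have hCa : C (some a) = false := by have := hd (some a); simpa [hA.mem] using this
  by_cases hne : m.1 = a.1
  · rcases eq_or_eq_bar hne with rfl | rfl
    · simp [hC.mem] at hCa
    · exact (conn_of_whSet ((wh_edge_disjoint hA hC hd)) (by group)).mono (by omega)
  rcases haC : C (some (bar a)) with _ | _
  · exact (hw.conn_commute hA hC hd hma hne haC h).mono (by omega)
  rcases hmA : A (some (bar m)) with _ | _
  · exact ((hw.conn_commute hC hA hd' (fun h => hma h.symm) (Ne.symm hne) hmA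
      (by omega)).symm fun _ => longGen_inv).mono (by omega)
  have l1 (x : V) (hx : Γ.Adj m.1 x) : Γ.Adj a.1 x :=
    hA.adj_of_ne (y := m) (x := (x, true)) (by simp [hAm, hmA]) (fun h => hma h.symm) hx
  have l2 (x : V) (hx : Γ.Adj a.1 x) : Γ.Adj m.1 x :=
    hC.adj_of_ne (y := a) (x := (x, true)) (by simp [hCa, haC]) hma hx
  have hA' : IsWh Γ A (bar m) := hA.change hmA (by rw [bar_bar, hAm]) l2
  have hC' : IsWh Γ C (bar a) := hC.change haC (by rw [bar_bar, hCa]) l1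
  have hg := gain_swap (A := A) (B := C) (u := a.1) (v := m.1) (fun x => ⟨l2 x, l1 x⟩) w
  by_cases hs : gain Γ w A m.1 < 0
  · have hC'' : IsWh Γ C (bar (bar m)) := by rw [bar_bar]; exact hC
    have e : wh hC''.adm = wh hC.adm := by congr 1; exact bar_bar m
    have := wh_edge_disjoint hA' hC'' hd
    rw [e] at this
    exact (hw.conn_swap hA hA' (Ne.symm hne) hs).trans (conn_of_whSet (this) (by group))
      (hw.strict hA' hs)
  · have hs' : gain Γ w C a.1 < 0 := by omega
    exact Conn.symm (fun _ => longGen_inv) ((hw.conn_swap hC hC' hne hs').trans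
      (Conn.symm (fun _ => longGen_inv)
        (conn_of_whSet ((wh_edge_disjoint hA hC' hd)) (by group))) (hw.strict hC' hs'))

lemma IsWh.dSet (hA : IsWh Γ A a) (hB : IsWh Γ B b) (hba : B (some a) = false)
    (hab : A (some b) = false) (hn : ¬ Γ.Adj a.1 b.1) : IsWh Γ (dSet A B) a := by
  refine ⟨by simp [RaagPaper.dSet, hA.mem, hba], by simp [RaagPaper.dSet, hA.not_mem],
    fun x hx => by simp [RaagPaper.dSet, hA.lk x hx], fun x y hxy hx hy => ?_⟩
  have h1 := hA.closed x y hxy hx hy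
  have hl := hA.eq_false_of_adj hab hn
  by_cases hbx : Γ.Adj b.1 x.1
  · have h2 := hl x hbx
    rw [h2] at h1
    simp [RaagPaper.dSet, h2, ← h1]
  by_cases hby : Γ.Adj b.1 y.1
  · have h2 := hl y hby
    rw [h2] at h1
    simp [RaagPaper.dSet, h2, h1]
  simp [RaagPaper.dSet, h1, hB.closed x y hxy hbx hby]

lemma Reps.conn_good (hw : Reps Γ φ w) (hA : IsWh Γ A a) (hB : IsWh Γ B b)
    (hba : B (some a) = false) (hab : A (some b) = false) (hn : ¬ Γ.Adj a.1 b.1)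
    (h1 : gain Γ w A a.1 ≤ 0) (h2 : gain Γ w B b.1 ≤ 0)
    (h : gain Γ w A a.1 + gain Γ w B b.1 < 0) :
    Conn (longGen Γ) (autNorm Γ) φ 4 (wh hA.adm) (wh hB.adm) := by
  have hn' : ¬ Γ.Adj b.1 a.1 := fun h => hn h.symm
  have hA' := hA.dSet hB hba hab hn
  have hB' := hB.dSet hA hab hba hn'
  have hg : gain Γ w (RaagPaper.dSet A B) a.1 + gain Γ w (RaagPaper.dSet B A) b.1 ≤
      gain Γ w A a.1 + gain Γ w B b.1 := by
    simp only [gain, ← Finset.sum_add_distrib]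
    refine Finset.sum_le_sum fun v _ => ?_
    have := cut_dSet_add_le (Γ := Γ) hA.lk (hA.eq_false_of_adj hab hn)
      (hB.eq_false_of_adj hba hn') hB.lk (A none) (B none) (w v)
    simp only [RaagPaper.dSet] at this ⊢
    omega
  by_cases hs : gain Γ w (RaagPaper.dSet A B) a.1 < 0
  · refine Conn.trans (j := 1) (k := 3) (conn_of_whSet ((wh_edge_sub hA hA' ?_)) (by group))
      (hw.conn_disjoint hA' hB ?_ hn' (by omega)) (hw.strict hA' hs)
    · intro o; simp [RaagPaper.dSet]; tauto
    · intro o; simp only [RaagPaper.dSet]; cases A o <;> cases B o <;> rfl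
  · have hs' : gain Γ w (RaagPaper.dSet B A) b.1 < 0 := by omega
    refine Conn.trans (j := 3) (k := 1) (hw.conn_disjoint hA hB' ?_ hn' (by omega))
      (Conn.symm (fun _ => longGen_inv)
        (conn_of_whSet ((wh_edge_sub hB hB' ?_)) (by group))) (hw.strict hB' hs')
    · intro o; simp only [RaagPaper.dSet]; cases A o <;> cases B o <;> rfl
    · intro o; simp [RaagPaper.dSet]; tauto

lemma Reps.conn_same (hw : Reps Γ φ w) (hA : IsWh Γ A a) (hB : IsWh Γ B b) (hab : b.1 = a.1)
    (h1 : gain Γ w A a.1 ≤ 0) (h2 : gain Γ w B b.1 ≤ 0)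
    (h : gain Γ w A a.1 + gain Γ w B b.1 < 0) :
    Conn (longGen Γ) (autNorm Γ) φ 4 (wh hA.adm) (wh hB.adm) := by
  rcases eq_or_eq_bar hab with rfl | rfl
  · rw [← hB.wh_flip]
    have hg := hw.gain_flip hB
    exact hw.conn_good hA hB.flip (by simpa using hB.flip.not_mem) hA.not_mem (by simp)
      h1 (by simpa [hg] using h2) (by simpa [hg] using h)
  · exact hw.conn_good hA hB (by simpa using hB.not_mem) hA.not_mem (by simp) h1 h2 h

lemma Reps.conn_bad (hw : Reps Γ φ w) (hA : IsWh Γ A a) (hB : IsWh Γ B b) (hne : b.1 ≠ a.1)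
    (hn : ¬ Γ.Adj a.1 b.1) (ha : B (some a) = true) (ha' : B (some (bar a)) = false)
    (hb : A (some b) = false) (hb' : A (some (bar b)) = true)
    (h1 : gain Γ w A a.1 ≤ 0) (h2 : gain Γ w B b.1 ≤ 0)
    (h : gain Γ w A a.1 + gain Γ w B b.1 < 0) :
    Conn (longGen Γ) (autNorm Γ) φ 6 (wh hA.adm) (wh hB.adm) := by
  have l1 (x : V) (hx : Γ.Adj b.1 x) : Γ.Adj a.1 x :=
    hA.adj_of_ne (y := b) (x := (x, true)) (by simp [hb, hb']) hn hx
  have l2 (x : V) (hx : Γ.Adj a.1 x) : Γ.Adj b.1 x :=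
    hB.adj_of_ne (y := a) (x := (x, true)) (by simp [ha, ha']) (fun h => hn h.symm) hx
  have hA' : IsWh Γ A (bar b) := hA.change hb' (by rw [bar_bar, hb]) l2
  have hB' : IsWh Γ B a := hB.change ha ha' l1
  have hg := gain_swap (A := A) (B := B) (u := a.1) (v := b.1) (fun x => ⟨l2 x, l1 x⟩) w
  by_cases hs : gain Γ w A b.1 < 0
  · exact Conn.trans (j := 2) (k := 4) (hw.conn_swap hA hA' (Ne.symm hne) hs)
      (hw.conn_same hA' hB rfl hs.le h2 (by simp only [bar_fst]; omega)) (hw.strict hA' hs)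
  · have hs' : gain Γ w B a.1 < 0 := by omega
    exact Conn.trans (j := 4) (k := 2) (hw.conn_same hA hB' rfl h1 hs'.le (by omega))
      (Conn.symm (fun _ => longGen_inv) (hw.conn_swap hB hB' hne hs')) (hw.strict hB' hs')

lemma Reps.conn_adj (hw : Reps Γ φ w) (hA : IsWh Γ A a) (hB : IsWh Γ B b) (hn : Γ.Adj b.1 a.1)
    (h : gain Γ w A a.1 + gain Γ w B b.1 < 0) :
    Conn (longGen Γ) (autNorm Γ) φ 2 (wh hA.adm) (wh hB.adm) := by
  refine Conn.trans (conn_of_whSet (hB.mem_whSet) rfl)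
    (conn_of_whSet ((whSet_inv hA.mem_whSet)) ?_) ?_
  · rw [wh_commute_adj hB.adm hA.adm hn, inv_mul_cancel_left]
  · have := hw.autNorm_wh_wh_le hA hB hn.ne fun v => (cut_img_adj hn _ _ _).le
    rw [smul_eq_mul, mul_assoc]
    omega

lemma Reps.conn_wh (hw : Reps Γ φ w) (hA : IsWh Γ A a) (hB : IsWh Γ B b)
    (h1 : gain Γ w A a.1 ≤ 0) (h2 : gain Γ w B b.1 ≤ 0)
    (h : gain Γ w A a.1 + gain Γ w B b.1 < 0) :
    Conn (longGen Γ) (autNorm Γ) φ 6 (wh hA.adm) (wh hB.adm) := by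
  by_cases hne : b.1 = a.1
  · exact (hw.conn_same hA hB hne h1 h2 h).mono (by omega)
  by_cases hn : Γ.Adj a.1 b.1
  · exact (hw.conn_adj hA hB hn.symm h).mono (by omega)
  have hn' : ¬ Γ.Adj b.1 a.1 := fun h => hn h.symm
  have gA : gain Γ w (flipSet Γ A a) (bar a).1 = gain Γ w A a.1 := hw.gain_flip hA
  have gB : gain Γ w (flipSet Γ B b) (bar b).1 = gain Γ w B b.1 := hw.gain_flip hB
  have fA (x : V × Bool) (hx : ¬ Γ.Adj a.1 x.1) : flipSet Γ A a (some x) = !A (some x) := by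
    simp [flipSet, hx]
  have fB (x : V × Bool) (hx : ¬ Γ.Adj b.1 x.1) : flipSet Γ B b (some x) = !B (some x) := by
    simp [flipSet, hx]
  rcases e1 : A (some b) with _ | _
  · rcases e2 : B (some a) with _ | _
    · exact (hw.conn_good hA hB e2 e1 hn h1 h2 h).mono (by omega)
    · rcases e3 : A (some (bar b)) with _ | _
      · rw [← hB.wh_flip]
        exact (hw.conn_good hA hB.flip (by rw [fB _ hn', e2]; rfl) e3 hn h1
          (by omega) (by omega)).mono (by omega)
      · rcases e4 : B (some (bar a)) with _ | _
        · exact hw.conn_bad hA hB hne hn e2 e4 e1 e3 h1 h2 h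
        · rw [← hA.wh_flip, ← hB.wh_flip]
          exact (hw.conn_good hA.flip hB.flip (by rw [fB (bar a) hn', e4]; rfl)
            (by rw [fA (bar b) hn, e3]; rfl) hn (by omega) (by omega) (by omega)).mono (by omega)
  · rcases e4 : B (some (bar a)) with _ | _
    · rw [← hA.wh_flip]
      exact (hw.conn_good hA.flip hB e4 (by rw [fA _ hn, e1]; rfl) hn
        (by omega) h2 (by omega)).mono (by omega)
    · rcases e3 : A (some (bar b)) with _ | _
      · rcases e2 : B (some a) with _ | _
        · rw [← hA.wh_flip]
          exact hw.conn_bad hA.flip hB hne hn e4 (by rw [bar_bar, e2]) (by rw [fA _ hn, e1]; rfl)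
            (by rw [fA (bar b) hn, e3]; rfl) (by omega) h2 (by omega)
        · rw [← hB.wh_flip]
          exact (hw.conn_good hA hB.flip (by rw [fB _ hn', e2]; rfl) e3 hn h1
            (by omega) (by omega)).mono (by omega)
      · rw [← hA.wh_flip, ← hB.wh_flip]
        exact (hw.conn_good hA.flip hB.flip (by rw [fB (bar a) hn', e4]; rfl)
          (by rw [fA (bar b) hn, e3]; rfl) hn (by omega) (by omega) (by omega)).mono (by omega)

lemma longGen_conn (φ : MulAut (Raag Γ)) {α β : MulAut (Raag Γ)} (hα : α ∈ longGen Γ)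
    (hβ : β ∈ longGen Γ) (h1 : autNorm Γ (α • φ) ≤ autNorm Γ φ)
    (h2 : autNorm Γ (β • φ) < autNorm Γ φ) : Conn (longGen Γ) (autNorm Γ) φ 6 α β := by
  rw [smul_eq_mul] at h1 h2
  rcases hβ with hβ | hβ
  swap
  · rw [hβ.1.autNorm_mul] at h2; omega
  rcases hα with hα | hα
  · obtain ⟨A, a, hA, rfl⟩ := hα
    obtain ⟨B, b, hB, rfl⟩ := hβ
    obtain ⟨w, hw⟩ := exists_reps Γ φ
    have := hw.autNorm_wh hA
    have := hw.autNorm_wh hB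
    exact hw.conn_wh hA hB (by omega) (by omega) (by omega)
  · refine Conn.mono (Conn.trans (γ := α * β) (j := 1) (k := 1)
      (conn_of_whSet ((hα.1.conj_mem hβ)) (by group))
      (conn_of_mem (longGen_inv (Or.inr hα)) (by group)) ?_) (by omega)
    rw [smul_eq_mul, mul_assoc, hα.1.autNorm_mul]
    exact h2

end PeakReduction

section LongRange

variable {Γ : SimpleGraph V}

lemma IsInversion.isSgn {α : MulAut (Raag Γ)} (h : IsInversion Γ α) : IsSgn α := by
  obtain ⟨v, hv, h⟩ := h
  intro u
  by_cases hu : u = v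
  · exact ⟨(v, false), by rw [hu, hv, ev_false]⟩
  · exact ⟨(u, true), by rw [h u hu, ev_true]⟩

lemma longGen_subset {ω : MulAut (Raag Γ)} (h : ω ∈ longGen Γ) : ω ∈ longGroup Γ := by
  rcases h with h | h
  · exact whSet_subset_longGroup h
  · exact h.2

lemma longGen_finite : (longGen Γ).Finite :=
  whSet_finite.union (sgn_finite.subset fun _ h => h.1)

lemma longGroup_le_closure : longGroup Γ ≤ Subgroup.closure (longGen Γ) := by
  refine Subgroup.closure_mono ?_
  rintro φ (h | h)
  · exact Or.inl h
  · exact Or.inr ⟨IsInversion.isSgn h, Subgroup.subset_closure (Or.inr h)⟩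

variable [DecidableRel Γ.Adj]

theorem longGroup_peakReducible : PeakReducible (G := longGroup Γ) (X := MulAut (Raag Γ))
    (Subtype.val ⁻¹' longGen Γ) (autNorm Γ) 1 6 where
  inv_mem ω hω := longGen_inv hω
  local_conn g α hα β hβ h1 h2 :=
    Conn.of_subgroup _ (fun _ => longGen_subset) (longGen_conn _ hα hβ h1 h2)
  min g := by rw [autNorm_one]; exact card_le_autNorm _
  gen := closure_preimage_eq_top _ _ (fun _ => longGen_subset) longGroup_le_closure

instance longGroup_isFinitelyPresented : Group.IsFinitelyPresented (longGroup Γ) := by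
  have hst : MulAction.stabilizer (longGroup Γ) (1 : MulAut (Raag Γ)) = ⊥ := by
    rw [eq_bot_iff]
    intro g hg
    rw [MulAction.mem_stabilizer_iff, Subgroup.smul_def, smul_eq_mul, mul_one] at hg
    exact Subtype.ext hg
  have : Group.IsFinitelyPresented (MulAction.stabilizer (longGroup Γ) (1 : MulAut (Raag Γ))) := by
    rw [hst]; infer_instance
  refine longGroup_peakReducible.isFinitelyPresented
    (longGen_finite.preimage Subtype.val_injective.injOn) ?_
  refine sgn_finite.subset fun φ hφ => ?_
  rw [Set.mem_ofPred_eq, autNorm_one] at hφ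
  exact isSgn_of_autNorm hφ.2

end LongRange

section SpecialLinear

section PatternGen

variable {ι : Type*} [Fintype ι] [DecidableEq ι] [Preorder ι]

variable (ι) in
/-- Elementary matrices and sign changes. -/
def elemGen : Set ((ι → ℤ) ≃ₗ[ℤ] (ι → ℤ)) :=
  {φ | (∃ (p w : ι) (h : p ≠ w) (ε : ℤ), (ε = 1 ∨ ε = -1) ∧ p ≤ w ∧ φ = elem p w h ε) ∨
    ∃ a, φ = flipAt a}

lemma diagonal_mem_closure (s : ι → ℤ) (hs : ∀ i, s i = 1 ∨ s i = -1)
    (φ : (ι → ℤ) ≃ₗ[ℤ] (ι → ℤ)) (h : ∀ z i, φ z i = s i * z i) :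
    φ ∈ Subgroup.closure (elemGen ι) := by
  induction hn : (Finset.univ.filter fun i => s i = -1).card using Nat.strong_induction_on
    generalizing s φ with
  | _ n ih =>
    by_cases hall : ∀ i, s i = 1
    · have : φ = 1 := by
        ext z i
        show φ _ i = _
        rw [h, hall, one_mul]; rfl
      rw [this]; exact one_mem _
    · push Not at hall
      obtain ⟨i, hi⟩ := hall
      have hi' : s i = -1 := (hs i).resolve_left hi
      have hm : flipAt i ∈ Subgroup.closure (elemGen ι) :=
        Subgroup.subset_closure (Or.inr ⟨i, rfl⟩)
      rw [← Subgroup.mul_mem_cancel_left _ hm]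
      refine ih _ ?_ (Function.update s i 1) ?_ _ ?_ rfl
      · rw [← hn]
        apply Finset.card_lt_card
        rw [Finset.ssubset_iff_of_subset]
        · exact ⟨i, by simp [hi'], by simp⟩
        · intro j hj
          by_cases hji : j = i
          · subst hji; simp at hj
          · simpa [hji] using hj
      · intro j
        by_cases hji : j = i
        · subst hji; simp
        · simpa [hji] using hs j
      · intro z j
        rw [LinearEquiv.mul_apply, flipAt_apply]
        by_cases hji : j = i
        · subst hji; simp [h, hi']
        · simp [hji, h]

lemma rot_mem_closure {a b : ι} (h : a ≠ b) (hab : a ≤ b) (hba : b ≤ a) :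
    rot a b h 1 (by norm_num) ∈ Subgroup.closure (elemGen ι) := by
  have h1 := elem_rot h (ε := 1) (by norm_num)
  have key (p w : ι) (h : p ≠ w) (hpw : p ≤ w) (ε : ℤ) (hε : ε = 1 ∨ ε = -1) :
      elem p w h ε ∈ Subgroup.closure (elemGen ι) :=
    Subgroup.subset_closure (Or.inl ⟨p, w, h, ε, hε, hpw, rfl⟩)
  have h2 := key b a h.symm hba 1 (Or.inl rfl)
  rw [h1] at h2
  exact (Subgroup.mul_mem_cancel_right _ (mul_mem (key b a h.symm hba (-1) (Or.inr rfl))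
    (key a b h hab 1 (Or.inl rfl)))).1 h2

lemma signedPerm_mem_closure (π : Equiv.Perm ι) (hπ : ∀ i, i ≤ π i) (s : ι → ℤ)
    (hs : ∀ i, s i = 1 ∨ s i = -1) (φ : (ι → ℤ) ≃ₗ[ℤ] (ι → ℤ))
    (h : ∀ z i, φ z (π i) = s i * z i) : φ ∈ Subgroup.closure (elemGen ι) := by
  induction hn : π.support.card using Nat.strong_induction_on generalizing π s φ with
  | _ n ih =>
    by_cases hall : ∀ i, π i = i
    · exact diagonal_mem_closure s hs φ fun z i => by rw [← h, hall]
    · push Not at hall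
      obtain ⟨i, hi⟩ := hall
      have hback : π i ≤ i := by
        have hpow (n : ℕ) (j : ι) : j ≤ (π ^ n) j := by
          induction n with
          | zero => simp
          | succ n ih => rw [pow_succ']; exact ih.trans (hπ _)
        have h1 := hpow (orderOf π - 1) (π i)
        rwa [← Equiv.Perm.mul_apply, ← pow_succ, Nat.sub_add_cancel (orderOf_pos π),
          pow_orderOf_eq_one, Equiv.Perm.one_apply] at h1
      rw [← Subgroup.mul_mem_cancel_left _ (rot_mem_closure (Ne.symm hi) (hπ i) hback)]
      refine ih _ (hn ▸ Equiv.Perm.card_support_swap_mul hi) (Equiv.swap i (π i) * π) ?_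
        (fun j => if π j = i then - s j else s j) ?_ _ ?_ rfl
      · intro j
        rw [Equiv.Perm.mul_apply]
        by_cases h1 : π j = i
        · rw [h1, Equiv.swap_apply_left]; exact (h1 ▸ hπ j).trans (hπ i)
        · by_cases h2 : π j = π i
          · rw [h2, Equiv.swap_apply_right]; exact (π.injective h2).le
          · rw [Equiv.swap_apply_of_ne_of_ne h1 h2]; exact hπ j
      · intro j
        have := hs j
        split_ifs <;> omega
      · intro z j
        rw [LinearEquiv.mul_apply, rot_apply, Equiv.Perm.mul_apply]
        by_cases h1 : π j = i
        · have h3 : φ z i = s j * z j := by rw [← h1, h]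
          rw [h1, Equiv.swap_apply_left, Function.update_self, if_pos rfl, h3]; ring
        · rw [if_neg h1]
          by_cases h2 : π j = π i
          · rw [h2, Equiv.swap_apply_right, Function.update_of_ne (Ne.symm hi),
              Function.update_self, h, π.injective h2, one_mul]
          · rw [Equiv.swap_apply_of_ne_of_ne h1 h2, Function.update_of_ne h2,
              Function.update_of_ne h1, h]

lemma suppAbove_single (u : ι) (n : ℤ) : SuppAbove u (Pi.single u n) := by
  intro i hi
  by_cases hip : i = u
  · exact hip ▸ le_rfl
  · simp [hip] at hi

lemma patternGroup_le_closure_elemGen :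
    patternGroup (Finset.univ : Finset ι) ≤ Subgroup.closure (elemGen ι) := by
  refine (pattern_main Finset.univ).2.trans ((Subgroup.closure_le _).2 ?_)
  rintro φ ⟨hφ, ⟨p, w, h, ε, hε, rfl⟩ | ⟨π, s, hs, h⟩⟩
  · exact Subgroup.subset_closure (Or.inl ⟨p, w, h, ε, hε, ((elem_mem_iff h hε).1 hφ).2, rfl⟩)
  · refine signedPerm_mem_closure π (fun i => ?_) s hs φ h
    refine (hφ.1 i _).1 (suppAbove_single i 1) (π i) ?_
    rw [h]
    have := hs i
    simp
    omega

end PatternGen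

end SpecialLinear

section ShortRange

/-- Inclusion of stars, as a preorder on the vertices. -/
@[reducible] def starPreorder (Γ : SimpleGraph V) : Preorder V where
  le v w := st Γ v ⊆ st Γ w
  le_refl _ := subset_rfl
  le_trans _ _ _ h h' := h.trans h'

variable {Γ : SimpleGraph V}

lemma mem_st {u v : V} : u ∈ st Γ v ↔ u = v ∨ Γ.Adj v u := Iff.rfl

lemma self_mem_st (v : V) : v ∈ st Γ v := Or.inl rfl

lemma mem_st_comm {u v : V} : u ∈ st Γ v ↔ v ∈ st Γ u := by
  rw [mem_st, mem_st, eq_comm, Γ.adj_comm]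

lemma adj_of_st_subset {p w : V} (hp : p ≠ w) (h : st Γ p ⊆ st Γ w) : Γ.Adj w p :=
  (mem_st.1 (h (self_mem_st p))).resolve_left hp

lemma commute_of_mem_st {u v : V} (h : u ∈ st Γ v) : Commute (gen Γ u) (gen Γ v) := by
  rcases mem_st.1 h with rfl | h
  · exact Commute.refl _
  · exact gen_commute h.symm

variable (Γ) in
/-- Vectors supported on the vertices whose star contains the star of `u`. -/
def starVec (u : V) : AddSubgroup (V → ℤ) where
  carrier := {z | ∀ w, z w ≠ 0 → st Γ u ⊆ st Γ w}
  zero_mem' := fun w h => absurd rfl h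
  add_mem' := by
    intro z z' hz hz' w hw
    by_cases h : z w = 0
    · exact hz' w fun h' => hw (by simp [h, h'])
    · exact hz w h
  neg_mem' := by
    intro z hz w hw
    exact hz w fun h => hw (by simp [h])

lemma starVec_mono {u v : V} (h : st Γ u ⊆ st Γ v) : starVec Γ v ≤ starVec Γ u :=
  fun _ hz w hw => h.trans (hz w hw)

lemma single_mem_starVec (u : V) (n : ℤ) : Pi.single u n ∈ starVec Γ u := by
  intro w hw
  by_cases h : w = u
  · rw [h]
  · simp [h] at hw

lemma mem_st_of_starVec {u v : V} (huv : v ∈ st Γ u) {z z' : V → ℤ} (hz : z ∈ starVec Γ u)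
    (hz' : z' ∈ starVec Γ v) {w w' : V} (hw : z w ≠ 0) (hw' : z' w' ≠ 0) : w ∈ st Γ w' :=
  hz' w' hw' (mem_st_comm.1 (hz w hw huv))

lemma list_prod_map_mul {α M : Type*} [Monoid M] (l : List α) (f g : α → M)
    (h : ∀ i j, Commute (f i) (g j)) :
    (l.map fun i => f i * g i).prod = (l.map f).prod * (l.map g).prod := by
  induction l with
  | nil => simp
  | cons a l ih =>
    have hc : Commute (g a) (l.map f).prod :=
      Commute.list_prod_right _ _ (by
        intro x hx
        obtain ⟨i, _, rfl⟩ := List.mem_map.1 hx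
        exact (h i a).symm)
    simp only [List.map_cons, List.prod_cons, ih, mul_assoc]
    rw [← mul_assoc (g a), hc.eq, mul_assoc]

variable (Γ) in
/-- The product of the powers of the generators with the exponents `z`. -/
noncomputable def mon (z : V → ℤ) : Raag Γ := (Finset.univ.toList.map fun w => gen Γ w ^ z w).prod

lemma commute_gen_zpow {u v : V} (huv : v ∈ st Γ u) {z z' : V → ℤ} (hz : z ∈ starVec Γ u)
    (hz' : z' ∈ starVec Γ v) (w w' : V) : Commute (gen Γ w ^ z w) (gen Γ w' ^ z' w') := by
  by_cases hw : z w = 0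
  · rw [hw, zpow_zero]; exact Commute.one_left _
  by_cases hw' : z' w' = 0
  · rw [hw', zpow_zero]; exact Commute.one_right _
  exact ((commute_of_mem_st (mem_st_of_starVec huv hz hz' hw hw')).zpow_left _).zpow_right _

lemma commute_mon {u v : V} (huv : v ∈ st Γ u) {z z' : V → ℤ} (hz : z ∈ starVec Γ u)
    (hz' : z' ∈ starVec Γ v) : Commute (mon Γ z) (mon Γ z') := by
  refine Commute.list_prod_left _ _ fun x hx => Commute.list_prod_right _ _ fun y hy => ?_
  obtain ⟨w, _, rfl⟩ := List.mem_map.1 hx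
  obtain ⟨w', _, rfl⟩ := List.mem_map.1 hy
  exact commute_gen_zpow huv hz hz' w w'

lemma mon_add {u : V} {z z' : V → ℤ} (hz : z ∈ starVec Γ u) (hz' : z' ∈ starVec Γ u) :
    mon Γ (z + z') = mon Γ z * mon Γ z' := by
  unfold mon
  rw [← list_prod_map_mul _ _ _ (commute_gen_zpow (self_mem_st u) hz hz')]
  simp only [Pi.add_apply, zpow_add]

lemma mon_zero : mon Γ 0 = 1 := by
  unfold mon
  exact List.prod_eq_one fun x hx => by
    obtain ⟨w, _, rfl⟩ := List.mem_map.1 hx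
    simp

/-- The map `mon` as a homomorphism on the vectors of an upper set. -/
noncomputable def monHom (u : V) : Multiplicative (starVec Γ u) →* Raag Γ where
  toFun z := mon Γ z.toAdd.1
  map_one' := mon_zero
  map_mul' z z' := mon_add z.toAdd.2 z'.toAdd.2

lemma mon_zsmul {u : V} {z : V → ℤ} (hz : z ∈ starVec Γ u) (n : ℤ) :
    mon Γ (n • z) = mon Γ z ^ n :=
  map_zpow (monHom (Γ := Γ) u) (Multiplicative.ofAdd ⟨z, hz⟩) n

lemma list_prod_map_single {M : Type*} [Monoid M] {l : List V} (hl : l.Nodup) {u : V} (hu : u ∈ l)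
    (f : V → M) (hf : ∀ w ≠ u, f w = 1) : (l.map f).prod = f u := by
  induction l with
  | nil => simp at hu
  | cons a l ih =>
    rw [List.nodup_cons] at hl
    rw [List.map_cons, List.prod_cons]
    by_cases h : a = u
    · subst h
      rw [List.prod_eq_one, mul_one]
      intro x hx
      obtain ⟨w, hw, rfl⟩ := List.mem_map.1 hx
      exact hf w (by rintro rfl; exact hl.1 hw)
    · rw [hf a h, one_mul, ih hl.2 ((List.mem_cons.1 hu).resolve_left (Ne.symm h))]

lemma mon_single (u : V) (n : ℤ) : mon Γ (Pi.single u n) = gen Γ u ^ n := by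
  unfold mon
  rw [list_prod_map_single (Finset.nodup_toList _) (Finset.mem_toList.2 (Finset.mem_univ u))]
  · simp
  · intro w hw
    simp [hw]

lemma mon_list_sum {u : V} (l : List V) (F : V → V → ℤ) (hF : ∀ w, F w ∈ starVec Γ u) :
    mon Γ (l.map F).sum = (l.map fun w => mon Γ (F w)).prod := by
  induction l with
  | nil => exact mon_zero
  | cons a l ih =>
    simp only [List.map_cons, List.sum_cons, List.prod_cons, ← ih]
    refine mon_add (hF a) (AddSubgroup.list_sum_mem _ fun x hx => ?_)
    obtain ⟨w, _, rfl⟩ := List.mem_map.1 hx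
    exact hF w

/-- The endomorphism of the right-angled Artin group defined by a matrix. -/
noncomputable def matHom (φ : (V → ℤ) →ₗ[ℤ] (V → ℤ)) (h : ∀ u, φ (Pi.single u 1) ∈ starVec Γ u) :
    Raag Γ →* Raag Γ :=
  PresentedGroup.toGroup (f := fun u => mon Γ (φ (Pi.single u 1))) (by
    rintro r ⟨u, v, huv, rfl⟩
    simp only [map_mul, map_inv, FreeGroup.lift_apply_of]
    rw [mul_inv_eq_one, mul_inv_eq_iff_eq_mul]
    exact commute_mon (Or.inr huv) (h u) (h v))

lemma matHom_gen (φ : (V → ℤ) →ₗ[ℤ] (V → ℤ)) (h : ∀ u, φ (Pi.single u 1) ∈ starVec Γ u) (u : V) :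
    matHom φ h (gen Γ u) = mon Γ (φ (Pi.single u 1)) :=
  PresentedGroup.toGroup.of _

lemma matHom_mon (φ : (V → ℤ) →ₗ[ℤ] (V → ℤ)) (h : ∀ u, φ (Pi.single u 1) ∈ starVec Γ u) {u : V}
    {z : V → ℤ} (hz : z ∈ starVec Γ u) : matHom φ h (mon Γ z) = mon Γ (φ z) := by
  have e : z = (Finset.univ.toList.map fun w => z w • (Pi.single w 1 : V → ℤ)).sum := by
    rw [Finset.sum_map_toList]
    ext i
    simp [Finset.sum_apply, Pi.single_apply]
  have hF (w : V) : z w • φ (Pi.single w 1) ∈ starVec Γ u := by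
    by_cases hw : z w = 0
    · rw [hw, zero_smul]; exact zero_mem _
    · exact zsmul_mem (starVec_mono (hz w hw) (h w)) _
  conv_rhs => rw [e, map_list_sum, List.map_map]
  have := mon_list_sum Finset.univ.toList _ hF
  simp only [Function.comp_def, map_smul]
  rw [this]
  conv_lhs => rw [mon, map_list_prod, List.map_map]
  refine congrArg List.prod (List.map_congr_left fun w _ => ?_)
  rw [Function.comp_apply, map_zpow, matHom_gen, mon_zsmul (h w)]

variable (Γ) in
/-- The group of matrices preserving the upper sets of the inclusion order on stars. -/
def starMat : Subgroup ((V → ℤ) ≃ₗ[ℤ] (V → ℤ)) :=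
  letI := starPreorder Γ
  patternGroup Finset.univ

lemma starMat_mem {φ : (V → ℤ) ≃ₗ[ℤ] (V → ℤ)} (hφ : φ ∈ starMat Γ) (u : V) :
    φ (Pi.single u 1) ∈ starVec Γ u :=
  letI := starPreorder Γ
  (hφ.1 u _).1 (suppAbove_single u 1)

/-- The endomorphism defined by a matrix preserving upper sets. -/
noncomputable def starHom (φ : starMat Γ) : Raag Γ →* Raag Γ :=
  matHom φ.1.toLinearMap (starMat_mem φ.2)

lemma starHom_mul (φ ψ : starMat Γ) (u : V) :
    starHom φ (starHom ψ (gen Γ u)) = starHom (φ * ψ) (gen Γ u) := by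
  unfold starHom
  rw [matHom_gen, matHom_gen]
  exact matHom_mon _ _ (starMat_mem ψ.2 u)

lemma starHom_one (u : V) : starHom (1 : starMat Γ) (gen Γ u) = gen Γ u := by
  unfold starHom
  rw [matHom_gen]
  exact (mon_single u 1).trans (zpow_one _)

variable (Γ) in
/-- Matrices preserving upper sets act on the right-angled Artin group. -/
noncomputable def starRep : starMat Γ →* MulAut (Raag Γ) :=
  MonoidHom.mk' (fun φ => MonoidHom.toMulEquiv (starHom φ) (starHom φ⁻¹)
    (PresentedGroup.ext fun u => by
      change starHom φ⁻¹ (starHom φ (gen Γ u)) = gen Γ u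
      rw [starHom_mul, inv_mul_cancel, starHom_one])
    (PresentedGroup.ext fun u => by
      change starHom φ (starHom φ⁻¹ (gen Γ u)) = gen Γ u
      rw [starHom_mul, mul_inv_cancel, starHom_one]))
    fun φ ψ => mulEquiv_ext_gen fun u => (starHom_mul φ ψ u).symm

lemma starRep_gen (φ : starMat Γ) (u : V) :
    starRep Γ φ (gen Γ u) = mon Γ (φ.1 (Pi.single u 1)) :=
  matHom_gen _ (starMat_mem φ.2) u

variable (Γ) in
/-- The exponent vector of an element of the right-angled Artin group. -/
def expVec : Raag Γ →* Multiplicative (V → ℤ) :=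
  PresentedGroup.toGroup (f := fun u => Multiplicative.ofAdd (Pi.single u 1)) (by
    rintro r ⟨u, v, huv, rfl⟩
    simp only [map_mul, map_inv, FreeGroup.lift_apply_of]
    rw [mul_inv_eq_one, mul_inv_eq_iff_eq_mul, mul_comm])

lemma expVec_gen (u : V) : expVec Γ (gen Γ u) = Multiplicative.ofAdd (Pi.single u 1) :=
  PresentedGroup.toGroup.of _

lemma expVec_mon (z : V → ℤ) : expVec Γ (mon Γ z) = Multiplicative.ofAdd z := by
  rw [mon, map_list_prod, List.map_map]
  simp only [Function.comp_def, map_zpow, expVec_gen]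
  rw [Finset.prod_map_toList]
  simp only [← ofAdd_zsmul]
  rw [← ofAdd_sum]
  congr 1
  ext i
  simp [Finset.sum_apply, Pi.single_apply]

lemma starRep_injective : Function.Injective (starRep Γ) := by
  intro φ ψ h
  let := starPreorder Γ
  refine Subtype.ext (linearEquiv_ext_single fun u => ?_)
  have := congrArg (fun α : MulAut (Raag Γ) => expVec Γ (α (gen Γ u))) h
  simp only [starRep_gen, expVec_mon] at this
  exact this

variable (Γ) in
/-- The subgroup generated by inversions and transvections between adjacent vertices. -/
noncomputable def shortGroup : Subgroup (MulAut (Raag Γ)) := (starRep Γ).range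

instance shortGroup_isFinitelyPresented : Group.IsFinitelyPresented (shortGroup Γ) := by
  have : Group.IsFinitelyPresented (starMat Γ) :=
    letI := starPreorder Γ
    (pattern_main Finset.univ).1
  exact Group.IsFinitelyPresented.equiv (MonoidHom.ofInjective starRep_injective)

lemma shortGroup_eq_closure : shortGroup Γ =
    Subgroup.closure (starRep Γ '' (Subtype.val ⁻¹' (@elemGen V _ (starPreorder Γ)))) := by
  let := starPreorder Γ
  have h : Subgroup.closure (Subtype.val ⁻¹' elemGen V : Set (starMat Γ)) = ⊤ := by
    refine closure_preimage_eq_top _ _ ?_ patternGroup_le_closure_elemGen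
    rintro φ (⟨p, w, h, ε, hε, hpw, rfl⟩ | ⟨a, rfl⟩)
    · exact elem_mem h ε (Finset.mem_univ _) hpw
    · exact flipAt_mem (Finset.mem_univ _)
  rw [shortGroup, MonoidHom.range_eq_map, ← h, MonoidHom.map_closure]

end ShortRange

section Twists

variable {Γ : SimpleGraph V} {w : V} {f g : V → ℤ}

variable (Γ) in
/-- Exponents defining a product of transvections by `w` between adjacent vertices. -/
def Twd (w : V) (f : V → ℤ) : Prop := ∀ x, f x ≠ 0 → x ≠ w ∧ st Γ x ⊆ st Γ w

lemma Twd.add (hf : Twd Γ w f) (hg : Twd Γ w g) : Twd Γ w (f + g) := by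
  intro x hx
  by_cases h : f x = 0
  · exact hg x fun h' => hx (by simp [h, h'])
  · exact hf x h

lemma Twd.neg (hf : Twd Γ w f) : Twd Γ w (-f) := fun x hx => hf x fun h => hx (by simp [h])

lemma Twd.self (hf : Twd Γ w f) : f w = 0 := by
  by_contra h
  exact (hf w h).1 rfl

lemma Twd.single {p : V} (hp : p ≠ w) (h : st Γ p ⊆ st Γ w) (n : ℤ) : Twd Γ w (Pi.single p n) := by
  intro x hx
  by_cases hxp : x = p
  · exact hxp ▸ ⟨hp, h⟩
  · simp [hxp] at hx

/-- The endomorphism multiplying each generator `x` by the power `f x` of `w`. -/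
def twHom (hf : Twd Γ w f) : Raag Γ →* Raag Γ :=
  PresentedGroup.toGroup (f := fun x => gen Γ x * gen Γ w ^ f x) (by
    have key {u v : V} (huv : Γ.Adj u v) : Commute (gen Γ v) (gen Γ w ^ f u) := by
      by_cases h : f u = 0
      · rw [h, zpow_zero]; exact Commute.one_right _
      · exact (commute_of_mem_st ((hf u h).2 (Or.inr huv))).zpow_right _
    rintro r ⟨u, v, huv, rfl⟩
    simp only [map_mul, map_inv, FreeGroup.lift_apply_of]
    rw [mul_inv_eq_one, mul_inv_eq_iff_eq_mul]
    exact ((gen_commute huv).mul_right (key huv.symm)).mul_left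
      ((key huv).symm.mul_right (((Commute.refl _).zpow_left _).zpow_right _)))

lemma twHom_gen (hf : Twd Γ w f) (x : V) : twHom hf (gen Γ x) = gen Γ x * gen Γ w ^ f x :=
  PresentedGroup.toGroup.of _

lemma twHom_comp (hf : Twd Γ w f) (hg : Twd Γ w g) (x : V) :
    twHom hf (twHom hg (gen Γ x)) = gen Γ x * gen Γ w ^ (f + g) x := by
  simp only [twHom_gen, map_mul, map_zpow, hf.self, zpow_zero, mul_one, Pi.add_apply, zpow_add,
    mul_assoc]

/-- The automorphism multiplying each generator `x` by the power `f x` of `w`. -/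
def tw (hf : Twd Γ w f) : MulAut (Raag Γ) :=
  MonoidHom.toMulEquiv (twHom hf) (twHom hf.neg)
    (PresentedGroup.ext fun u => by
      change twHom hf.neg (twHom hf (gen Γ u)) = gen Γ u
      rw [twHom_comp, neg_add_cancel, Pi.zero_apply, zpow_zero, mul_one])
    (PresentedGroup.ext fun u => by
      change twHom hf (twHom hf.neg (gen Γ u)) = gen Γ u
      rw [twHom_comp, add_neg_cancel, Pi.zero_apply, zpow_zero, mul_one])

lemma tw_gen (hf : Twd Γ w f) (x : V) : tw hf (gen Γ x) = gen Γ x * gen Γ w ^ f x := twHom_gen hf x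

lemma tw_gen_of_eq_zero (hf : Twd Γ w f) {x : V} (hx : f x = 0) : tw hf (gen Γ x) = gen Γ x := by
  rw [tw_gen, hx, zpow_zero, mul_one]

lemma tw_ev_of_eq_zero (hf : Twd Γ w f) {x : V × Bool} (hx : f x.1 = 0) :
    tw hf (ev Γ x) = ev Γ x := by
  unfold ev
  split_ifs
  · exact tw_gen_of_eq_zero hf hx
  · rw [map_inv, tw_gen_of_eq_zero hf hx]

lemma tw_mul (hf : Twd Γ w f) (hg : Twd Γ w g) : tw hf * tw hg = tw (hf.add hg) :=
  mulEquiv_ext_gen fun u => by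
    rw [tw_gen, MulAut.mul_apply]
    exact twHom_comp hf hg u

lemma tw_congr (hf : Twd Γ w f) (hg : Twd Γ w g) (h : f = g) : tw hf = tw hg := by
  subst h; rfl

lemma tw_eq_one (hf : Twd Γ w f) (h : f = 0) : tw hf = 1 := by
  subst h
  exact mulEquiv_ext_gen fun u => tw_gen_of_eq_zero _ rfl

lemma tw_inv (hf : Twd Γ w f) : (tw hf)⁻¹ = tw hf.neg := by
  rw [inv_eq_iff_mul_eq_one, tw_mul]
  exact tw_eq_one _ (add_neg_cancel f)

variable (Γ) in
/-- The transvections by `w` and their inverses, between adjacent vertices. -/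
def twSet (w : V) : Set (MulAut (Raag Γ)) :=
  {α | ∃ (p : V) (hp : p ≠ w) (h : st Γ p ⊆ st Γ w) (ε : ℤ), (ε = 1 ∨ ε = -1) ∧
    α = tw (Twd.single hp h ε)}

lemma twSet_finite : (twSet Γ w).Finite := by
  classical
  have : twSet Γ w ⊆ Set.range (fun q : V × Bool =>
      if h : q.1 ≠ w ∧ st Γ q.1 ⊆ st Γ w then tw (Twd.single h.1 h.2 (if q.2 then 1 else -1))
      else 1) := by
    rintro α ⟨p, hp, h, ε, rfl | rfl, rfl⟩
    · exact ⟨(p, true), by simp [hp, h]⟩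
    · exact ⟨(p, false), by simp [hp, h]⟩
  exact (Set.finite_range _).subset this

lemma twSet_inv {α : MulAut (Raag Γ)} (hα : α ∈ twSet Γ w) : α⁻¹ ∈ twSet Γ w := by
  obtain ⟨p, hp, h, ε, hε, rfl⟩ := hα
  refine ⟨p, hp, h, -ε, by omega, ?_⟩
  rw [tw_inv]
  exact tw_congr _ _ (Pi.single_neg (f := fun _ => ℤ) p ε).symm

lemma tw_single_mem_closure {p : V} (hp : p ≠ w) (h : st Γ p ⊆ st Γ w) (n : ℤ) :
    tw (Twd.single hp h n) ∈ Subgroup.closure (twSet Γ w) := by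
  have hone (ε : ℤ) (hε : ε = 1 ∨ ε = -1) :
      tw (Twd.single hp h ε) ∈ Subgroup.closure (twSet Γ w) :=
    Subgroup.subset_closure ⟨p, hp, h, ε, hε, rfl⟩
  induction n using Int.induction_on with
  | zero => rw [tw_eq_one _ (Pi.single_zero p)]; exact one_mem _
  | succ n ih =>
    have := mul_mem ih (hone 1 (Or.inl rfl))
    rw [tw_mul] at this
    rwa [tw_congr _ _ (Pi.single_add (f := fun _ => ℤ) p n 1)]
  | pred n ih =>
    have := mul_mem ih (hone (-1) (Or.inr rfl))
    rw [tw_mul] at this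
    rwa [tw_congr _ _ (Pi.single_add (f := fun _ => ℤ) p (-n) (-1))]

lemma tw_mem_closure (hf : Twd Γ w f) : tw hf ∈ Subgroup.closure (twSet Γ w) := by
  induction hn : (Finset.univ.filter fun x => f x ≠ 0).card generalizing f with
  | zero =>
    rw [tw_eq_one hf]
    · exact one_mem _
    · ext x
      by_contra hx
      rw [Finset.card_eq_zero] at hn
      exact Finset.eq_empty_iff_forall_notMem.1 hn x (Finset.mem_filter.2 ⟨Finset.mem_univ x, hx⟩)
  | succ n ih =>
    obtain ⟨p, hp⟩ := Finset.card_pos.1 (by rw [hn]; omega :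
      0 < (Finset.univ.filter fun x => f x ≠ 0).card)
    obtain ⟨hpw, hst⟩ := hf p (Finset.mem_filter.1 hp).2
    have hs := Twd.single hpw hst (-f p)
    rw [← Subgroup.mul_mem_cancel_left _ (tw_single_mem_closure hpw hst (-f p)), tw_mul]
    refine ih _ ?_
    have : (Finset.univ.filter fun x => ((Pi.single p (-f p) : V → ℤ) + f) x ≠ 0) =
        (Finset.univ.filter fun x => f x ≠ 0).erase p := by
      ext x
      by_cases hx : x = p
      · subst hx; simp
      · simp [hx]
    rw [this, Finset.card_erase_of_mem hp, hn, Nat.add_sub_cancel]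

end Twists

section TwistConjugation

variable {Γ : SimpleGraph V} {w p : V} {f g : V → ℤ} {a : V × Bool} {s : Option (V × Bool) → ℤ}

lemma single_of_ne {x : V} (h : x ≠ p) (n : ℤ) : (Pi.single p n : V → ℤ) x = 0 := by
  simp [h]

lemma commute_ev_gen_of_mem_st (h : a.1 ∈ st Γ w) : Commute (ev Γ a) (gen Γ w) := by
  unfold ev
  split_ifs
  · exact commute_of_mem_st h
  · exact (commute_of_mem_st h).inv_left

lemma wh_gen_of_mem_st (h : Adm Γ a.1 s) (hw : a.1 ∈ st Γ w) : wh h (gen Γ w) = gen Γ w := by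
  rw [wh_gen]
  rcases mem_st.1 hw with e | e
  · rw [whGen, if_pos e.symm]
  · exact h.whGen_lk e.symm

lemma tw_single_wh_commute (hp : p ≠ w) (hpw : st Γ p ⊆ st Γ w) (ε : ℤ) (h : Adm Γ a.1 s)
    (ha : a.1 ≠ p) : tw (Twd.single hp hpw ε) * wh h = wh h * tw (Twd.single hp hpw ε) := by
  refine mulEquiv_ext_gen fun x => ?_
  rw [MulAut.mul_apply, MulAut.mul_apply]
  have ht := tw_ev_of_eq_zero (Twd.single hp hpw ε) (x := a) (single_of_ne ha ε)
  by_cases hx : x = p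
  · subst hx
    rw [tw_gen, Pi.single_eq_same, map_mul, map_zpow]
    by_cases hw : a.1 ∈ st Γ w
    · have hc := (commute_ev_gen_of_mem_st hw)
      rw [wh_gen_of_mem_st h hw, wh_gen, whGen, if_neg (Ne.symm ha)]
      simp only [map_mul, map_zpow, ht, tw_gen, Pi.single_eq_same, mul_assoc]
      rw [((hc.zpow_left _).zpow_right ε).eq]
    · have hx' : a.1 ∉ st Γ x := fun h' => hw (hpw h')
      have h1 : ¬ Γ.Adj a.1 x := fun h' => hx' (Or.inr h'.symm)
      have h2 : ¬ Γ.Adj a.1 w := fun h' => hw (Or.inr h'.symm)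
      have hwa : w ≠ a.1 := fun h' => hw (Or.inl h'.symm)
      have e1 := h.closed (x, true) (w, true) (adj_of_st_subset hp hpw).symm h1 h2
      have e2 := h.closed (x, true) (w, false) (adj_of_st_subset hp hpw).symm h1 h2
      rw [wh_gen, wh_gen, whGen, whGen, if_neg (Ne.symm ha), if_neg hwa, ← e1, ← e2]
      have e3 : s none - s (some (x, true)) = -(s (some (x, true)) - s none) := by ring
      have e4 : (ev Γ a ^ (s none - s (some (x, true))) * gen Γ w *
          ev Γ a ^ (s (some (x, true)) - s none)) ^ ε =
          ev Γ a ^ (s none - s (some (x, true))) * gen Γ w ^ ε *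
          ev Γ a ^ (s (some (x, true)) - s none) := by
        have := conj_zpow (i := ε) (a := ev Γ a ^ (s none - s (some (x, true)))) (b := gen Γ w)
        rwa [← zpow_neg, neg_sub] at this
      rw [e4]
      simp only [map_mul, map_zpow, ht, tw_gen, Pi.single_eq_same, mul_assoc]
      rw [← mul_assoc (ev Γ a ^ (s (some (x, true)) - s none)), ← zpow_add]
      simp
  · rw [tw_gen_of_eq_zero _ (single_of_ne hx ε), wh_gen, whGen]
    split_ifs
    · exact tw_gen_of_eq_zero _ (single_of_ne hx ε)
    · simp only [map_mul, map_zpow, ht, tw_gen_of_eq_zero _ (single_of_ne hx ε)]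

lemma wh_tw_commute (h : Adm Γ w s) (hf : Twd Γ w f) :
    wh (a := (w, true)) h * tw hf = tw hf * wh (a := (w, true)) h := by
  refine mulEquiv_ext_gen fun x => ?_
  rw [MulAut.mul_apply, MulAut.mul_apply]
  have hw := tw_gen_of_eq_zero hf hf.self
  by_cases hx : f x = 0
  · rw [tw_gen_of_eq_zero hf hx, wh_gen, whGen]
    split_ifs
    · rw [tw_gen_of_eq_zero hf hx]
    · simp only [map_mul, map_zpow, ev_true, hw, tw_gen_of_eq_zero hf hx]
  · obtain ⟨hxw, hst⟩ := hf x hx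
    have hadj := adj_of_st_subset hxw hst
    have h1 : wh (a := (w, true)) h (gen Γ x) = gen Γ x := wh_gen_of_mem_st _ (Or.inr hadj.symm)
    have h2 : wh (a := (w, true)) h (gen Γ w) = gen Γ w := wh_gen_of_mem_st _ (Or.inl rfl)
    rw [h1, tw_gen, map_mul, map_zpow, h1, h2]

lemma exists_tw_wh_conj {v : V} {A : Option (V × Bool) → Bool} (h : IsWh Γ A (v, true))
    (hv : v ≠ w) (hvw : st Γ v ⊆ st Γ w) (ε : ℤ) (hε : ε = 1 ∨ ε = -1) :
    ∃ c ∈ whSet Γ, ∃ (f : V → ℤ) (hf : Twd Γ w f),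
      tw (Twd.single hv hvw ε) * wh h.adm * (tw (Twd.single hv hvw ε))⁻¹ = wh h.adm * c * tw hf ∧
      ∀ g (hg : Twd Γ w g), c * tw hg = tw hg * c := by
  classical
  have hadj := adj_of_st_subset hv hvw
  set s := ind A with hs
  have hsv : ∀ o, s o = 0 ∨ s o = 1 := fun o => by
    rw [hs]; simp only [ind]; split_ifs <;> simp
  have hadm : Adm Γ v s := h.adm
  have hnot {x : V} (hx : ¬ Γ.Adj w x) (hxw : x ≠ w) : ¬ Γ.Adj v x := fun h' =>
    (mem_st.1 (hvw (Or.inr h'))).elim hxw hx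
  let s' : Option (V × Bool) → ℤ := fun o => match o with
    | none => ε * s none
    | some x => if Γ.Adj w x.1 then ε * s none else ε * s (some x)
  have hs' : Adm Γ w s' := by
    refine ⟨fun x hx => by simp [s', hx], fun x y hxy hx hy => ?_⟩
    have hxw : x.1 ≠ w := by rintro e; rw [e] at hxy; exact hy hxy
    have hyw : y.1 ≠ w := by rintro e; rw [e] at hxy; exact hx hxy.symm
    simp [s', hx, hy, hadm.closed x y hxy (hnot hx hxw) (hnot hy hyw)]
  let f : V → ℤ := fun x => if Γ.Adj w x ∧ x ∉ st Γ v then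
    ε * (s (some (x, true)) - s (some (x, false))) else 0
  have hf : Twd Γ w f := by
    intro x hx
    by_cases hc : Γ.Adj w x ∧ x ∉ st Γ v
    · refine ⟨hc.1.ne', ?_⟩
      simp only [f, if_pos hc] at hx
      intro y hy
      rcases mem_st.1 hy with rfl | hy
      · exact Or.inr hc.1
      · by_cases hvy : Γ.Adj v y
        · exact hvw (Or.inr hvy)
        · exfalso
          have hvx : ¬ Γ.Adj v x := fun h' => hc.2 (Or.inr h')
          have e1 := hadm.closed (x, true) (y, true) hy hvx hvy
          have e2 := hadm.closed (x, false) (y, true) hy hvx hvy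
          exact hx (by rw [e1, e2, sub_self, mul_zero])
    · simp only [f, if_neg hc] at hx
      exact absurd rfl hx
  refine ⟨wh (a := (w, true)) hs', ?_, f, hf, ?_, fun g hg => wh_tw_commute hs' hg⟩
  · refine wh_mem_whSet _ (if ε = 1 then 0 else -1) ?_ ?_
    · have := hsv none
      rcases hε with rfl | rfl <;> simp [s'] <;> omega
    · intro x _ hx
      have := hsv (some x)
      rcases hε with rfl | rfl <;> simp [s', hx] <;> omega
  · rw [mul_inv_eq_iff_eq_mul]
    refine mulEquiv_ext_gen fun x => ?_
    simp only [MulAut.mul_apply]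
    have hww : wh h.adm (gen Γ w) = gen Γ w := wh_gen_of_mem_st _ (Or.inr hadj)
    have hwv : wh (a := (w, true)) hs' (gen Γ v) = gen Γ v :=
      wh_gen_of_mem_st _ (Or.inr hadj.symm)
    have hw' : wh (a := (w, true)) hs' (gen Γ w) = gen Γ w := wh_gen_of_mem_st _ (Or.inl rfl)
    have hvv : wh h.adm (gen Γ v) = gen Γ v := wh_gen_of_mem_st _ (Or.inl rfl)
    have hfw := tw_gen_of_eq_zero hf hf.self
    have hfv : tw hf (gen Γ v) = gen Γ v :=
      tw_gen_of_eq_zero hf (by simp only [f]; rw [if_neg fun h' => h'.2 (self_mem_st v)])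
    have htw := tw_gen_of_eq_zero (Twd.single hv hvw ε) (single_of_ne (Ne.symm hv) ε)
    have htv : tw (Twd.single hv hvw ε) (gen Γ v) = gen Γ v * gen Γ w ^ ε := by
      rw [tw_gen, Pi.single_eq_same]
    have hcomm : Commute (gen Γ v) (gen Γ w) := gen_commute hadj.symm
    by_cases hxv : x = v
    · subst hxv
      simp only [hvv, htv, map_mul, map_zpow, hfv, hfw, hwv, hw', hww]
    have htx := tw_gen_of_eq_zero (Twd.single hv hvw ε) (single_of_ne hxv ε)
    rw [htx]
    by_cases hvx : Γ.Adj v x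
    · have h0 : f x = 0 := by simp only [f]; rw [if_neg fun h' => h'.2 (Or.inr hvx)]
      rw [wh_gen_of_mem_st h.adm (Or.inr hvx.symm), htx, tw_gen_of_eq_zero hf h0,
        wh_gen_of_mem_st (a := (w, true)) hs' (mem_st_comm.1 (hvw (Or.inr hvx))),
        wh_gen_of_mem_st h.adm (Or.inr hvx.symm)]
    have hxst : x ∉ st Γ v := fun h' => (mem_st.1 h').elim hxv hvx
    have hxw : x ≠ w := by rintro rfl; exact hvx hadj.symm
    have e : wh h.adm (gen Γ x) = gen Γ v ^ (s none - s (some (x, false))) * gen Γ x *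
        gen Γ v ^ (s (some (x, true)) - s none) := by
      rw [wh_gen, whGen, if_neg hxv, ev_true]
    have hpow (n : ℤ) : (gen Γ v * gen Γ w ^ ε) ^ n = gen Γ v ^ n * gen Γ w ^ (ε * n) := by
      rw [(hcomm.zpow_right ε).mul_zpow, zpow_mul]
    have hpow' (n : ℤ) : (gen Γ v * gen Γ w ^ ε) ^ n = gen Γ w ^ (ε * n) * gen Γ v ^ n := by
      rw [hpow, ((hcomm.zpow_left _).zpow_right _).eq]
    rw [e]
    simp only [map_mul, map_zpow, htv, htx]
    by_cases hwx : Γ.Adj w x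
    · have hfx : f x = ε * (s (some (x, true)) - s (some (x, false))) := by
        simp only [f]; rw [if_pos ⟨hwx, hxst⟩]
      have hcx : Commute (gen Γ w) (gen Γ x) := gen_commute hwx
      rw [tw_gen, map_mul, map_mul, map_zpow, map_zpow, hw', hww,
        wh_gen_of_mem_st (a := (w, true)) hs' (Or.inr hwx.symm), e, hfx, hpow, hpow]
      have e5 : ε * (s (some (x, true)) - s (some (x, false))) =
        ε * (s none - s (some (x, false))) + ε * (s (some (x, true)) - s none) := by ring
      rw [e5, zpow_add]
      simp only [mul_assoc]
      rw [← mul_assoc (gen Γ w ^ _) (gen Γ x), (hcx.zpow_left _).eq, mul_assoc,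
        ← mul_assoc (gen Γ w ^ _) (gen Γ v ^ _), ← ((hcomm.zpow_left _).zpow_right _).eq, mul_assoc]
    · have hfx : f x = 0 := by
        simp only [f]; rw [if_neg fun h' => hwx h'.1]
      rw [tw_gen_of_eq_zero hf hfx, wh_gen (a := (w, true)) hs', whGen, if_neg hxw, ev_true]
      simp only [map_mul, map_zpow, hww, e, s', hwx, if_false, ← mul_sub]
      rw [hpow', hpow]
      simp only [mul_assoc]

end TwistConjugation

section Generation

variable {Γ : SimpleGraph V} {w p : V} {α : MulAut (Raag Γ)}

lemma IsInversion.mul_self (h : IsInversion Γ α) : α * α = 1 := by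
  obtain ⟨v, hv, h⟩ := h
  refine mulEquiv_ext_gen fun x => ?_
  rw [MulAut.mul_apply, MulAut.one_apply]
  by_cases hx : x = v
  · rw [hx, hv, map_inv, hv, inv_inv]
  · rw [h x hx, h x hx]

lemma IsInversion.inv (h : IsInversion Γ α) : IsInversion Γ α⁻¹ := by
  rwa [inv_eq_of_mul_eq_one_left h.mul_self]

lemma IsInversion.conj_tw (h : IsInversion Γ α) (hp : p ≠ w) (hpw : st Γ p ⊆ st Γ w) (ε : ℤ) :
    α * tw (Twd.single hp hpw ε) * α = tw (Twd.single hp hpw ε) ∨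
      α * tw (Twd.single hp hpw ε) * α = (tw (Twd.single hp hpw ε))⁻¹ := by
  have hc : Commute (gen Γ p) (gen Γ w) := gen_commute (adj_of_st_subset hp hpw).symm
  have key {f : V → ℤ} (hf : Twd Γ w f) (hf' : ∀ x ≠ p, f x = 0)
      (hfp : (α * tw (Twd.single hp hpw ε) * α) (gen Γ p) = gen Γ p * gen Γ w ^ f p) :
      α * tw (Twd.single hp hpw ε) * α = tw hf := by
    refine mulEquiv_ext_gen fun x => ?_
    by_cases hx : x = p
    · rw [hx, hfp, tw_gen]
    · rw [tw_gen_of_eq_zero hf (hf' x hx)]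
      have ht := tw_gen_of_eq_zero (Twd.single hp hpw ε) (single_of_ne hx ε)
      have hαα : α (α (gen Γ x)) = gen Γ x := by
        rw [← MulAut.mul_apply, h.mul_self, MulAut.one_apply]
      rw [MulAut.mul_apply, MulAut.mul_apply]
      have : tw (Twd.single hp hpw ε) (α (gen Γ x)) = α (gen Γ x) := by
        obtain ⟨v, hv, h⟩ := h
        by_cases hxv : x = v
        · subst hxv; rw [hv, map_inv, ht]
        · rw [h x hxv, ht]
      rw [this, hαα]
  have htp : tw (Twd.single hp hpw ε) (gen Γ p) = gen Γ p * gen Γ w ^ ε := by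
    rw [tw_gen, Pi.single_eq_same]
  have hneg := key (Twd.single hp hpw ε).neg fun x hx => by simp [hx]
  obtain ⟨v, hv, hα⟩ := id h
  rw [tw_inv]
  by_cases hvp : v = p
  · subst hvp
    refine Or.inr (hneg ?_)
    simp only [MulAut.mul_apply, hv, map_inv, htp, map_mul, map_zpow, hα w (Ne.symm hp),
      Pi.neg_apply, Pi.single_eq_same, mul_inv_rev, inv_inv, zpow_neg]
    exact (hc.zpow_right ε).inv_right.eq.symm
  · by_cases hvw : v = w
    · subst hvw
      refine Or.inr (hneg ?_)
      simp only [MulAut.mul_apply, hα p hp, htp, map_mul, map_zpow, hv, Pi.neg_apply,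
        Pi.single_eq_same, inv_zpow, zpow_neg]
    · refine Or.inl (key _ (fun x hx => single_of_ne hx ε) ?_)
      simp only [MulAut.mul_apply, hα p (Ne.symm hvp), htp, map_mul, map_zpow,
        hα w (Ne.symm hvw), Pi.single_eq_same]

lemma starRep_elem (hp : p ≠ w) (hpw : st Γ p ⊆ st Γ w) (ε : ℤ)
    (hm : elem p w hp ε ∈ starMat Γ) : starRep Γ ⟨elem p w hp ε, hm⟩ = tw (Twd.single hp hpw ε) := by
  refine mulEquiv_ext_gen fun x => ?_
  rw [starRep_gen, elem_apply]
  by_cases hx : x = p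
  · subst hx
    have e : Function.update (Pi.single x 1 : V → ℤ) w ((Pi.single x 1 : V → ℤ) w + ε *
        (Pi.single x 1 : V → ℤ) x) = Pi.single x 1 + Pi.single w ε := by
      ext i
      by_cases hi : i = w
      · subst hi; simp
      · simp [hi]
    rw [e, mon_add (single_mem_starVec x 1) (starVec_mono hpw (single_mem_starVec w ε)),
      mon_single, mon_single, zpow_one, tw_gen, Pi.single_eq_same]
  · rw [tw_gen_of_eq_zero _ (single_of_ne hx ε)]
    have e : Function.update (Pi.single x 1 : V → ℤ) w ((Pi.single x 1 : V → ℤ) w + ε *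
        (Pi.single x 1 : V → ℤ) p) = Pi.single x 1 := by
      rw [single_of_ne (Ne.symm hx), mul_zero, add_zero, Function.update_eq_self]
    rw [e, mon_single, zpow_one]

lemma isInversion_starRep_flipAt (v : V) (hm : flipAt v ∈ starMat Γ) :
    IsInversion Γ (starRep Γ ⟨flipAt v, hm⟩) := by
  refine ⟨v, ?_, fun x hx => ?_⟩
  · rw [starRep_gen, flipAt_apply]
    have e : Function.update (Pi.single v 1 : V → ℤ) v (-(Pi.single v 1 : V → ℤ) v) =
        Pi.single v (-1) := by
      ext i
      by_cases hi : i = v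
      · subst hi; simp
      · simp [hi]
    rw [e, mon_single, zpow_neg, zpow_one]
  · rw [starRep_gen, flipAt_apply]
    have e : Function.update (Pi.single x 1 : V → ℤ) v (-(Pi.single x 1 : V → ℤ) v) =
        Pi.single x 1 := by
      ext i
      by_cases hi : i = v
      · subst hi; simp [Ne.symm hx]
      · simp [hi]
    rw [e, mon_single, zpow_one]

lemma elem_mem_starMat (hp : p ≠ w) (hpw : st Γ p ⊆ st Γ w) (ε : ℤ) :
    elem p w hp ε ∈ starMat Γ :=
  letI := starPreorder Γ
  elem_mem hp ε (Finset.mem_univ _) hpw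

lemma twSet_subset_shortGroup (hα : α ∈ twSet Γ w) : α ∈ shortGroup Γ := by
  obtain ⟨p, hp, h, ε, hε, rfl⟩ := hα
  exact ⟨_, starRep_elem hp h ε (elem_mem_starMat hp h ε)⟩

lemma shortGroup_le_closure : shortGroup Γ ≤
    Subgroup.closure ((⋃ w, twSet Γ w) ∪ {α | IsInversion Γ α ∧ α ∈ shortGroup Γ}) := by
  conv_lhs => rw [shortGroup_eq_closure]
  refine Subgroup.closure_mono ?_
  rintro _ ⟨⟨φ, hm⟩, ⟨p, w, h, ε, hε, hpw, rfl⟩ | ⟨a, rfl⟩, rfl⟩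
  · exact Or.inl (Set.mem_iUnion.2 ⟨w, p, h, hpw, ε, hε, starRep_elem h hpw ε hm⟩)
  · exact Or.inr ⟨isInversion_starRep_flipAt a hm, ⟨_, rfl⟩⟩

variable (Γ) in
/-- The endomorphism killing the generator `v`. -/
def killHom (v : V) : Raag Γ →* Raag Γ :=
  PresentedGroup.toGroup (f := fun u => if u = v then 1 else gen Γ u) (by
    rintro r ⟨u, u', huv, rfl⟩
    simp only [map_mul, map_inv, FreeGroup.lift_apply_of]
    rw [mul_inv_eq_one, mul_inv_eq_iff_eq_mul]
    split_ifs
    · simp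
    · simp
    · simp
    · exact gen_commute huv)

lemma killHom_gen (v u : V) : killHom Γ v (gen Γ u) = if u = v then 1 else gen Γ u :=
  PresentedGroup.toGroup.of _

lemma killHom_ev (v : V) (x : V × Bool) :
    killHom Γ v (ev Γ x) = if x.1 = v then 1 else ev Γ x := by
  unfold ev
  split_ifs <;> simp_all [killHom_gen]

lemma killHom_wh {a : V × Bool} {s : Option (V × Bool) → ℤ} (h : Adm Γ a.1 s) (y : Raag Γ) :
    killHom Γ a.1 (wh h y) = killHom Γ a.1 y := by
  have : (killHom Γ a.1).comp (wh h : Raag Γ →* Raag Γ) = killHom Γ a.1 := by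
    refine PresentedGroup.ext fun u => ?_
    change killHom Γ a.1 (wh h (gen Γ u)) = killHom Γ a.1 (gen Γ u)
    rw [wh_gen, whGen]
    split_ifs
    · rfl
    · simp [killHom_ev]
  exact DFunLike.congr_fun this y

lemma killHom_mon {v : V} {z : V → ℤ} (hz : z v = 0) : killHom Γ v (mon Γ z) = mon Γ z := by
  rw [mon, map_list_prod, List.map_map]
  refine congrArg List.prod (List.map_congr_left fun u _ => ?_)
  rw [Function.comp_apply, map_zpow, killHom_gen]
  split_ifs with hu
  · rw [hu, hz, zpow_zero, zpow_zero]
  · rfl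

section Length

variable [DecidableRel Γ.Adj]

lemma len_killHom_le (v : V) (y : Raag Γ) : len Γ (killHom Γ v y) ≤ len Γ y := by
  obtain ⟨u, hu, rfl⟩ := exists_red_evl Γ y
  have e : killHom Γ v (evl Γ u) = evl Γ (u.filter fun x => x.1 ≠ v) := by
    clear hu
    induction u with
    | nil => simp
    | cons x u ih =>
      rw [evl_cons, map_mul, killHom_ev, ih]
      by_cases hx : x.1 = v <;> simp [hx]
  rw [e, hu.len]
  exact (len_evl_le _).trans (List.length_filter_le _ _)

lemma len_mon_le_len_wh {a : V × Bool} {s : Option (V × Bool) → ℤ} (h : Adm Γ a.1 s) {u : V}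
    {z : V → ℤ} (hz : z ∈ starVec Γ u) : len Γ (mon Γ z) ≤ len Γ (wh h (mon Γ z)) := by
  by_cases hza : z a.1 = 0
  · calc len Γ (mon Γ z) = len Γ (killHom Γ a.1 (wh h (mon Γ z))) := by
          rw [killHom_wh, killHom_mon hza]
      _ ≤ _ := len_killHom_le _ _
  · have e : wh h (mon Γ z) = mon Γ z := by
      rw [mon, map_list_prod, List.map_map]
      refine congrArg List.prod (List.map_congr_left fun x _ => ?_)
      rw [Function.comp_apply, map_zpow]
      by_cases hx : z x = 0
      · rw [hx, zpow_zero, zpow_zero]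
      · rw [wh_gen_of_mem_st h (mem_st_of_starVec (self_mem_st u) hz hz hza hx)]
    rw [e]

lemma autNorm_le_of_shortGroup {σ ω : MulAut (Raag Γ)} (hσ : σ ∈ shortGroup Γ)
    (hω : ω ∈ longGen Γ) : autNorm Γ σ ≤ autNorm Γ (ω * σ) := by
  rcases hω with ⟨A, a, h, rfl⟩ | hω
  · obtain ⟨φ, rfl⟩ := hσ
    unfold autNorm
    refine Finset.sum_le_sum fun v _ => ?_
    rw [MulAut.mul_apply, starRep_gen]
    exact len_mon_le_len_wh h.adm (starMat_mem φ.2 v)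
  · rw [hω.1.autNorm_mul]

lemma longGroup_inf_shortGroup_finite :
    ((longGroup Γ ⊓ shortGroup Γ : Subgroup (MulAut (Raag Γ))) : Set (MulAut (Raag Γ))).Finite := by
  refine sgn_finite.subset ?_
  rintro σ ⟨hL, hS⟩
  refine isSgn_of_autNorm (le_antisymm ?_ (card_le_autNorm σ))
  by_contra hlt
  obtain ⟨ω, hω, h⟩ := (longGroup_peakReducible (Γ := Γ)).exists_lt ⟨σ, hL⟩ (by
    rw [autNorm_one, Subgroup.smul_def, smul_eq_mul, mul_one]
    exact not_le.1 hlt)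
  simp only [Subgroup.smul_def, smul_eq_mul, mul_one, Subgroup.coe_mul] at h
  exact absurd h (not_lt.2 (autNorm_le_of_shortGroup hS hω))

lemma exists_conj_eq {t l : MulAut (Raag Γ)} (ht : t ∈ twSet Γ w)
    (hl : l ∈ whSet Γ ∪ {α | IsInversion Γ α}) :
    ∃ c ∈ longGroup Γ, ∃ τ ∈ Subgroup.closure (twSet Γ w),
      t * l * t⁻¹ = l * c * τ ∧ ∀ t' ∈ twSet Γ w, c * t' = t' * c := by
  have hone {τ : MulAut (Raag Γ)} (hτ : τ ∈ Subgroup.closure (twSet Γ w))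
      (h : t * l * t⁻¹ = l * τ) : ∃ c ∈ longGroup Γ, ∃ τ ∈ Subgroup.closure (twSet Γ w),
      t * l * t⁻¹ = l * c * τ ∧ ∀ t' ∈ twSet Γ w, c * t' = t' * c :=
    ⟨1, one_mem _, τ, hτ, by rw [h, mul_one], fun t' _ => by rw [one_mul, mul_one]⟩
  have htc := Subgroup.subset_closure ht
  obtain ⟨p, hp, hpw, ε, hε, rfl⟩ := ht
  rcases hl with ⟨A, a, h, rfl⟩ | hl
  · have key {A : Option (V × Bool) → Bool} (h : IsWh Γ A (p, true)) :
        ∃ c ∈ longGroup Γ, ∃ τ ∈ Subgroup.closure (twSet Γ w),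
        tw (Twd.single hp hpw ε) * wh h.adm * (tw (Twd.single hp hpw ε))⁻¹ = wh h.adm * c * τ ∧
          ∀ t' ∈ twSet Γ w, c * t' = t' * c := by
      obtain ⟨c, hc, f, hf, e, hcomm⟩ := exists_tw_wh_conj h hp hpw ε hε
      refine ⟨c, whSet_subset_longGroup hc, _, tw_mem_closure hf, e, ?_⟩
      rintro _ ⟨q, hq, hqw, δ, -, rfl⟩
      exact hcomm _ _
    by_cases ha : a.1 = p
    · subst ha
      obtain ⟨v, b⟩ := a
      cases b
      · rw [← h.wh_flip]
        exact key h.flip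
      · exact key h
    · refine hone (one_mem _) ?_
      rw [tw_single_wh_commute hp hpw ε h.adm ha, mul_inv_cancel_right, mul_one]
  · refine hone (τ := l * tw (Twd.single hp hpw ε) * l * (tw (Twd.single hp hpw ε))⁻¹) ?_ ?_
    · refine mul_mem ?_ (inv_mem htc)
      rcases hl.conj_tw hp hpw ε with e | e
      · rw [e]; exact htc
      · rw [e]; exact inv_mem htc
    · have := hl.mul_self
      simp only [← mul_assoc]
      rw [this, one_mul]

theorem sup_isFinitelyPresented :
    Group.IsFinitelyPresented (longGroup Γ ⊔ shortGroup Γ : Subgroup (MulAut (Raag Γ))) := by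
  refine isFinitelyPresented_sup (longGroup Γ) (shortGroup Γ) longGroup_inf_shortGroup_finite
    (fun w => twSet Γ w) (fun _ => twSet_finite) (fun _ _ => twSet_inv)
    (fun _ _ => twSet_subset_shortGroup) ?_ (whSet Γ ∪ {α | IsInversion Γ α})
    (whSet_finite.union (sgn_finite.subset fun _ h => IsInversion.isSgn h)) ?_ rfl
    (fun _ _ ht _ hl => exists_conj_eq ht hl)
  · refine shortGroup_le_closure.trans (Subgroup.closure_mono (Set.union_subset_union_right _ ?_))
    rintro α ⟨h, hα⟩
    exact ⟨Subgroup.subset_closure (Or.inr h), hα⟩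
  · rintro l (h | h)
    · exact Or.inl (whSet_inv h)
    · exact Or.inr h.inv

end Length

end Generation

section Conclusion

variable {Γ : SimpleGraph V} {v : V} {α : MulAut (Raag Γ)} {s : Option (V × Bool) → ℤ} {Y : Set V}

section Components

variable {S : Set V}

lemma IsCompOf.subset (hY : IsCompOf Γ S Y) : Y ⊆ S := by
  obtain ⟨C, rfl⟩ := hY
  rintro _ ⟨x, _, rfl⟩
  exact x.2

lemma IsCompOf.mem_of_adj (hY : IsCompOf Γ S Y) {x y : V} (hx : x ∈ Y) (hxy : Γ.Adj x y)
    (hy : y ∈ S) : y ∈ Y := by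
  obtain ⟨C, rfl⟩ := hY
  obtain ⟨x, hx, rfl⟩ := hx
  refine ⟨⟨y, hy⟩, ?_, rfl⟩
  rw [ConnectedComponent.mem_supp_iff] at hx ⊢
  rw [← hx]
  exact ConnectedComponent.connectedComponentMk_eq_of_adj hxy.symm

lemma IsCompOf.eq_of_adj_eq (hY : IsCompOf Γ S Y) (f : V → ℤ)
    (hf : ∀ x ∈ S, ∀ y ∈ S, Γ.Adj x y → f x = f y) {x y : V} (hx : x ∈ Y) (hy : y ∈ Y) :
    f x = f y := by
  obtain ⟨C, rfl⟩ := hY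
  obtain ⟨x, hx, rfl⟩ := hx
  obtain ⟨y, hy, rfl⟩ := hy
  rw [ConnectedComponent.mem_supp_iff] at hx hy
  obtain ⟨p⟩ := ConnectedComponent.exact (hx.trans hy.symm)
  clear hx hy
  induction p with
  | nil => rfl
  | cons h _ ih => exact (hf _ (Subtype.prop _) _ (Subtype.prop _) h).trans ih

lemma exists_isCompOf {u : V} (hu : u ∈ S) : ∃ Y, IsCompOf Γ S Y ∧ u ∈ Y :=
  ⟨_, ⟨(Γ.induce S).connectedComponentMk ⟨u, hu⟩, rfl⟩, ⟨u, hu⟩, rfl, rfl⟩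

end Components

open Classical in
/-- The weights defining a partial conjugation. -/
noncomputable def compWt (Y : Set V) : Option (V × Bool) → ℤ
  | none => 0
  | some x => if x.1 ∈ Y then 1 else 0

lemma not_mem_st_of_adj {x y : V} (hxy : Γ.Adj x y) (hx : ¬ Γ.Adj v x) (hy : ¬ Γ.Adj v y) :
    x ∈ (st Γ v)ᶜ := by
  rintro (rfl | h)
  · exact hy hxy
  · exact hx h

lemma adm_compWt (hY : IsCompOf Γ (st Γ v)ᶜ Y) : Adm Γ v (compWt Y) := by
  refine ⟨fun x hx => rfl, fun x y hxy hx hy => ?_⟩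
  have : x.1 ∈ Y ↔ y.1 ∈ Y :=
    ⟨fun h => hY.mem_of_adj h hxy (not_mem_st_of_adj hxy.symm hy hx),
      fun h => hY.mem_of_adj h hxy.symm (not_mem_st_of_adj hxy hx hy)⟩
  by_cases h : y.1 ∈ Y
  · simp [compWt, this.2 h, h]
  · simp [compWt, mt this.1 h, h]

lemma wh_compWt_gen (hY : IsCompOf Γ (st Γ v)ᶜ Y) {y : V} (hy : y ∈ Y) :
    wh (a := (v, true)) (adm_compWt hY) (gen Γ y) = (gen Γ v)⁻¹ * gen Γ y * gen Γ v := by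
  have hyv : y ≠ v := fun h => hY.subset hy (Or.inl h)
  rw [wh_gen, whGen, if_neg hyv, ev_true]
  simp [compWt, hy]

lemma wh_compWt_gen_of_notMem (hY : IsCompOf Γ (st Γ v)ᶜ Y) {y : V} (hy : y ∉ Y) :
    wh (a := (v, true)) (adm_compWt hY) (gen Γ y) = gen Γ y := by
  rw [wh_gen, whGen, ev_true]
  split_ifs
  · rfl
  · simp [compWt, hy]

lemma wh_compWt_mem_whSet (hY : IsCompOf Γ (st Γ v)ᶜ Y) :
    wh (a := (v, true)) (adm_compWt hY) ∈ whSet Γ := by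
  refine wh_mem_whSet _ 0 (Or.inl rfl) fun x _ _ => ?_
  simp only [compWt]
  split_ifs <;> simp

lemma isPartialConj_wh_compWt (hY : IsCompOf Γ (st Γ v)ᶜ Y) :
    IsPartialConj Γ (wh (a := (v, true)) (adm_compWt hY)) :=
  ⟨v, Y, hY, fun _ => wh_compWt_gen hY, fun _ => wh_compWt_gen_of_notMem hY⟩

lemma IsPartialConj.mem_whSet (h : IsPartialConj Γ α) : α ∈ whSet Γ := by
  obtain ⟨v, Y, hY, h1, h2⟩ := h
  have : α = wh (a := (v, true)) (adm_compWt hY) := mulEquiv_ext_gen fun x => by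
    by_cases hx : x ∈ Y
    · rw [h1 x hx, wh_compWt_gen hY hx]
    · rw [h2 x hx, wh_compWt_gen_of_notMem hY hx]
  rw [this]
  exact wh_compWt_mem_whSet hY

/-- The weights defining a transvection. -/
def letterWt (u : V) : Option (V × Bool) → ℤ
  | none => 0
  | some x => if x = (u, true) then 1 else 0

lemma adm_letterWt {u : V} (hvu : ¬ Γ.Adj v u) (hlk : ∀ y, Γ.Adj u y → Γ.Adj v y) :
    Adm Γ v (letterWt u) := by
  have key (x : V × Bool) (h : x.1 ≠ u) : letterWt u (some x) = 0 := by
    simp only [letterWt]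
    rw [if_neg]
    rintro rfl
    exact h rfl
  refine ⟨fun x hx => ?_, fun x y hxy hx hy => ?_⟩
  · have : x.1 ≠ u := by rintro rfl; exact hvu hx
    rw [key x this, key (bar x) (by rwa [bar_fst])]
  · rw [key x, key y]
    · rintro rfl; exact hx (hlk _ hxy.symm)
    · rintro rfl; exact hy (hlk _ hxy)

lemma wh_letterWt_gen {u : V} (huv : u ≠ v) (hvu : ¬ Γ.Adj v u)
    (hlk : ∀ y, Γ.Adj u y → Γ.Adj v y) :
    wh (a := (v, true)) (adm_letterWt hvu hlk) (gen Γ u) = gen Γ u * gen Γ v := by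
  rw [wh_gen, whGen, if_neg huv, ev_true]
  simp [letterWt]

lemma wh_letterWt_gen_of_ne {u : V} (hvu : ¬ Γ.Adj v u) (hlk : ∀ y, Γ.Adj u y → Γ.Adj v y) {x : V}
    (hx : x ≠ u) : wh (a := (v, true)) (adm_letterWt hvu hlk) (gen Γ x) = gen Γ x := by
  rw [wh_gen, whGen, ev_true]
  split_ifs
  · rfl
  · simp [letterWt, hx]

lemma isTransvection_wh_letterWt {u : V} (huv : u ≠ v) (hvu : ¬ Γ.Adj v u)
    (hlk : ∀ y, Γ.Adj u y → Γ.Adj v y) :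
    IsTransvection Γ (wh (a := (v, true)) (adm_letterWt hvu hlk)) :=
  ⟨u, v, huv, fun y hy => Or.inr (hlk y hy), wh_letterWt_gen huv hvu hlk,
    fun _ => wh_letterWt_gen_of_ne hvu hlk⟩

lemma IsTransvection.mem_sup (h : IsTransvection Γ α) : α ∈ longGroup Γ ⊔ shortGroup Γ := by
  obtain ⟨u, v, huv, hle, h1, h2⟩ := h
  by_cases hadj : Γ.Adj v u
  · refine Subgroup.mem_sup_right (twSet_subset_shortGroup (w := v) ⟨u, huv, ?_, 1, Or.inl rfl, ?_⟩)
    · rintro y (rfl | hy)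
      · exact Or.inr hadj
      · exact hle hy
    · refine mulEquiv_ext_gen fun x => ?_
      by_cases hx : x = u
      · rw [hx, h1, tw_gen, Pi.single_eq_same, zpow_one]
      · rw [h2 x hx, tw_gen_of_eq_zero _ (single_of_ne hx 1)]
  · have hlk (y : V) (hy : Γ.Adj u y) : Γ.Adj v y := by
      refine (mem_st.1 (hle hy)).resolve_left ?_
      rintro rfl
      exact hadj hy.symm
    refine Subgroup.mem_sup_left (whSet_subset_longGroup ?_)
    have : α = wh (a := (v, true)) (adm_letterWt hadj hlk) := mulEquiv_ext_gen fun x => by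
      by_cases hx : x = u
      · rw [hx, h1, wh_letterWt_gen huv hadj hlk]
      · rw [h2 x hx, wh_letterWt_gen_of_ne hadj hlk hx]
    rw [this]
    refine wh_mem_whSet _ 0 (Or.inl rfl) fun x _ _ => ?_
    simp only [letterWt]
    split_ifs <;> simp

lemma Aut0_le_sup : Aut0 Γ ≤ longGroup Γ ⊔ shortGroup Γ := by
  refine (Subgroup.closure_le _).2 ?_
  rintro α (h | h | h)
  · exact h.mem_sup
  · exact Subgroup.mem_sup_left (whSet_subset_longGroup h.mem_whSet)
  · exact Subgroup.mem_sup_left (Subgroup.subset_closure (Or.inr h))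

lemma IsTransvection.mem_Aut0 (h : IsTransvection Γ α) : α ∈ Aut0 Γ :=
  Subgroup.subset_closure (Or.inl h)

lemma IsPartialConj.mem_Aut0 (h : IsPartialConj Γ α) : α ∈ Aut0 Γ :=
  Subgroup.subset_closure (Or.inr (Or.inl h))

lemma IsInversion.mem_Aut0 (h : IsInversion Γ α) : α ∈ Aut0 Γ :=
  Subgroup.subset_closure (Or.inr (Or.inr h))

lemma shortGroup_le_Aut0 : shortGroup Γ ≤ Aut0 Γ := by
  refine shortGroup_le_closure.trans ((Subgroup.closure_le _).2 ?_)
  rintro α (h | h)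
  · obtain ⟨w, p, hp, hpw, ε, hε, rfl⟩ := Set.mem_iUnion.1 h
    have h1 : tw (Twd.single hp hpw 1) ∈ Aut0 Γ := by
      refine IsTransvection.mem_Aut0 ⟨p, w, hp, fun y hy => hpw (Or.inr hy), ?_, fun x hx => ?_⟩
      · rw [tw_gen, Pi.single_eq_same, zpow_one]
      · exact tw_gen_of_eq_zero _ (single_of_ne hx 1)
    rcases hε with rfl | rfl
    · exact h1
    · have h2 := inv_mem h1
      rw [tw_inv, tw_congr _ (Twd.single hp hpw (-1))
        (Pi.single_neg (f := fun _ => ℤ) p 1).symm] at h2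
      exact h2
  · exact h.1.mem_Aut0

lemma Adm.zsmul (h : Adm Γ v s) (n : ℤ) : Adm Γ v (n • s) :=
  ⟨fun x hx => by simp [h.lk x hx], fun x y hxy hx hy => by simp [h.closed x y hxy hx hy]⟩

lemma wh_zsmul_mem {H : Subgroup (MulAut (Raag Γ))} {a : V × Bool} (h : Adm Γ a.1 s)
    (hH : wh h ∈ H) (n : ℤ) : wh (h.zsmul n) ∈ H := by
  induction n using Int.induction_on with
  | zero =>
    rw [wh_congr (h.zsmul 0) Adm.zero 0 (by simp) (by simp), wh_zero]
    exact one_mem _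
  | succ n ih =>
    have h1 := mul_mem ih hH
    rw [wh_mul] at h1
    rwa [wh_congr (h.zsmul (n + 1)) ((h.zsmul n).add h) 0 (by simp; ring) (by intros; simp; ring)]
  | pred n ih =>
    have h1 := mul_mem ih (inv_mem hH)
    rw [wh_inv, wh_mul] at h1
    rwa [wh_congr (h.zsmul (-n - 1)) ((h.zsmul (-n)).add h.neg) 0 (by simp; ring)
      (by intros; simp; ring)]

lemma wh_mem_Aut0_of_false (h : Adm Γ v s) (hs : ∀ u ∉ st Γ v, s (some (u, false)) = s none) :
    wh (a := (v, true)) h ∈ Aut0 Γ := by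
  classical
  induction hn : (Finset.univ.filter fun u => u ∉ st Γ v ∧ s (some (u, true)) ≠ s none).card using
    Nat.strong_induction_on generalizing s with
  | _ n ih =>
    by_cases hall : ∀ u ∉ st Γ v, s (some (u, true)) = s none
    · rw [wh_congr (a := (v, true)) h Adm.zero (s none) (by simp), wh_zero]
      · exact one_mem _
      · rintro ⟨x, b⟩ hx hvx
        have hxst : x ∉ st Γ v := fun h' => (mem_st.1 h').elim hx hvx
        cases b
        · simp [hs x hxst]
        · simp [hall x hxst]
    · push Not at hall
      obtain ⟨u, hu, hne⟩ := hall
      have huv : u ≠ v := fun h' => hu (Or.inl h')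
      have hvu : ¬ Γ.Adj v u := fun h' => hu (Or.inr h')
      have hlk (y : V) (hy : Γ.Adj u y) : Γ.Adj v y := by
        by_contra hvy
        exact hne ((h.closed (u, true) (y, false) hy hvu hvy).trans
          (hs y (not_mem_st_of_adj hy.symm hvy hvu)))
      have hm := wh_zsmul_mem (a := (v, true)) (adm_letterWt hvu hlk)
        (isTransvection_wh_letterWt huv hvu hlk).mem_Aut0 (s none - s (some (u, true)))
      rw [← Subgroup.mul_mem_cancel_left _ hm, wh_mul]
      refine ih _ ?_ _ ?_ rfl
      · rw [← hn]
        apply Finset.card_lt_card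
        rw [Finset.ssubset_iff_of_subset]
        · exact ⟨u, by simp [hu, hne], by simp [letterWt]⟩
        · intro x hx
          by_cases hxu : x = u
          · subst hxu; simp [letterWt] at hx
          · simpa [letterWt, hxu] using hx
      · intro x hx
        simpa [letterWt] using hs x hx

lemma wh_mem_Aut0 (h : Adm Γ v s) : wh (a := (v, true)) h ∈ Aut0 Γ := by
  classical
  induction hn : (Finset.univ.filter fun u => u ∉ st Γ v ∧ s (some (u, false)) ≠ s none).card using
    Nat.strong_induction_on generalizing s with
  | _ n ih =>
    by_cases hall : ∀ u ∉ st Γ v, s (some (u, false)) = s none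
    · exact wh_mem_Aut0_of_false h hall
    · push Not at hall
      obtain ⟨u, hu, hne⟩ := hall
      obtain ⟨Y, hY, huY⟩ := exists_isCompOf (Γ := Γ) (S := (st Γ v)ᶜ) hu
      have hconst {x : V} (hx : x ∈ Y) : s (some (x, false)) = s (some (u, false)) :=
        hY.eq_of_adj_eq (fun x => s (some (x, false))) (fun x hx y hy hxy =>
          h.closed (x, false) (y, false) hxy (fun h' => hx (Or.inr h'))
            fun h' => hy (Or.inr h')) hx huY
      have hm := wh_zsmul_mem (a := (v, true)) (adm_compWt hY)
        (isPartialConj_wh_compWt hY).mem_Aut0 (s none - s (some (u, false)))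
      rw [← Subgroup.mul_mem_cancel_left _ hm, wh_mul]
      refine ih _ ?_ _ rfl
      rw [← hn]
      apply Finset.card_lt_card
      rw [Finset.ssubset_iff_of_subset]
      · exact ⟨u, by simp [hu, hne], by simp [compWt, huY]⟩
      · intro x hx
        by_cases hxY : x ∈ Y
        · simp [compWt, hxY, hconst hxY] at hx
        · simpa [compWt, hxY] using hx

lemma longGroup_le_Aut0 : longGroup Γ ≤ Aut0 Γ := by
  refine (Subgroup.closure_le _).2 ?_
  rintro α (⟨A, ⟨v, b⟩, h, rfl⟩ | h)
  · cases b
    · have := wh_mem_Aut0 (v := v) h.flip.adm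
      rw [SetLike.mem_coe, ← h.wh_flip]
      exact this
    · exact wh_mem_Aut0 h.adm
  · exact IsInversion.mem_Aut0 h

variable (Γ) in
theorem Aut0_isFinitelyPresented : Group.IsFinitelyPresented (Aut0 Γ) := by
  classical
  rw [le_antisymm Aut0_le_sup (sup_le longGroup_le_Aut0 shortGroup_le_Aut0)]
  exact sup_isFinitelyPresented

end Conclusion

theorem Aut0_finitely_presented (Γ : SimpleGraph V) :
    ∃ (S : Type) (_ : Finite S) (R : Set (FreeGroup S)) (_ : R.Finite),
      Nonempty (Aut0 Γ ≃* PresentedGroup R) := by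
  have := Aut0_isFinitelyPresented Γ
  obtain ⟨n, R, hR, e⟩ :=
    Group.IsFinitelyPresented.exists_mulEquiv_presentedGroup (G := Aut0 Γ)
  exact ⟨Fin n, inferInstance, R, hR, e⟩

end RaagPaper
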